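/- Fix an integer d ≥ 2 and a real 0 < c < c_d^*. Then for every ε > 0 there exists a constant K = K(d,c,ε) such that for all sufficiently large n, with probability at least 1 − ε over Y = Y_d(n, c/n) the following holds: the number of (d+2)-element subsets τ of [n] all of whose (d+1)-element subsets are d-faces of Y is at most K, and the kernel of the boundary operator ∂_d of Y (i.e., H_d(Y;ℝ)) is spanned by the boundary cycles ∂_{d+1}τ of these (d+2)-subsets; in particular, if there are no such subsets then H_d(Y;ℝ) = 0. -/

import Mathlib

open Finset Filter
open scoped Classical

noncomputable section

/-- The set of all possible `d`-faces: `(d+1)`-element subsets of `[n]`. -/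
def allFaces (n d : ℕ) : Finset (Finset (Fin n)) :=
  Finset.univ.filter (fun σ => σ.card = d + 1)

/-- Probability of the event `E` under `Y_d(n,p)`. -/
def probY (n d : ℕ) (p : ℝ) (E : Finset (Finset (Fin n)) → Prop) : ℝ :=
  ∑ F ∈ (allFaces n d).powerset,
    if E F then p ^ F.card * (1 - p) ^ ((allFaces n d).card - F.card) else 0

/-- Expectation of `X` under `Y_d(n,p)`. -/
def expectY (n d : ℕ) (p : ℝ) (X : Finset (Finset (Fin n)) → ℝ) : ℝ :=
  ∑ F ∈ (allFaces n d).powerset,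
    p ^ F.card * (1 - p) ^ ((allFaces n d).card - F.card) * X F

/-- Coefficient of the `d`-face `τ` in the boundary of `σ`. -/
def bdCoeff {n : ℕ} (τ σ : Finset (Fin n)) : ℝ :=
  if τ ⊆ σ ∧ τ.card + 1 = σ.card then
    ∑ v ∈ σ \ τ, (-1 : ℝ) ^ (σ.filter (fun w => w < v)).card
  else 0

/-- The boundary operator `∂_d(F) : ℝ^F → ℝ^{(d-1)-faces}`. -/
def boundaryMap (n : ℕ) (F : Finset (Finset (Fin n))) :
    (↥F → ℝ) →ₗ[ℝ] (Finset (Fin n) → ℝ) where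
  toFun x := fun τ => ∑ σ ∈ F.attach, x σ * bdCoeff τ σ.1
  map_add' x y := by
    funext τ
    simp [add_mul, Finset.sum_add_distrib]
  map_smul' c x := by
    funext τ
    simp [Finset.mul_sum, mul_assoc]

/-- Dimension of the kernel of `∂_d(F)`, i.e. `dim H_d`. -/
def dimKer (n : ℕ) (F : Finset (Finset (Fin n))) : ℕ :=
  Module.finrank ℝ (LinearMap.ker (boundaryMap n F))

/-- The real shadow of `F`. -/
def shadowR (n d : ℕ) (F : Finset (Finset (Fin n))) : Finset (Finset (Fin n)) :=
  (allFaces n d).filter (fun σ => σ ∉ F ∧ dimKer n F < dimKer n (insert σ F))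

/-- The `(d+2)`-subsets all of whose `(d+1)`-subsets are faces of `F`. -/
def simplexBoundaries (n d : ℕ) (F : Finset (Finset (Fin n))) : Finset (Finset (Fin n)) :=
  Finset.univ.filter (fun τ => τ.card = d + 2 ∧ ∀ s ∈ τ.powerset, s.card = d + 1 → s ∈ F)

/-- The boundary cycle of the `(d+2)`-subset `τ`, as a vector in `ℝ^F`. -/
def simplexCycle (n : ℕ) (F : Finset (Finset (Fin n))) (τ : Finset (Fin n)) : ↥F → ℝ :=
  fun σ => bdCoeff σ.1 τ


section

/-- Expectation over a random subset of `E`, each element kept with probability `p`. -/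
def Ex {α : Type*} (E : Finset α) (p : ℝ) (X : Finset α → ℝ) : ℝ :=
  ∑ F ∈ E.powerset, p ^ F.card * (1 - p) ^ (E.card - F.card) * X F

lemma Ex_insert {α : Type*} [DecidableEq α] {E : Finset α} {e : α} (he : e ∉ E) (p : ℝ) (X : Finset α → ℝ) :
    Ex (insert e E) p X = p * Ex E p (fun F => X (insert e F)) + (1 - p) * Ex E p X := by
  unfold Ex
  rw [Finset.sum_powerset_insert he, add_comm, Finset.mul_sum, Finset.mul_sum]
  congr 1
  · refine Finset.sum_congr rfl fun F hF => ?_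
    have hF' := Finset.mem_powerset.1 hF
    have : e ∉ F := fun h => he (hF' h)
    rw [Finset.card_insert_of_notMem this, Finset.card_insert_of_notMem he, Nat.add_sub_add_right]
    ring
  · refine Finset.sum_congr rfl fun F hF => ?_
    have hF' := Finset.card_le_card (Finset.mem_powerset.1 hF)
    rw [Finset.card_insert_of_notMem he, Nat.sub_add_comm hF']
    ring

lemma Ex_empty {α : Type*} [DecidableEq α] (p : ℝ) (X : Finset α → ℝ) : Ex ∅ p X = X ∅ := by
  simp [Ex]

lemma Ex_erase {α : Type*} [DecidableEq α] {E : Finset α} {e : α} (he : e ∈ E) (p : ℝ) (X : Finset α → ℝ) :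
    Ex E p X = p * Ex (E.erase e) p (fun F => X (insert e F)) + (1 - p) * Ex (E.erase e) p X := by
  conv_lhs => rw [← Finset.insert_erase he]
  exact Ex_insert (Finset.notMem_erase _ _) p X

lemma Ex_congr {α : Type*} [DecidableEq α] {E : Finset α} {p : ℝ} {X Y : Finset α → ℝ}
    (h : ∀ F ⊆ E, X F = Y F) : Ex E p X = Ex E p Y := by
  unfold Ex
  exact Finset.sum_congr rfl fun F hF => by rw [h F (Finset.mem_powerset.1 hF)]

lemma Ex_add {α : Type*} [DecidableEq α] (E : Finset α) (p : ℝ) (X Y : Finset α → ℝ) :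
    Ex E p (fun F => X F + Y F) = Ex E p X + Ex E p Y := by
  simp [Ex, mul_add, Finset.sum_add_distrib]

lemma Ex_mul {α : Type*} [DecidableEq α] (E : Finset α) (p a : ℝ) (X : Finset α → ℝ) :
    Ex E p (fun F => a * X F) = a * Ex E p X := by
  unfold Ex
  rw [Finset.mul_sum]
  exact Finset.sum_congr rfl fun F _ => by ring

lemma Ex_sub {α : Type*} [DecidableEq α] (E : Finset α) (p : ℝ) (X Y : Finset α → ℝ) :
    Ex E p (fun F => X F - Y F) = Ex E p X - Ex E p Y := by
  simp [Ex, mul_sub, Finset.sum_sub_distrib]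

lemma Ex_sum {α ι : Type*} [DecidableEq α] (E : Finset α) (p : ℝ) (s : Finset ι) (X : ι → Finset α → ℝ) :
    Ex E p (fun F => ∑ i ∈ s, X i F) = ∑ i ∈ s, Ex E p (X i) := by
  unfold Ex
  simp_rw [Finset.mul_sum]
  exact Finset.sum_comm

lemma Ex_const {α : Type*} [DecidableEq α] (E : Finset α) (p a : ℝ) : Ex E p (fun _ => a) = a := by
  induction E using Finset.induction_on with
  | empty => exact Ex_empty _ _
  | insert e E he ih => rw [Ex_insert he, ih]; ring

lemma Ex_mono {α : Type*} [DecidableEq α] {E : Finset α} {p : ℝ} (hp0 : 0 ≤ p) (hp1 : p ≤ 1)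
    {X Y : Finset α → ℝ} (h : ∀ F ⊆ E, X F ≤ Y F) : Ex E p X ≤ Ex E p Y := by
  unfold Ex
  refine Finset.sum_le_sum fun F hF => mul_le_mul_of_nonneg_left (h F (Finset.mem_powerset.1 hF)) ?_
  have : 0 ≤ 1 - p := by linarith
  positivity

lemma Ex_nonneg {α : Type*} [DecidableEq α] {E : Finset α} {p : ℝ} (hp0 : 0 ≤ p) (hp1 : p ≤ 1)
    {X : Finset α → ℝ} (h : ∀ F ⊆ E, 0 ≤ X F) : 0 ≤ Ex E p X := by
  have := Ex_mono (X := fun _ => 0) hp0 hp1 h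
  rwa [Ex_const] at this

lemma Ex_le_one {α : Type*} [DecidableEq α] {E : Finset α} {p : ℝ} (hp0 : 0 ≤ p) (hp1 : p ≤ 1)
    {X : Finset α → ℝ} (h : ∀ F ⊆ E, X F ≤ 1) : Ex E p X ≤ 1 := by
  have := Ex_mono (Y := fun _ => 1) hp0 hp1 h
  rwa [Ex_const] at this

lemma Ex_subset {α : Type*} [DecidableEq α] {E A : Finset α} (hA : A ⊆ E) (p : ℝ) :
    Ex E p (fun F => if A ⊆ F then 1 else 0) = p ^ A.card := by
  induction A using Finset.induction_on generalizing E with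
  | empty => simp [Ex_const]
  | insert a A ha ih =>
    have haE : a ∈ E := hA (Finset.mem_insert_self _ _)
    rw [Ex_erase haE, Finset.card_insert_of_notMem ha, pow_succ]
    have hAE : A ⊆ E.erase a := fun x hx => Finset.mem_erase.2
      ⟨fun h => ha (h ▸ hx), hA (Finset.mem_insert_of_mem hx)⟩
    have h1 : Ex (E.erase a) p (fun F => if insert a A ⊆ insert a F then (1 : ℝ) else 0)
        = p ^ A.card := by
      rw [← ih hAE]
      refine Ex_congr fun F _ => ?_
      have : insert a A ⊆ insert a F ↔ A ⊆ F := by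
        rw [Finset.insert_subset_insert_iff ha]
      simp [this]
    have h2 : Ex (E.erase a) p (fun F => if insert a A ⊆ F then (1 : ℝ) else 0) = 0 := by
      refine (Ex_congr (Y := fun _ => 0) fun F hF => ?_).trans (Ex_const _ _ _)
      rw [if_neg]
      intro h
      exact Finset.notMem_erase a E (hF (h (Finset.mem_insert_self _ _)))
    rw [h1, h2]; ring

lemma Ex_coupling {α : Type*} [DecidableEq α] (E : Finset α) (p r : ℝ) (X : Finset α → ℝ) :
    Ex E (p + (1 - p) * r) X = Ex E p (fun F => Ex E r (fun G => X (F ∪ G))) := by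
  induction E using Finset.induction_on generalizing X with
  | empty => simp [Ex_empty]
  | insert e E he ih =>
    rw [Ex_insert he, Ex_insert he, ih, ih]
    simp_rw [Ex_insert he]
    simp only [Ex_add, Ex_mul, Finset.insert_union, Finset.union_insert, Finset.insert_idem]
    ring

lemma Ex_flip {α : Type*} [DecidableEq α] {E : Finset α} {e : α} (he : e ∈ E) (p : ℝ) (Q : Finset α → Prop) :
    (1 - p) * Ex E p (fun F => if e ∈ F ∧ Q (F.erase e) then 1 else 0)
      = p * Ex E p (fun F => if e ∉ F ∧ Q F then 1 else 0) := by
  rw [Ex_erase he, Ex_erase he p (fun F => if e ∉ F ∧ Q F then 1 else 0)]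
  have h1 : Ex (E.erase e) p (fun F => if e ∈ insert e F ∧ Q ((insert e F).erase e) then (1:ℝ) else 0)
      = Ex (E.erase e) p (fun F => if Q F then (1:ℝ) else 0) := by
    refine Ex_congr fun F hF => ?_
    have : e ∉ F := fun h => Finset.notMem_erase e E (hF h)
    simp [this]
  have h2 : Ex (E.erase e) p (fun F => if e ∈ F ∧ Q (F.erase e) then (1:ℝ) else 0) = 0 := by
    refine (Ex_congr (Y := fun _ => 0) fun F hF => ?_).trans (Ex_const _ _ _)
    have : e ∉ F := fun h => Finset.notMem_erase e E (hF h)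
    simp [this]
  have h3 : Ex (E.erase e) p (fun F => if e ∉ insert e F ∧ Q (insert e F) then (1:ℝ) else 0) = 0 := by
    refine (Ex_congr (Y := fun _ => 0) fun F hF => ?_).trans (Ex_const _ _ _)
    simp
  have h4 : Ex (E.erase e) p (fun F => if e ∉ F ∧ Q F then (1:ℝ) else 0)
      = Ex (E.erase e) p (fun F => if Q F then (1:ℝ) else 0) := by
    refine Ex_congr fun F hF => ?_
    have : e ∉ F := fun h => Finset.notMem_erase e E (hF h)
    simp [this]
  rw [h1, h2, h3, h4]; ring

lemma Ex_card {α : Type*} [DecidableEq α] (E : Finset α) (p : ℝ) :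
    Ex E p (fun F => (F.card : ℝ)) = p * E.card := by
  induction E using Finset.induction_on with
  | empty => simp [Ex_empty]
  | insert e E he ih =>
    rw [Ex_insert he, ih, Finset.card_insert_of_notMem he]
    have : Ex E p (fun F => ((insert e F).card : ℝ)) = Ex E p (fun F => (F.card : ℝ) + 1) := by
      refine Ex_congr fun F hF => ?_
      rw [Finset.card_insert_of_notMem (fun h => he (hF h))]; push_cast; ring
    rw [this, Ex_add, Ex_const, ih]; push_cast; ring

/-- Probability of an event. -/
def Pr {α : Type*} (E : Finset α) (p : ℝ) (Q : Finset α → Prop) : ℝ :=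
  Ex E p (fun F => if Q F then 1 else 0)

lemma probY_eq (n d : ℕ) (p : ℝ) (Q : Finset (Finset (Fin n)) → Prop) :
    probY n d p Q = Pr (allFaces n d) p Q := by
  unfold probY Pr Ex
  refine Finset.sum_congr rfl fun F _ => ?_
  by_cases h : Q F <;> simp [h]

lemma Pr_markov {α : Type*} [DecidableEq α] {E : Finset α} {p : ℝ} (hp0 : 0 ≤ p) (hp1 : p ≤ 1)
    {X : Finset α → ℝ} (h : ∀ F ⊆ E, 0 ≤ X F) {a : ℝ} (ha : 0 < a) :
    Pr E p (fun F => a ≤ X F) ≤ Ex E p X / a := by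
  rw [le_div_iff₀ ha, mul_comm]
  unfold Pr
  rw [← Ex_mul]
  refine Ex_mono hp0 hp1 fun F hF => ?_
  have := h F hF
  split_ifs with h1 <;> simp <;> linarith

lemma Pr_union_bound {α : Type*} [DecidableEq α] {E : Finset α} {p : ℝ} (hp0 : 0 ≤ p) (hp1 : p ≤ 1)
    (𝒜 : Finset (Finset α)) (h𝒜 : ∀ A ∈ 𝒜, A ⊆ E) :
    Pr E p (fun F => ∃ A ∈ 𝒜, A ⊆ F) ≤ ∑ A ∈ 𝒜, p ^ A.card := by
  have : ∑ A ∈ 𝒜, p ^ A.card = Ex E p (fun F => ∑ A ∈ 𝒜, if A ⊆ F then 1 else 0) := by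
    rw [Ex_sum]
    exact Finset.sum_congr rfl fun A hA => (Ex_subset (h𝒜 A hA) p).symm
  rw [this]
  refine Ex_mono hp0 hp1 fun F _ => ?_
  have hnn : ∀ A ∈ 𝒜, (0:ℝ) ≤ if A ⊆ F then 1 else 0 := fun A _ => by split_ifs <;> norm_num
  split_ifs with hh
  · obtain ⟨A, hA, hAF⟩ := hh
    have := Finset.single_le_sum hnn hA
    simpa [hAF] using this
  · exact Finset.sum_nonneg hnn

lemma Pr_three {α : Type*} [DecidableEq α] {E : Finset α} {p : ℝ} (hp0 : 0 ≤ p) (hp1 : p ≤ 1)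
    {Q A B C : Finset α → Prop} (h : ∀ F ⊆ E, ¬ A F → ¬ B F → ¬ C F → Q F) :
    1 - (Pr E p A + Pr E p B + Pr E p C) ≤ Pr E p Q := by
  unfold Pr
  rw [← Ex_add, ← Ex_add]
  rw [← Ex_const E p 1, ← Ex_sub, Ex_const]
  refine Ex_mono hp0 hp1 fun F hF => ?_
  have := h F hF
  split_ifs <;> first | (exfalso; tauto) | norm_num

end

section

/-- Boundary vector of a face. -/
def bvec {n : ℕ} (σ : Finset (Fin n)) : Finset (Fin n) → ℝ := fun τ => bdCoeff τ σ

/-- Span of boundary vectors. -/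
def bspan {n : ℕ} (F : Finset (Finset (Fin n))) : Submodule ℝ (Finset (Fin n) → ℝ) :=
  Submodule.span ℝ (bvec '' (F : Set (Finset (Fin n))))

lemma boundaryMap_eq {n : ℕ} (F : Finset (Finset (Fin n))) (x : ↥F → ℝ) :
    boundaryMap n F x = ∑ σ : ↥F, x σ • bvec σ.1 := by
  funext τ
  simp [boundaryMap, bvec, Finset.sum_apply]

lemma range_boundaryMap {n : ℕ} (F : Finset (Finset (Fin n))) :
    LinearMap.range (boundaryMap n F) = bspan F := by
  have h : boundaryMap n F = Fintype.linearCombination ℝ (fun σ : ↥F => bvec σ.1) := by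
    ext x τ
    rw [LinearMap.comp_apply, LinearMap.comp_apply, boundaryMap_eq, Fintype.linearCombination_apply]
  rw [h, Fintype.range_linearCombination, bspan]
  congr 1
  ext y
  simp

lemma dimKer_add {n : ℕ} (F : Finset (Finset (Fin n))) :
    Module.finrank ℝ (bspan F) + dimKer n F = F.card := by
  have := LinearMap.finrank_range_add_finrank_ker (boundaryMap n F)
  rw [range_boundaryMap] at this
  rw [dimKer, this]; simp

lemma bspan_mono {n : ℕ} {F G : Finset (Finset (Fin n))} (h : F ⊆ G) : bspan F ≤ bspan G :=
  Submodule.span_mono (Set.image_mono (by exact_mod_cast h))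

lemma bvec_mem {n : ℕ} {F : Finset (Finset (Fin n))} {σ : Finset (Fin n)} (h : σ ∈ F) :
    bvec σ ∈ bspan F :=
  Submodule.subset_span ⟨σ, by exact_mod_cast h, rfl⟩

lemma finrank_bspan_le {n : ℕ} (F : Finset (Finset (Fin n))) :
    Module.finrank ℝ (bspan F) ≤ F.card := by
  have := dimKer_add F; omega

/-- The faces of `F` contained in some cycle. -/
def UU {n : ℕ} (F : Finset (Finset (Fin n))) : Finset (Finset (Fin n)) :=
  F.filter (fun σ => bvec σ ∈ bspan (F.erase σ))

def Sh (n d : ℕ) (F : Finset (Finset (Fin n))) : Finset (Finset (Fin n)) :=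
  (allFaces n d).filter (fun σ => σ ∉ F ∧ bvec σ ∈ bspan F)

lemma dimKer_union {n d : ℕ} (F G : Finset (Finset (Fin n))) :
    (Sh n d F ∩ G).card ≤ dimKer n (F ∪ G) := by
  have h1 := dimKer_add (F ∪ G)
  have h2 : bspan (F ∪ G) ≤ bspan ((F ∪ G) \ (Sh n d F ∩ G)) := by
    have hF : F ⊆ (F ∪ G) \ (Sh n d F ∩ G) := by
      intro σ hσ
      simp [Sh, hσ]
    refine Submodule.span_le.2 ?_
    rintro _ ⟨σ, hσ, rfl⟩
    by_cases h : σ ∈ Sh n d F ∩ G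
    · have : bvec σ ∈ bspan F := by simp [Sh] at h; tauto
      exact bspan_mono hF this
    · exact bvec_mem (Finset.mem_sdiff.2 ⟨by exact_mod_cast hσ, h⟩)
  have h3 := Submodule.finrank_mono h2
  have h4 := finrank_bspan_le ((F ∪ G) \ (Sh n d F ∩ G))
  have h5 : (Sh n d F ∩ G) ⊆ F ∪ G := fun x hx => by
    rw [Finset.mem_inter] at hx; exact Finset.mem_union_right _ hx.2
  rw [Finset.card_sdiff_of_subset h5] at h4
  have := Finset.card_le_card h5
  omega

lemma Ex_inter_card {α : Type*} [DecidableEq α] {E A : Finset α} (hA : A ⊆ E) (p : ℝ) :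
    Ex E p (fun G => ((A ∩ G).card : ℝ)) = p * A.card := by
  have : ∀ G, ((A ∩ G).card : ℝ) = ∑ a ∈ A, if {a} ⊆ G then (1:ℝ) else 0 := by
    intro G
    simp [Finset.sum_ite_mem]
  simp_rw [this]
  rw [Ex_sum]
  rw [Finset.sum_congr rfl fun a ha => Ex_subset (Finset.singleton_subset_iff.2 (hA ha)) p]
  simp [mul_comm]

lemma Ex_UU {n d : ℕ} (p : ℝ) :
    (1 - p) * Ex (allFaces n d) p (fun F => ((UU F).card : ℝ))
      = p * Ex (allFaces n d) p (fun F => ((Sh n d F).card : ℝ)) := by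
  have h1 : Ex (allFaces n d) p (fun F => ((UU F).card : ℝ)) = ∑ σ ∈ allFaces n d,
      Ex (allFaces n d) p (fun F => if σ ∈ F ∧ (bvec σ ∈ bspan (F.erase σ)) then 1 else 0) := by
    rw [← Ex_sum]
    refine Ex_congr fun F hF => ?_
    rw [Finset.sum_boole]
    congr 2
    ext σ
    simp only [UU, Finset.mem_filter]
    exact ⟨fun h => ⟨hF h.1, h⟩, fun h => h.2⟩
  have h2 : Ex (allFaces n d) p (fun F => ((Sh n d F).card : ℝ)) = ∑ σ ∈ allFaces n d,
      Ex (allFaces n d) p (fun F => if σ ∉ F ∧ (bvec σ ∈ bspan F) then 1 else 0) := by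
    rw [← Ex_sum]
    refine Ex_congr fun F hF => ?_
    rw [Finset.sum_boole]
    rfl
  rw [h1, h2, Finset.mul_sum, Finset.mul_sum]
  refine Finset.sum_congr rfl fun σ hσ => ?_
  exact Ex_flip hσ p (fun F => bvec σ ∈ bspan F)

lemma Ex_UU_le {n d : ℕ} {p p' : ℝ} (hp0 : 0 ≤ p) (hpp : p < p') (hp1 : p' ≤ 1) :
    (p' - p) * Ex (allFaces n d) p (fun F => ((UU F).card : ℝ))
      ≤ p * Ex (allFaces n d) p' (fun F => (dimKer n F : ℝ)) := by
  have h1p : 0 < 1 - p := by linarith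
  set r := (p' - p) / (1 - p) with hr
  have hr0 : 0 ≤ r := div_nonneg (by linarith) h1p.le
  have hr1 : r ≤ 1 := by rw [hr, div_le_one h1p]; linarith
  have hp' : p' = p + (1 - p) * r := by rw [hr]; field_simp; ring
  have key : r * Ex (allFaces n d) p (fun F => ((Sh n d F).card : ℝ))
      ≤ Ex (allFaces n d) p' (fun F => (dimKer n F : ℝ)) := by
    rw [hp', Ex_coupling, ← Ex_mul]
    refine Ex_mono hp0 (by linarith) fun F hF => ?_
    rw [← Ex_inter_card (A := Sh n d F) (Finset.filter_subset _ _)]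
    exact Ex_mono hr0 hr1 fun G hG => by exact_mod_cast dimKer_union F G
  have hU := Ex_UU (n := n) (d := d) p
  have : p' - p = r * (1 - p) := by rw [hr]; field_simp
  rw [this, mul_assoc, hU]
  nlinarith

/-- Hilbert-space distance data of the basis vectors to a subspace. -/
lemma exists_dist {ι : Type*} [Fintype ι] [DecidableEq ι] (V : Submodule ℝ (ι → ℝ)) :
    ∃ X : ι → ℝ, (∀ i, 0 ≤ X i ∧ X i ≤ 1) ∧
      (∀ i (f : ι → ℝ), f - Pi.single i 1 ∈ V → X i ≤ ∑ j, f j ^ 2) ∧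
      ∀ T : Finset ι, ∑ i ∈ T, (1 - X i) ≤ Module.finrank ℝ V := by
  let L : EuclideanSpace ℝ ι ≃ₗ[ℝ] (ι → ℝ) := WithLp.linearEquiv 2 ℝ (ι → ℝ)
  let V' : Submodule ℝ (EuclideanSpace ℝ ι) := V.comap L.toLinearMap
  have hfr : Module.finrank ℝ V' = Module.finrank ℝ V := by
    have : V' = V.map L.symm.toLinearMap := by
      ext x; simp [V', Submodule.mem_map_equiv]
    rw [this]; exact LinearEquiv.finrank_map_eq L.symm V
  let b := stdOrthonormalBasis ℝ V'
  let m := Module.finrank ℝ V'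
  let e : ι → EuclideanSpace ℝ ι := fun i => EuclideanSpace.single i 1
  have hproj : ∀ x : EuclideanSpace ℝ ι, ∑ k, (inner ℝ ((b k : V') : EuclideanSpace ℝ ι) x) ^ 2
      = ‖V'.starProjection x‖ ^ 2 := by
    intro x
    rw [Submodule.starProjection_apply, Submodule.norm_coe, ← b.sum_sq_norm_inner_right]
    refine Finset.sum_congr rfl fun k _ => ?_
    rw [Real.norm_eq_abs, sq_abs, Submodule.inner_orthogonalProjectionOnto_eq_of_mem_left]
  have hnorm : ∀ x : EuclideanSpace ℝ ι, ‖x‖ ^ 2 = ‖V'.starProjection x‖ ^ 2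
      + ‖x - V'.starProjection x‖ ^ 2 := by
    intro x
    rw [V'.norm_sq_eq_add_norm_sq_starProjection x, Submodule.starProjection_orthogonal_val]
  have he : ∀ i, ‖e i‖ = 1 := fun i => by simp [e]
  refine ⟨fun i => 1 - ‖V'.starProjection (e i)‖ ^ 2, ?_, ?_, ?_⟩
  · intro i
    have := hnorm (e i)
    rw [he] at this
    constructor <;> dsimp only <;> nlinarith [sq_nonneg ‖e i - V'.starProjection (e i)‖, sq_nonneg ‖V'.starProjection (e i)‖]
  · intro i f hf
    have h0 := hnorm (e i)
    rw [he] at h0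
    let f' : EuclideanSpace ℝ ι := L.symm f
    have hf' : f' - e i ∈ V' := by
      show L (f' - e i) ∈ V
      convert hf using 1
      rw [map_sub]
      simp only [f', LinearEquiv.apply_symm_apply]
      congr 1
    have h1 : f' - V'.starProjection f' = e i - V'.starProjection (e i) := by
      have : V'.starProjection (f' - e i) = f' - e i :=
        Submodule.starProjection_eq_self_iff.2 hf'
      rw [map_sub] at this
      have h2 : V'.starProjection f' = f' - e i + V'.starProjection (e i) := by
        rw [← this]; abel
      rw [h2]; abel
    have h2 := hnorm f'
    rw [h1] at h2
    have h3 : ‖f'‖ ^ 2 = ∑ j, f j ^ 2 := by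
      rw [EuclideanSpace.norm_sq_eq]
      simp [f', L]
    rw [← h3]
    dsimp only
    nlinarith [sq_nonneg ‖V'.starProjection f'‖]
  · intro T
    have h1 : ∑ i ∈ T, (1 - (1 - ‖V'.starProjection (e i)‖ ^ 2))
        ≤ ∑ i, ‖V'.starProjection (e i)‖ ^ 2 := by
      simp only [sub_sub_cancel]
      exact Finset.sum_le_univ_sum_of_nonneg fun i => sq_nonneg _
    refine h1.trans ?_
    simp_rw [← hproj]
    rw [Finset.sum_comm]
    have : ∀ k, ∑ i, (inner ℝ ((b k : V') : EuclideanSpace ℝ ι) (e i)) ^ 2 = 1 := by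
      intro k
      have hb : ‖((b k : V') : EuclideanSpace ℝ ι)‖ = 1 := by
        rw [Submodule.norm_coe]; exact b.orthonormal.1 k
      have := EuclideanSpace.norm_sq_eq ((b k : V') : EuclideanSpace ℝ ι)
      rw [hb] at this
      simp [e, EuclideanSpace.inner_single_right] at this ⊢
      exact this.symm
    simp_rw [this]
    simp [hfr]

end

section

/-- squared distance of `e_τ` from the span of boundaries. -/
def dist2 {n : ℕ} (τ : Finset (Fin n)) (F : Finset (Finset (Fin n))) : ℝ :=
  Classical.choose (exists_dist (bspan F)) τ

lemma dist2_nonneg {n : ℕ} (τ : Finset (Fin n)) (F : Finset (Finset (Fin n))) : 0 ≤ dist2 τ F :=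
  ((Classical.choose_spec (exists_dist (bspan F))).1 τ).1

lemma dist2_le_one {n : ℕ} (τ : Finset (Fin n)) (F : Finset (Finset (Fin n))) : dist2 τ F ≤ 1 :=
  ((Classical.choose_spec (exists_dist (bspan F))).1 τ).2

lemma dist2_le {n : ℕ} (τ : Finset (Fin n)) (F : Finset (Finset (Fin n))) (f : Finset (Fin n) → ℝ)
    (h : f - Pi.single τ 1 ∈ bspan F) : dist2 τ F ≤ ∑ η, f η ^ 2 :=
  (Classical.choose_spec (exists_dist (bspan F))).2.1 τ f h

lemma sum_dist2 {n : ℕ} (T : Finset (Finset (Fin n))) (F : Finset (Finset (Fin n))) :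
    ∑ τ ∈ T, (1 - dist2 τ F) ≤ Module.finrank ℝ (bspan F) :=
  (Classical.choose_spec (exists_dist (bspan F))).2.2 T

lemma Ex_dimKer_le {n d : ℕ} {p b : ℝ} (hp0 : 0 ≤ p) (hp1 : p ≤ 1)
    (hb : ∀ τ : Finset (Fin n), τ.card = d → Ex (allFaces n d) p (dist2 τ) ≤ b) :
    Ex (allFaces n d) p (fun F => (dimKer n F : ℝ))
      ≤ p * (n.choose (d + 1)) - (n.choose d) * (1 - b) := by
  set T : Finset (Finset (Fin n)) := Finset.univ.filter (fun τ => τ.card = d) with hT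
  have hTc : T.card = n.choose d := by
    have : T = Finset.powersetCard d Finset.univ := by ext; simp [hT, Finset.mem_powersetCard]
    rw [this]; simp
  have hFc : (allFaces n d).card = n.choose (d + 1) := by
    have : allFaces n d = Finset.powersetCard (d+1) Finset.univ := by
      ext; simp [allFaces, Finset.mem_powersetCard]
    rw [this]; simp
  have h1 : ∀ F ⊆ allFaces n d, (dimKer n F : ℝ) ≤ F.card - ∑ τ ∈ T, (1 - dist2 τ F) := by
    intro F _
    have h1 := sum_dist2 T F
    have h2 : ((Module.finrank ℝ (bspan F) : ℝ)) + dimKer n F = F.card := by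
      exact_mod_cast dimKer_add F
    linarith
  refine (Ex_mono hp0 hp1 h1).trans ?_
  rw [Ex_sub, Ex_card, Ex_sum, hFc]
  simp_rw [Ex_sub, Ex_const]
  have : ∑ τ ∈ T, (1 - b) ≤ ∑ τ ∈ T, (1 - Ex (allFaces n d) p (dist2 τ)) := by
    refine Finset.sum_le_sum fun τ hτ => ?_
    have := hb τ (by simpa [hT] using hτ)
    linarith
  rw [Finset.sum_const, hTc, nsmul_eq_mul] at this
  linarith

/-! ### cycles -/

lemma bdCoeff_erase {n : ℕ} {σ : Finset (Fin n)} {v : Fin n} (hv : v ∈ σ) :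
    bdCoeff (σ.erase v) σ = (-1 : ℝ) ^ (σ.filter (fun w => w < v)).card := by
  unfold bdCoeff
  rw [if_pos ⟨Finset.erase_subset _ _, Finset.card_erase_add_one hv⟩]
  have : σ \ σ.erase v = {v} := by
    ext x; simp only [Finset.mem_sdiff, Finset.mem_erase, Finset.mem_singleton]
    constructor
    · rintro ⟨h1, h2⟩; by_contra h; exact h2 ⟨h, h1⟩
    · rintro rfl; exact ⟨hv, fun h => h.1 rfl⟩
  rw [this]; simp

lemma exists_erase {n : ℕ} {τ σ : Finset (Fin n)} (h : τ ⊆ σ ∧ τ.card + 1 = σ.card) :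
    ∃ v ∈ σ, τ = σ.erase v := by
  have : (σ \ τ).card = 1 := by rw [Finset.card_sdiff_of_subset h.1]; omega
  obtain ⟨v, hv⟩ := Finset.card_eq_one.1 this
  have hvm : v ∈ σ \ τ := by rw [hv]; simp
  refine ⟨v, (Finset.mem_sdiff.1 hvm).1, ?_⟩
  refine Finset.eq_of_subset_of_card_le (fun x hx => Finset.mem_erase.2 ⟨?_, h.1 hx⟩) ?_
  · rintro rfl; exact (Finset.mem_sdiff.1 hvm).2 hx
  · rw [Finset.card_erase_of_mem (Finset.mem_sdiff.1 hvm).1]; omega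

lemma bdCoeff_ne_zero_iff {n : ℕ} (τ σ : Finset (Fin n)) :
    bdCoeff τ σ ≠ 0 ↔ τ ⊆ σ ∧ τ.card + 1 = σ.card := by
  constructor
  · intro h; by_contra h'; exact h (by unfold bdCoeff; rw [if_neg h'])
  · intro h
    obtain ⟨v, hv, rfl⟩ := exists_erase h
    rw [bdCoeff_erase hv]
    exact pow_ne_zero _ (by norm_num)
    
lemma bd_bd {n : ℕ} (ρ T : Finset (Fin n)) :
    ∑ v ∈ T, bdCoeff (T.erase v) T * bdCoeff ρ (T.erase v) = 0 := by
  by_cases h : ρ ⊆ T ∧ ρ.card + 2 = T.card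
  · have hc : (T \ ρ).card = 2 := by rw [Finset.card_sdiff_of_subset h.1]; omega
    obtain ⟨a, b, hab, hT⟩ := Finset.card_eq_two.1 hc
    wlog hlt : a < b generalizing a b
    · exact this b a hab.symm (by rw [hT, Finset.pair_comm]) (lt_of_le_of_ne (not_lt.1 hlt) hab.symm)
    have haT : a ∈ T ∧ a ∉ ρ := by
      have : a ∈ T \ ρ := by rw [hT]; simp
      simpa using this
    have hbT : b ∈ T ∧ b ∉ ρ := by
      have : b ∈ T \ ρ := by rw [hT]; simp
      simpa using this
    have hsub : ({a, b} : Finset (Fin n)) ⊆ T := by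
      intro x; simp only [Finset.mem_insert, Finset.mem_singleton]
      rintro (rfl | rfl); exacts [haT.1, hbT.1]
    rw [← Finset.sum_subset hsub, Finset.sum_pair hab]
    · have e1 : ρ = (T.erase a).erase b := by
        refine Finset.eq_of_subset_of_card_le (fun x hx => ?_) ?_
        · simp only [Finset.mem_erase]
          refine ⟨?_, ?_, h.1 hx⟩ <;> rintro rfl
          exacts [hbT.2 hx, haT.2 hx]
        · rw [Finset.card_erase_of_mem (Finset.mem_erase.2 ⟨hab.symm, hbT.1⟩),
            Finset.card_erase_of_mem haT.1]; omega
      have e2 : ρ = (T.erase b).erase a := by rw [e1, Finset.erase_right_comm]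
      rw [bdCoeff_erase haT.1, bdCoeff_erase hbT.1]
      conv_lhs => enter [1, 2]; rw [e1]
      conv_lhs => enter [2, 2]; rw [e2]
      rw [bdCoeff_erase (Finset.mem_erase.2 ⟨hab.symm, hbT.1⟩),
        bdCoeff_erase (Finset.mem_erase.2 ⟨hab, haT.1⟩)]
      have f1 : (T.erase b).filter (fun w => w < a) = T.filter (fun w => w < a) := by
        ext x; simp only [Finset.mem_filter, Finset.mem_erase]
        constructor
        · tauto
        · rintro ⟨h1, h2⟩; exact ⟨⟨(h2.trans hlt).ne, h1⟩, h2⟩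
      have f2 : (T.filter (fun w => w < b)).card = ((T.erase a).filter (fun w => w < b)).card + 1 := by
        rw [← Finset.card_erase_add_one (a := a) (s := T.filter (fun w => w < b)) (by simp [haT.1, hlt])]
        congr 2
        ext x; simp only [Finset.mem_filter, Finset.mem_erase]; tauto
      rw [f1, f2]; ring
    · intro x hxT hx
      have : ¬ (ρ ⊆ T.erase x ∧ ρ.card + 1 = (T.erase x).card) := by
        rintro ⟨h1, -⟩
        have : x ∉ ρ := fun hh => Finset.notMem_erase x T (h1 hh)
        have : x ∈ T \ ρ := Finset.mem_sdiff.2 ⟨hxT, this⟩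
        rw [hT] at this; exact hx this
      rw [show bdCoeff ρ (T.erase x) = 0 by unfold bdCoeff; rw [if_neg this], mul_zero]
  · refine Finset.sum_eq_zero fun v hv => ?_
    have : ¬ (ρ ⊆ T.erase v ∧ ρ.card + 1 = (T.erase v).card) := by
      rintro ⟨h1, h2⟩
      refine h ⟨h1.trans (Finset.erase_subset _ _), ?_⟩
      have := Finset.card_erase_add_one hv; omega
    rw [show bdCoeff ρ (T.erase v) = 0 by unfold bdCoeff; rw [if_neg this], mul_zero]

lemma sum_erase_eq {n d : ℕ} {A : Finset (Finset (Fin n))} {T : Finset (Fin n)}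
    (hT : T.card = d + 2) (hA : ∀ s ∈ T.powerset, s.card = d + 1 → s ∈ A)
    (g : Finset (Fin n) → ℝ) :
    ∑ σ ∈ A, bdCoeff σ T * g σ = ∑ v ∈ T, bdCoeff (T.erase v) T * g (T.erase v) := by
  have hinj : Set.InjOn (fun v => T.erase v) (T : Set (Fin n)) := Finset.erase_injOn T
  rw [← Finset.sum_image (f := fun σ => bdCoeff σ T * g σ) (g := fun v => T.erase v) hinj]
  symm
  apply Finset.sum_subset
  · intro σ hσ
    obtain ⟨v, hv, rfl⟩ := Finset.mem_image.1 hσ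
    exact hA _ (Finset.mem_powerset.2 (Finset.erase_subset _ _))
      (by rw [Finset.card_erase_of_mem hv, hT]; rfl)
  · intro σ _ hσ
    by_contra h
    have := (bdCoeff_ne_zero_iff σ T).1 (left_ne_zero_of_mul h)
    obtain ⟨v, hv, rfl⟩ := exists_erase this
    exact hσ (Finset.mem_image_of_mem _ hv)

lemma boundaryMap_apply {n : ℕ} (F : Finset (Finset (Fin n))) (x : ↥F → ℝ) (τ : Finset (Fin n)) :
    boundaryMap n F x τ = ∑ σ ∈ F.attach, x σ * bdCoeff τ σ.1 := rfl

lemma simplexCycle_mem_ker {n d : ℕ} {F : Finset (Finset (Fin n))} {T : Finset (Fin n)}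
    (hT : T ∈ simplexBoundaries n d F) : simplexCycle n F T ∈ LinearMap.ker (boundaryMap n F) := by
  simp only [simplexBoundaries, Finset.mem_filter, Finset.mem_univ, true_and] at hT
  rw [LinearMap.mem_ker]
  funext ρ
  rw [boundaryMap_apply]
  have : ∑ σ ∈ F.attach, simplexCycle n F T σ * bdCoeff ρ σ.1 =
      ∑ σ ∈ F, bdCoeff σ T * bdCoeff ρ σ := by
    rw [← Finset.sum_attach F]; rfl
  rw [this, sum_erase_eq hT.1 hT.2 (fun σ => bdCoeff ρ σ), bd_bd]; rfl

/-- every facet is in at least two faces. -/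
def isCore {n : ℕ} (A : Finset (Finset (Fin n))) : Prop :=
  ∀ σ ∈ A, ∀ v ∈ σ, ∃ σ' ∈ A, σ' ≠ σ ∧ σ.erase v ⊆ σ'

def noSimplex {n : ℕ} (d : ℕ) (A : Finset (Finset (Fin n))) : Prop :=
  ∀ T : Finset (Fin n), T.card = d + 2 → ∃ s ⊆ T, s.card = d + 1 ∧ s ∉ A

lemma reduction {n d : ℕ} {F : Finset (Finset (Fin n))} (hF : F ⊆ allFaces n d)
    (h : LinearMap.ker (boundaryMap n F) ≠
      Submodule.span ℝ (simplexCycle n F '' ↑(simplexBoundaries n d F))) :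
    ∃ A ⊆ UU F, A.Nonempty ∧ isCore A ∧ noSimplex d A := by
  set S := Submodule.span ℝ (simplexCycle n F '' ↑(simplexBoundaries n d F)) with hS
  have hle : S ≤ LinearMap.ker (boundaryMap n F) := by
    refine Submodule.span_le.2 ?_
    rintro _ ⟨T, hT, rfl⟩
    exact simplexCycle_mem_ker (by exact_mod_cast hT)
  have hex : ∃ z ∈ LinearMap.ker (boundaryMap n F), z ∉ S := by
    by_contra hh; push Not at hh
    exact h (le_antisymm hh hle)
  let supp : (↥F → ℝ) → Finset (Finset (Fin n)) := fun z =>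
    F.filter (fun σ => ∃ hσ : σ ∈ F, z ⟨σ, hσ⟩ ≠ 0)
  have hex2 : ∃ k, ∃ z ∈ LinearMap.ker (boundaryMap n F), z ∉ S ∧ (supp z).card = k := by
    obtain ⟨z, h1, h2⟩ := hex; exact ⟨_, z, h1, h2, rfl⟩
  obtain ⟨z, hz, hzS, hzc⟩ := Nat.find_spec hex2
  have hmin : ∀ z' ∈ LinearMap.ker (boundaryMap n F), z' ∉ S → (supp z).card ≤ (supp z').card := by
    intro z' h1 h2
    rw [hzc]
    exact Nat.find_min' hex2 ⟨z', h1, h2, rfl⟩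
  have hsz : ∀ σ, ∀ hσ : σ ∈ F, (σ ∈ supp z ↔ z ⟨σ, hσ⟩ ≠ 0) := by
    intro σ hσ
    simp only [supp, Finset.mem_filter]
    exact ⟨fun h => h.2.2, fun h => ⟨hσ, hσ, h⟩⟩
  have hsF : supp z ⊆ F := Finset.filter_subset _ _
  have hzero : ∀ τ, ∑ σ ∈ F.attach, z σ * bdCoeff τ σ.1 = 0 := by
    intro τ
    rw [← boundaryMap_apply, LinearMap.mem_ker.1 hz]; rfl
  refine ⟨supp z, ?_, ?_, ?_, ?_⟩
  · intro σ hσ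
    have hσF := hsF hσ
    refine Finset.mem_filter.2 ⟨hσF, ?_⟩
    have hz0 := (hsz σ hσF).1 hσ
    have h1 : boundaryMap n F z = 0 := LinearMap.mem_ker.1 hz
    rw [boundaryMap_eq, ← Finset.add_sum_erase _ _ (Finset.mem_univ (⟨σ, hσF⟩ : ↥F))] at h1
    have h2 : bvec σ = (z ⟨σ, hσF⟩)⁻¹ • (-∑ x ∈ Finset.univ.erase (⟨σ, hσF⟩ : ↥F), z x • bvec x.1) := by
      rw [← eq_neg_of_add_eq_zero_left h1, smul_smul, inv_mul_cancel₀ hz0, one_smul]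
    rw [h2]
    refine Submodule.smul_mem _ _ (Submodule.neg_mem _ (Submodule.sum_mem _ fun x hx => ?_))
    refine Submodule.smul_mem _ _ (bvec_mem (Finset.mem_erase.2 ⟨?_, x.2⟩))
    intro hxx
    exact (Finset.mem_erase.1 hx).1 (Subtype.ext hxx)
  · rw [Finset.nonempty_iff_ne_empty]
    intro he
    apply hzS
    have : z = 0 := by
      funext ⟨σ, hσ⟩
      by_contra h0
      have := (hsz σ hσ).2 h0
      rw [he] at this; simp at this
    rw [this]; exact S.zero_mem
  · intro σ hσ v hv
    by_contra hcon
    push Not at hcon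
    have hσF := hsF hσ
    have := hzero (σ.erase v)
    rw [Finset.sum_eq_single (⟨σ, hσF⟩ : ↥F)] at this
    · rw [bdCoeff_erase hv] at this
      have h2 := (hsz σ hσF).1 hσ
      exact h2 (by simpa using this)
    · rintro ⟨σ', hσ'⟩ - hne
      by_contra h0
      have h1 := (hsz σ' hσ').2 (left_ne_zero_of_mul h0)
      exact hcon σ' h1 (fun h => hne (Subtype.ext h)) ((bdCoeff_ne_zero_iff _ _).1 (right_ne_zero_of_mul h0)).1
    · intro hh; exact absurd (Finset.mem_attach _ _) hh
  · intro T hT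
    by_contra hcon
    push Not at hcon
    have hTF : T ∈ simplexBoundaries n d F := by
      simp only [simplexBoundaries, Finset.mem_filter, Finset.mem_univ, true_and]
      exact ⟨hT, fun s hs hc => hsF (hcon s (Finset.mem_powerset.1 hs) hc)⟩
    have hTne : T.Nonempty := Finset.card_pos.1 (by omega)
    obtain ⟨v, hv⟩ := hTne
    have hvc : (T.erase v).card = d + 1 := by rw [Finset.card_erase_of_mem hv, hT]; rfl
    have hmem := hcon _ (Finset.erase_subset v T) hvc
    have hmF := hsF hmem
    set a := z ⟨T.erase v, hmF⟩ / bdCoeff (T.erase v) T with ha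
    have hb0 : bdCoeff (T.erase v) T ≠ 0 := by
      rw [bdCoeff_ne_zero_iff]; exact ⟨Finset.erase_subset _ _, by omega⟩
    set z' := z - a • simplexCycle n F T with hz'
    have hTS : simplexCycle n F T ∈ S := Submodule.subset_span ⟨T, by exact_mod_cast hTF, rfl⟩
    have h1 : z' ∈ LinearMap.ker (boundaryMap n F) :=
      Submodule.sub_mem _ hz (Submodule.smul_mem _ _ (hle hTS))
    have h2 : z' ∉ S := by
      intro hh
      apply hzS
      have := S.add_mem hh (S.smul_mem a hTS)
      simpa [hz'] using this
    have h3 := hmin z' h1 h2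
    have h4 : supp z' ⊆ (supp z).erase (T.erase v) := by
      intro σ hσ
      obtain ⟨hσF, _, h0⟩ := Finset.mem_filter.1 hσ
      refine Finset.mem_erase.2 ⟨?_, ?_⟩
      · rintro rfl
        apply h0
        simp only [hz', Pi.sub_apply, Pi.smul_apply, simplexCycle, smul_eq_mul, ha]
        field_simp; ring
      · rw [hsz σ hσF]
        intro hz0
        apply h0
        have hb : bdCoeff σ T = 0 := by
          by_contra hb
          obtain ⟨h5, h6⟩ := (bdCoeff_ne_zero_iff _ _).1 hb
          exact (hsz σ hσF).1 (hcon σ h5 (by omega)) hz0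
        simp only [hz', Pi.sub_apply, Pi.smul_apply, simplexCycle, smul_eq_mul, hb, hz0]
        ring
    have h5 := Finset.card_le_card h4
    rw [Finset.card_erase_of_mem hmem] at h5
    have := Finset.card_pos.2 ⟨_, hmem⟩
    omega

end

section

variable {n : ℕ}

def degK (K : Finset (Finset (Fin n))) (τ : Finset (Fin n)) : ℕ := (K.filter (fun σ => τ ⊆ σ)).card
def goodS (H : Finset (Finset (Fin n))) (η : Finset (Fin n)) : Prop := ∀ ρ ∈ H, ¬ ρ ⊆ η
def veryBad (H : Finset (Finset (Fin n))) (τ : Finset (Fin n)) : Prop :=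
  ∀ u ∈ τ, ∃ ρ ∈ H, ρ ⊆ τ.erase u
def savingV (H K : Finset (Finset (Fin n))) (τ : Finset (Fin n)) (v : Fin n) : Prop :=
  v ∉ τ ∧ ∃ ρ ⊂ τ, ρ ∉ H ∧ insert v ρ ∈ H ∪ K.shadow
def gS (H : Finset (Finset (Fin n))) (σ : Finset (Fin n)) : ℕ :=
  (σ.filter (fun u => goodS H (σ.erase u))).card
def fS (H K : Finset (Finset (Fin n))) : ℕ := (K.shadow.filter (goodS H)).card
def GS (H K : Finset (Finset (Fin n))) : ℕ := ∑ σ ∈ K, gS H σ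
def VB2 (H K : Finset (Finset (Fin n))) : ℕ :=
  (K.shadow.filter (fun τ => veryBad H τ ∧ 2 ≤ degK K τ)).card

lemma card_image_erase (σ X : Finset (Fin n)) (h : X ⊆ σ) :
    (X.image (fun u => σ.erase u)).card = X.card :=
  Finset.card_image_of_injOn ((Finset.erase_injOn σ).mono (by exact_mod_cast h))

lemma degK_mono {K K' : Finset (Finset (Fin n))} (h : K ⊆ K') (τ) : degK K τ ≤ degK K' τ :=
  Finset.card_le_card (Finset.filter_subset_filter _ h)

lemma shadow_mono' {K K' : Finset (Finset (Fin n))} (h : K ⊆ K') : K.shadow ⊆ K'.shadow :=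
  Finset.shadow_mono h

lemma fS_mono {H K K' : Finset (Finset (Fin n))} (h : K ⊆ K') : fS H K ≤ fS H K' :=
  Finset.card_le_card (Finset.filter_subset_filter _ (shadow_mono' h))

lemma VB2_mono {H K K' : Finset (Finset (Fin n))} (h : K ⊆ K') : VB2 H K ≤ VB2 H K' := by
  refine Finset.card_le_card fun τ hτ => ?_
  simp only [Finset.mem_filter] at hτ ⊢
  exact ⟨shadow_mono' h hτ.1, hτ.2.1, hτ.2.2.trans (degK_mono h τ)⟩

lemma gS_le (H : Finset (Finset (Fin n))) (σ) : gS H σ ≤ σ.card := Finset.card_filter_le _ _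

def stepInv (d : ℕ) (H K : Finset (Finset (Fin n))) (i q : ℕ) : Prop :=
  i + GS H K ≤ 2 * fS H K + (d + 2) * q + VB2 H K

lemma step_saving {d : ℕ} {H K : Finset (Finset (Fin n))} {i q : ℕ} {σ : Finset (Fin n)}
    (hσ : σ ∉ K) (hc : σ.card = d + 1) (h : stepInv d H K i q) :
    stepInv d H (insert σ K) (i + 1) (q + 1) := by
  unfold stepInv at *
  have h1 : GS H (insert σ K) = gS H σ + GS H K := Finset.sum_insert hσ
  have h2 := gS_le H σ
  have h3 := fS_mono (H := H) (Finset.subset_insert σ K)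
  have h4 := VB2_mono (H := H) (Finset.subset_insert σ K)
  rw [h1]
  nlinarith

lemma step_nonsaving {d : ℕ} (hd : 2 ≤ d) {H K : Finset (Finset (Fin n))} {i q : ℕ}
    {σ0 τ : Finset (Fin n)} {v0 v : Fin n} (hH : ∀ ρ ∈ H, 1 ≤ ρ.card ∧ ρ.card < d)
    (hσ0 : σ0 ∈ K) (hv0 : v0 ∈ σ0) (hτ : τ = σ0.erase v0)
    (hdeg : ∀ σ' ∈ K, τ ⊆ σ' → σ' = σ0) (hτc : τ.card = d) (hv : v ∉ τ)
    (hσ : insert v τ ∉ K) (hns : ¬ savingV H K τ v) (h : stepInv d H K i q) :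
    stepInv d H (insert (insert v τ) K) (i + 1) q := by
  unfold stepInv at *
  set σ := insert v τ with hσdef
  have h1 : GS H (insert σ K) = gS H σ + GS H K := Finset.sum_insert hσ
  have h4 := VB2_mono (H := H) (Finset.subset_insert σ K)
  -- non saving facts
  have hns' : ∀ ρ, ρ ⊂ τ → ρ ∉ H → insert v ρ ∉ H ∪ K.shadow := by
    intro ρ h1 h2 h3
    exact hns ⟨hv, ρ, h1, h2, h3⟩
  -- key : a subset of sigma in H that is not in tau
  have key : ∀ ρ' ∈ H, ρ' ⊆ σ → (∀ ρ ∈ H, ¬ ρ ⊆ ρ'.erase v) → ¬ v ∈ ρ' := by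
    intro ρ' hρ' hsub hno hvρ
    have hsub2 : ρ'.erase v ⊆ τ := by
      intro x hx
      have := hsub (Finset.mem_of_mem_erase hx)
      rw [hσdef, Finset.mem_insert] at this
      rcases this with rfl | h; · exact absurd hx (Finset.notMem_erase _ _)
      exact h
    have hss : ρ'.erase v ⊂ τ := by
      refine Finset.ssubset_iff_subset_ne.2 ⟨hsub2, fun he => ?_⟩
      have := (hH ρ' hρ').2
      have h2 := Finset.card_erase_le (s := ρ') (a := v)
      rw [he] at h2; omega
    refine hns' _ hss (fun hh => hno _ hh (Finset.Subset.refl _)) ?_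
    rw [Finset.insert_erase hvρ]
    exact Finset.mem_union_left _ hρ'
  set X := τ.filter (fun u => goodS H (σ.erase u)) with hX
  have hXσ : X ⊆ σ := (Finset.filter_subset _ _).trans (Finset.subset_insert _ _)
  have hg : gS H σ = X.card + if goodS H τ then 1 else 0 := by
    unfold gS
    have : σ.erase v = τ := Finset.erase_insert hv
    rw [hσdef, Finset.filter_insert, ← hσdef, this]
    split_ifs with hh
    · rw [Finset.card_insert_of_notMem]
      intro h'; exact hv (Finset.mem_filter.1 h').1
    · rfl
  have hnew : fS H K + X.card ≤ fS H (insert σ K) := by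
    unfold fS
    rw [← card_image_erase σ X hXσ, ← Finset.card_union_of_disjoint]
    · refine Finset.card_le_card fun η hη => ?_
      rcases Finset.mem_union.1 hη with hη | hη
      · exact Finset.filter_subset_filter _ (shadow_mono' (Finset.subset_insert σ K)) hη
      · obtain ⟨u, hu, rfl⟩ := Finset.mem_image.1 hη
        refine Finset.mem_filter.2 ⟨?_, (Finset.mem_filter.1 hu).2⟩
        exact Finset.erase_mem_shadow (Finset.mem_insert_self _ _) (hXσ hu)
    · rw [Finset.disjoint_right]
      intro η hη hη2
      obtain ⟨u, hu, rfl⟩ := Finset.mem_image.1 hη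
      obtain ⟨huτ, hgood⟩ := Finset.mem_filter.1 hu
      have huv : u ≠ v := fun h => hv (h ▸ huτ)
      have e : insert v (τ.erase u) = σ.erase u := by
        rw [hσdef, Finset.erase_insert_of_ne huv.symm]
      refine hns' (τ.erase u) (Finset.erase_ssubset huτ) (fun hh => ?_) ?_
      · exact hgood _ hh (by rw [← e]; exact Finset.subset_insert _ _)
      · rw [e]; exact Finset.mem_union_right _ (Finset.mem_filter.1 hη2).1
  rw [h1, hg]
  by_cases hgood : goodS H τ
  · have : X = τ := by
      refine Finset.filter_true_of_mem fun u hu => ?_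
      intro ρ hρ hsub
      have hno : ∀ ρ1 ∈ H, ¬ ρ1 ⊆ ρ.erase v := by
        intro ρ1 h1 h2
        refine hgood ρ1 h1 fun x hx => ?_
        have hx2 := h2 hx
        have := Finset.mem_of_mem_erase (hsub (Finset.mem_of_mem_erase hx2))
        rw [hσdef, Finset.mem_insert] at this
        exact this.resolve_left (Finset.ne_of_mem_erase hx2)
      have hvρ := key ρ hρ (hsub.trans (Finset.erase_subset _ _)) hno
      exact hno ρ hρ (by rw [Finset.erase_eq_of_notMem hvρ])
    rw [this, hτc] at hnew
    rw [if_pos hgood, this, hτc]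
    omega
  · rw [if_neg hgood]
    by_cases hvb : veryBad H τ
    · have : VB2 H K + 1 ≤ VB2 H (insert σ K) := by
        have hτK : τ ∈ K.shadow := hτ ▸ Finset.erase_mem_shadow hσ0 hv0
        have hd1 : degK K τ ≤ 1 := by
          unfold degK
          rw [Finset.card_le_one]
          intro a ha b hb
          rw [hdeg a (Finset.mem_filter.1 ha).1 (Finset.mem_filter.1 ha).2,
            hdeg b (Finset.mem_filter.1 hb).1 (Finset.mem_filter.1 hb).2]
        have hd2 : 2 ≤ degK (insert σ K) τ := by
          unfold degK
          rw [show (2:ℕ) = ({σ, σ0} : Finset (Finset (Fin n))).card by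
            rw [Finset.card_pair]; rintro rfl; exact hσ hσ0]
          refine Finset.card_le_card fun x hx => ?_
          rw [Finset.mem_insert, Finset.mem_singleton] at hx
          rcases hx with rfl | rfl
          · exact Finset.mem_filter.2 ⟨Finset.mem_insert_self _ _, Finset.subset_insert _ _⟩
          · exact Finset.mem_filter.2 ⟨Finset.mem_insert_of_mem hσ0, hτ ▸ Finset.erase_subset _ _⟩
        unfold VB2
        rw [← Finset.card_insert_of_notMem (a := τ)]
        · refine Finset.card_le_card fun x hx => ?_
          rcases Finset.mem_insert.1 hx with rfl | hx
          · exact Finset.mem_filter.2 ⟨shadow_mono' (Finset.subset_insert σ K) hτK, hvb, hd2⟩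
          · obtain ⟨a1, a2, a3⟩ := Finset.mem_filter.1 hx
            exact Finset.mem_filter.2 ⟨shadow_mono' (Finset.subset_insert σ K) a1, a2,
              a3.trans (degK_mono (Finset.subset_insert σ K) x)⟩
        · intro hx; have := (Finset.mem_filter.1 hx).2.2; omega
      omega
    · have : 1 ≤ X.card := by
        unfold veryBad at hvb
        push Not at hvb
        obtain ⟨u, hu, hno⟩ := hvb
        refine Finset.card_pos.2 ⟨u, Finset.mem_filter.2 ⟨hu, ?_⟩⟩
        intro ρ hρ hsub
        have huρ : u ∉ ρ := fun h => Finset.notMem_erase u σ (hsub h)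
        have hno2 : ∀ ρ1 ∈ H, ¬ ρ1 ⊆ ρ.erase v := by
          intro ρ1 h1 h2
          refine hno ρ1 h1 fun x hx => ?_
          have hx2 := h2 hx
          have hx3 := hsub (Finset.mem_of_mem_erase hx2)
          have := Finset.mem_of_mem_erase hx3
          rw [hσdef, Finset.mem_insert] at this
          exact Finset.mem_erase.2 ⟨Finset.ne_of_mem_erase hx3, this.resolve_left (Finset.ne_of_mem_erase hx2)⟩
        have hvρ := key ρ hρ (hsub.trans (Finset.erase_subset _ _)) hno2
        exact hno2 ρ hρ (by rw [Finset.erase_eq_of_notMem hvρ])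
      omega

/-- free facet of `K`. -/
def isFree (K : Finset (Finset (Fin n))) (τ : Finset (Fin n)) : Prop :=
  ∃ σ0 ∈ K, ∃ v0 ∈ σ0, τ = σ0.erase v0 ∧ ∀ σ' ∈ K, τ ⊆ σ' → σ' = σ0

def tauK (K : Finset (Finset (Fin n))) : Finset (Fin n) :=
  if h : ∃ τ, isFree K τ then Classical.choose h else ∅

lemma tauK_spec {K : Finset (Finset (Fin n))} (h : ¬ isCore K) : isFree K (tauK K) := by
  have hex : ∃ τ, isFree K τ := by
    unfold isCore at h
    push Not at h
    obtain ⟨σ, hσ, v, hv, hh⟩ := h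
    exact ⟨σ.erase v, σ, hσ, v, hv, rfl, fun σ' h1 h2 => by
      by_contra hne; exact hh σ' h1 hne h2⟩
  unfold tauK
  rw [dif_pos hex]
  exact Classical.choose_spec hex

def isMinCore (A : Finset (Finset (Fin n))) : Prop :=
  A.Nonempty ∧ isCore A ∧ ∀ K ⊂ A, K.Nonempty → ¬ isCore K

def extK (K : Finset (Finset (Fin n))) (v : Fin n) : Finset (Finset (Fin n)) :=
  insert (insert v (tauK K)) K

/-- reachable partial families. -/
def RR (d : ℕ) (H : Finset (Finset (Fin n))) (AA : Finset (Finset (Finset (Fin n)))) :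
    ℕ → ℕ → Finset (Finset (Finset (Fin n)))
  | 0, 0 => (allFaces n d).image (fun σ => {σ})
  | 0, _ + 1 => ∅
  | i + 1, 0 => (RR d H AA i 0).biUnion (fun K => Finset.univ.image (extK K))
  | i + 1, q + 1 => (RR d H AA i (q + 1)).biUnion (fun K => Finset.univ.image (extK K)) ∪
      ((RR d H AA i q).filter (fun K => tauK K ∈ K.shadow ∧ (tauK K).card = d ∧ ∃ A ∈ AA, K ⊆ A)).biUnion
        (fun K => (Finset.univ.filter (fun v => savingV H K (tauK K) v)).image (extK K))

lemma RR_nonsaving {d : ℕ} {H : Finset (Finset (Fin n))} {AA : Finset (Finset (Finset (Fin n)))}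
    {i q : ℕ} {K : Finset (Finset (Fin n))} (hK : K ∈ RR d H AA i q) (v : Fin n) :
    extK K v ∈ RR d H AA (i + 1) q := by
  rcases q with _ | q
  · exact Finset.mem_biUnion.2 ⟨K, hK, Finset.mem_image_of_mem _ (Finset.mem_univ _)⟩
  · exact Finset.mem_union_left _ (Finset.mem_biUnion.2 ⟨K, hK, Finset.mem_image_of_mem _ (Finset.mem_univ _)⟩)

lemma savings_card {d B : ℕ} {H K A : Finset (Finset (Fin n))} (hKA : K ⊆ A)
    (hB : ∀ ρ ∉ H, ρ.card < d → (Finset.univ.filter (fun v => v ∉ ρ ∧ insert v ρ ∈ H ∪ A.shadow)).card ≤ B)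
    (hτ : (tauK K).card = d) :
    (Finset.univ.filter (fun v => savingV H K (tauK K) v)).card ≤ 2 ^ d * B := by
  have : (Finset.univ.filter (fun v => savingV H K (tauK K) v)) ⊆
      ((tauK K).ssubsets.filter (fun ρ => ρ ∉ H)).biUnion
        (fun ρ => Finset.univ.filter (fun v => v ∉ ρ ∧ insert v ρ ∈ H ∪ A.shadow)) := by
    intro v hv
    obtain ⟨hvτ, ρ, hρ, hρH, hm⟩ := (Finset.mem_filter.1 hv).2
    refine Finset.mem_biUnion.2 ⟨ρ, Finset.mem_filter.2 ⟨Finset.mem_ssubsets.2 hρ, hρH⟩, ?_⟩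
    refine Finset.mem_filter.2 ⟨Finset.mem_univ _, fun h => hvτ (hρ.1 h), ?_⟩
    rcases Finset.mem_union.1 hm with h | h
    · exact Finset.mem_union_left _ h
    · exact Finset.mem_union_right _ (shadow_mono' hKA h)
  refine (Finset.card_le_card this).trans ?_
  refine (Finset.card_biUnion_le_card_mul _ _ B fun ρ hρ => ?_).trans ?_
  · obtain ⟨h1, h2⟩ := Finset.mem_filter.1 hρ
    exact hB ρ h2 (hτ ▸ Finset.card_lt_card (Finset.mem_ssubsets.1 h1))
  · refine Nat.mul_le_mul_right _ ((Finset.card_filter_le _ _).trans ?_)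
    rw [← hτ, ← Finset.card_powerset]
    exact Finset.card_le_card (Finset.erase_subset _ _)

lemma RR_card {d B : ℕ} {H : Finset (Finset (Fin n))} {AA : Finset (Finset (Finset (Fin n)))}
    (hB : ∀ A ∈ AA, ∀ ρ ∉ H, ρ.card < d →
      (Finset.univ.filter (fun v => v ∉ ρ ∧ insert v ρ ∈ H ∪ A.shadow)).card ≤ B) (i q : ℕ) :
    (RR d H AA i q).card * n ^ q ≤ n ^ (d + 1) * 2 ^ i * n ^ i * (2 ^ d * B) ^ q := by
  have hub : ∀ S : Finset (Finset (Finset (Fin n))),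
      (S.biUnion (fun K => Finset.univ.image (extK K))).card ≤ S.card * n := by
    intro S
    refine Finset.card_biUnion_le_card_mul _ _ _ fun K _ => Finset.card_image_le.trans ?_
    simp
  induction i generalizing q with
  | zero =>
    rcases q with _ | q
    · simp only [RR, pow_zero, mul_one]
      refine Finset.card_image_le.trans ?_
      have : allFaces n d = Finset.powersetCard (d+1) Finset.univ := by
        ext; simp [allFaces, Finset.mem_powersetCard]
      rw [this]; simp only [Finset.card_powersetCard, Finset.card_univ, Fintype.card_fin]
      exact Nat.choose_le_pow _ _
    · simp [RR]
  | succ i ih =>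
    rcases q with _ | q
    · have h1 := ih 0
      have h2 := hub (RR d H AA i 0)
      simp only [pow_zero, mul_one] at h1 ⊢
      calc _ ≤ (RR d H AA i 0).card * n := h2
        _ ≤ (n ^ (d + 1) * 2 ^ i * n ^ i) * n := Nat.mul_le_mul_right _ h1
        _ ≤ (n ^ (d + 1) * 2 ^ i * n ^ i) * n * 2 := Nat.le_mul_of_pos_right _ (by norm_num)
        _ = _ := by ring
    · have h1 := ih (q + 1)
      have h0 := ih q
      have h2 := hub (RR d H AA i (q + 1))
      have h3 : (((RR d H AA i q).filter (fun K => tauK K ∈ K.shadow ∧ (tauK K).card = d ∧ ∃ A ∈ AA, K ⊆ A)).biUnion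
        (fun K => (Finset.univ.filter (fun v => savingV H K (tauK K) v)).image (extK K))).card
          ≤ (RR d H AA i q).card * (2 ^ d * B) := by
        refine (Finset.card_biUnion_le_card_mul _ _ (2 ^ d * B) fun K hK => ?_).trans
          (Nat.mul_le_mul_right _ (Finset.card_filter_le _ _))
        obtain ⟨-, h5, h6, A, hA, hKA⟩ := Finset.mem_filter.1 hK
        exact Finset.card_image_le.trans (savings_card hKA (hB A hA) h6)
      have h4 : (RR d H AA (i + 1) (q + 1)).card ≤ (RR d H AA i (q + 1)).card * n
          + (RR d H AA i q).card * (2 ^ d * B) := by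
        conv_lhs => rw [RR]
        exact (Finset.card_union_le _ _).trans (Nat.add_le_add h2 h3)
      calc _ ≤ ((RR d H AA i (q + 1)).card * n + (RR d H AA i q).card * (2 ^ d * B)) * n ^ (q + 1) :=
            Nat.mul_le_mul_right _ h4
        _ = ((RR d H AA i (q + 1)).card * n ^ (q + 1)) * n
            + ((RR d H AA i q).card * n ^ q) * (2 ^ d * B * n) := by ring
        _ ≤ (n ^ (d + 1) * 2 ^ i * n ^ i * (2 ^ d * B) ^ (q + 1)) * n
            + (n ^ (d + 1) * 2 ^ i * n ^ i * (2 ^ d * B) ^ q) * (2 ^ d * B * n) :=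
            Nat.add_le_add (Nat.mul_le_mul_right _ h1) (Nat.mul_le_mul_right _ h0)
        _ = _ := by ring

lemma chain_exists {d : ℕ} (hd : 2 ≤ d) {H : Finset (Finset (Fin n))}
    {AA : Finset (Finset (Finset (Fin n)))} (hH : ∀ ρ ∈ H, 1 ≤ ρ.card ∧ ρ.card < d)
    {A : Finset (Finset (Fin n))} (hA : A ∈ AA) (hmin : isMinCore A) (hAF : A ⊆ allFaces n d) :
    ∀ i < A.card, ∃ q ≤ i, ∃ K ⊆ A, K.card = i + 1 ∧ K ∈ RR d H AA i q ∧ stepInv d H K i q := by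
  have hcard : ∀ σ ∈ A, σ.card = d + 1 := fun σ hσ => by
    have := hAF hσ; simpa [allFaces] using this
  intro i
  induction i with
  | zero =>
    intro _
    obtain ⟨σ, hσ⟩ := hmin.1
    refine ⟨0, le_rfl, {σ}, Finset.singleton_subset_iff.2 hσ, by simp, ?_, ?_⟩
    · exact Finset.mem_image_of_mem _ (hAF hσ)
    · unfold stepInv
      have h1 : GS H {σ} = gS H σ := Finset.sum_singleton _ _
      have h2 : gS H σ ≤ fS H {σ} := by
        unfold gS fS
        rw [← card_image_erase σ _ (Finset.filter_subset _ _)]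
        refine Finset.card_le_card fun η hη => ?_
        obtain ⟨u, hu, rfl⟩ := Finset.mem_image.1 hη
        obtain ⟨h1, h2⟩ := Finset.mem_filter.1 hu
        exact Finset.mem_filter.2 ⟨Finset.erase_mem_shadow (Finset.mem_singleton_self _) h1, h2⟩
      rw [h1]; omega
  | succ i ih =>
    intro hi
    obtain ⟨q, hq, K, hKA, hKc, hKR, hinv⟩ := ih (by omega)
    have hKss : K ⊂ A := Finset.ssubset_iff_subset_ne.2 ⟨hKA, fun h => by rw [h] at hKc; omega⟩
    have hKne : K.Nonempty := Finset.card_pos.1 (by omega)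
    have hfree := tauK_spec (hmin.2.2 K hKss hKne)
    obtain ⟨σ0, hσ0, v0, hv0, hτ, hdeg⟩ := hfree
    obtain ⟨σ', hσ'A, hne, hsub⟩ := hmin.2.1 σ0 (hKA hσ0) v0 hv0
    rw [← hτ] at hsub
    have hσ'K : σ' ∉ K := fun h => hne (hdeg σ' h hsub)
    have hτc : (tauK K).card = d := by
      rw [hτ, Finset.card_erase_of_mem hv0, hcard σ0 (hKA hσ0)]; rfl
    obtain ⟨v, hv, hve⟩ := exists_erase ⟨hsub, by rw [hτc, hcard σ' hσ'A]⟩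
    have hvτ : v ∉ tauK K := by rw [hve]; exact Finset.notMem_erase _ _
    have hins : insert v (tauK K) = σ' := by rw [hve, Finset.insert_erase hv]
    have hsubA : extK K v ⊆ A := by
      unfold extK; rw [hins]; exact Finset.insert_subset hσ'A hKA
    have hcardE : (extK K v).card = i + 1 + 1 := by
      unfold extK; rw [hins, Finset.card_insert_of_notMem hσ'K, hKc]
    by_cases hs : savingV H K (tauK K) v
    · refine ⟨q + 1, by omega, extK K v, hsubA, hcardE, ?_, ?_⟩
      · refine Finset.mem_union_right _ (Finset.mem_biUnion.2 ⟨K, ?_, ?_⟩)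
        · refine Finset.mem_filter.2 ⟨hKR, ?_, hτc, A, hA, hKA⟩
          rw [hτ]; exact Finset.erase_mem_shadow hσ0 hv0
        · exact Finset.mem_image_of_mem _ (Finset.mem_filter.2 ⟨Finset.mem_univ _, hs⟩)
      · unfold extK
        rw [hins]
        exact step_saving hσ'K (hcard σ' hσ'A) hinv
    · refine ⟨q, by omega, extK K v, hsubA, hcardE, RR_nonsaving hKR v, ?_⟩
      exact step_nonsaving hd hH hσ0 hv0 hτ hdeg hτc hvτ (hins ▸ hσ'K) hs hinv

lemma core_GS {d : ℕ} {H A : Finset (Finset (Fin n))} (hA : isCore A) (hAF : A ⊆ allFaces n d) : 2 * fS H A ≤ GS H A := by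
  have hg : ∀ σ ∈ A, gS H σ = ∑ η ∈ A.shadow.filter (goodS H), if (∃ u ∈ σ, σ.erase u = η) then 1 else 0 := by
    intro σ hσ
    rw [Finset.sum_boole, gS, ← card_image_erase σ _ (Finset.filter_subset _ _)]
    norm_cast
    congr 1
    ext η
    simp only [Finset.mem_image, Finset.mem_filter]
    constructor
    · rintro ⟨u, ⟨h1, h2⟩, rfl⟩
      exact ⟨⟨Finset.erase_mem_shadow hσ h1, h2⟩, u, h1, rfl⟩
    · rintro ⟨⟨h1, h2⟩, u, h3, rfl⟩
      exact ⟨u, ⟨h3, h2⟩, rfl⟩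
  unfold GS
  rw [Finset.sum_congr rfl hg, Finset.sum_comm, fS, mul_comm, ← smul_eq_mul, ← Finset.sum_const]
  refine Finset.sum_le_sum fun η hη => ?_
  have hcard : ∀ σ ∈ A, σ.card = d + 1 := fun σ hσ => by
    have := hAF hσ; simpa [allFaces] using this
  obtain ⟨σ, hσ, v, hv, rfl⟩ := Finset.mem_shadow_iff.1 (Finset.mem_filter.1 hη).1
  obtain ⟨σ', hσ', hne, hsub⟩ := hA σ hσ v hv
  rw [Finset.sum_boole]
  norm_cast
  rw [show (2:ℕ) = ({σ, σ'} : Finset (Finset (Fin n))).card by rw [Finset.card_pair hne.symm]]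
  refine Finset.card_le_card fun x hx => ?_
  rw [Finset.mem_insert, Finset.mem_singleton] at hx
  rcases hx with rfl | rfl
  · exact Finset.mem_filter.2 ⟨hσ, v, hv, rfl⟩
  · refine Finset.mem_filter.2 ⟨hσ', ?_⟩
    obtain ⟨w, hw, he⟩ := exists_erase ⟨hsub, by
      rw [Finset.card_erase_of_mem hv, hcard σ hσ, hcard x hσ']; rfl⟩
    exact ⟨w, hw, he.symm⟩

/-- The main counting lemma for minimal cores. -/
lemma count_cores {d B b m q0 : ℕ} (hd : 2 ≤ d) {H : Finset (Finset (Fin n))}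
    {AA : Finset (Finset (Finset (Fin n)))} (hH : ∀ ρ ∈ H, 1 ≤ ρ.card ∧ ρ.card < d)
    (hAA : ∀ A ∈ AA, isMinCore A ∧ A ⊆ allFaces n d ∧ A.card = m)
    (hB : ∀ A ∈ AA, ∀ ρ ∉ H, ρ.card < d →
      (Finset.univ.filter (fun v => v ∉ ρ ∧ insert v ρ ∈ H ∪ A.shadow)).card ≤ B)
    (hb : ∀ A ∈ AA, (A.shadow.filter (veryBad H)).card ≤ b)
    (hn : 0 < n) (hBn : 2 ^ d * B ≤ n) (hq0 : ∀ q, m ≤ (d + 2) * q + b + 1 → q0 ≤ q) (hm : 1 ≤ m) :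
    AA.card * n ^ q0 ≤ m * (n ^ d * 2 ^ m * n ^ m * (2 ^ d * B) ^ q0) := by
  have hsub : AA ⊆ (Finset.Icc q0 (m - 1)).biUnion (fun q => RR d H AA (m - 1) q) := by
    intro A hA
    obtain ⟨h1, h2, h3⟩ := hAA A hA
    obtain ⟨q, hq, K, hKA, hKc, hKR, hinv⟩ := chain_exists hd hH hA h1 h2 (m - 1) (by omega)
    have : K = A := Finset.eq_of_subset_of_card_le hKA (by omega)
    subst this
    refine Finset.mem_biUnion.2 ⟨q, Finset.mem_Icc.2 ⟨?_, hq⟩, hKR⟩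
    apply hq0
    unfold stepInv at hinv
    have h4 := core_GS (H := H) h1.2.1 h2
    have h5 : VB2 H K ≤ b := by
      refine le_trans (Finset.card_le_card fun x hx => ?_) (hb K hA)
      obtain ⟨a1, a2, a3⟩ := Finset.mem_filter.1 hx
      exact Finset.mem_filter.2 ⟨a1, a2⟩
    omega
  have hterm : ∀ q ∈ Finset.Icc q0 (m - 1), (RR d H AA (m - 1) q).card * n ^ q0
      ≤ n ^ d * 2 ^ m * n ^ m * (2 ^ d * B) ^ q0 := by
    intro q hq
    obtain ⟨hq1, hq2⟩ := Finset.mem_Icc.1 hq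
    have h1 := RR_card hB (m - 1) q
    · have hpos : 0 < n ^ (q - q0) := Nat.pos_of_ne_zero (pow_ne_zero _ hn.ne')
      refine Nat.le_of_mul_le_mul_right ?_ hpos
      calc (RR d H AA (m - 1) q).card * n ^ q0 * n ^ (q - q0)
          = (RR d H AA (m - 1) q).card * n ^ q := by
            rw [mul_assoc, ← pow_add]; congr 2; omega
        _ ≤ n ^ (d + 1) * 2 ^ (m - 1) * n ^ (m - 1) * (2 ^ d * B) ^ q := h1
        _ = n ^ (d + 1) * 2 ^ (m - 1) * n ^ (m - 1) * (2 ^ d * B) ^ q0 * (2 ^ d * B) ^ (q - q0) := by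
            rw [mul_assoc _ _ ((2 ^ d * B) ^ (q - q0)), ← pow_add]; congr 2; omega
        _ ≤ n ^ (d + 1) * 2 ^ (m - 1) * n ^ (m - 1) * (2 ^ d * B) ^ q0 * n ^ (q - q0) :=
            Nat.mul_le_mul_left _ (Nat.pow_le_pow_left hBn _)
        _ ≤ n ^ (d + 1) * 2 ^ (m - 1) * n ^ (m - 1) * (2 ^ d * B) ^ q0 * n ^ (q - q0) * 2 :=
            Nat.le_mul_of_pos_right _ (by norm_num)
        _ = n ^ d * 2 ^ m * n ^ m * (2 ^ d * B) ^ q0 * n ^ (q - q0) := by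
            obtain ⟨k, rfl⟩ : ∃ k, m = k + 1 := ⟨m - 1, by omega⟩
            simp only [Nat.add_sub_cancel]; ring
  calc AA.card * n ^ q0 ≤ (∑ q ∈ Finset.Icc q0 (m - 1), (RR d H AA (m - 1) q).card) * n ^ q0 :=
        Nat.mul_le_mul_right _ ((Finset.card_le_card hsub).trans Finset.card_biUnion_le)
    _ = ∑ q ∈ Finset.Icc q0 (m - 1), (RR d H AA (m - 1) q).card * n ^ q0 := Finset.sum_mul _ _ _
    _ ≤ ∑ q ∈ Finset.Icc q0 (m - 1), (n ^ d * 2 ^ m * n ^ m * (2 ^ d * B) ^ q0) :=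
        Finset.sum_le_sum hterm
    _ ≤ _ := by
        rw [Finset.sum_const, smul_eq_mul]
        refine Nat.mul_le_mul_right _ ?_
        rw [Nat.card_Icc]; omega

end

section

variable {n : ℕ}

lemma core_other {d : ℕ} {A : Finset (Finset (Fin n))} (hcard : ∀ σ ∈ A, σ.card = d + 1)
    (hA : isCore A) {σ : Finset (Fin n)} (hσ : σ ∈ A) {u : Fin n} (hu : u ∈ σ) :
    ∃ w, w ∉ σ ∧ insert w (σ.erase u) ∈ A := by
  obtain ⟨σ', h1, h2, h3⟩ := hA σ hσ u hu
  obtain ⟨w, hw, he⟩ := exists_erase ⟨h3, by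
    rw [Finset.card_erase_of_mem hu, hcard σ hσ, hcard σ' h1]; rfl⟩
  have hi : insert w (σ.erase u) = σ' := by rw [he, Finset.insert_erase hw]
  refine ⟨w, fun hwσ => ?_, hi ▸ h1⟩
  have hwu : w = u := by
    by_contra hne
    have : w ∈ σ.erase u := Finset.mem_erase.2 ⟨hne, hwσ⟩
    rw [he] at this; exact Finset.notMem_erase _ _ this
  rw [hwu, Finset.insert_erase hu] at hi
  exact h2 hi.symm

/-- the star of `x` obtained from `σ` and choice of `w`. -/
lemma star_card {d : ℕ} {σ : Finset (Fin n)} (hc : σ.card = d + 1) {x : Fin n} (hx : x ∈ σ)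
    (w : Fin n → Fin n) (hw : ∀ u ∈ σ, w u ∉ σ) :
    (insert σ ((σ.erase x).image (fun u => insert (w u) (σ.erase u)))).card = d + 1 := by
  rw [Finset.card_insert_of_notMem, Finset.card_image_of_injOn, Finset.card_erase_of_mem hx, hc]
  · omega
  · intro a ha b hb hab
    have ha' := Finset.mem_of_mem_erase (Finset.mem_coe.1 ha)
    have hb' := Finset.mem_of_mem_erase (Finset.mem_coe.1 hb)
    by_contra hne
    have h1 : a ∈ insert (w b) (σ.erase b) :=
      Finset.mem_insert_of_mem (Finset.mem_erase.2 ⟨hne, ha'⟩)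
    have hab' : insert (w a) (σ.erase a) = insert (w b) (σ.erase b) := hab
    rw [← hab', Finset.mem_insert] at h1
    rcases h1 with h1 | h1
    · exact hw a ha' (h1 ▸ ha')
    · exact Finset.notMem_erase _ _ h1
  · intro h
    obtain ⟨u, hu, he⟩ := Finset.mem_image.1 h
    exact hw u (Finset.mem_of_mem_erase hu) (he ▸ Finset.mem_insert_self _ _)

lemma core_vertices {d : ℕ} (hd : 2 ≤ d) {A : Finset (Finset (Fin n))} (hAF : A ⊆ allFaces n d)
    (hA : isCore A) (hne : A.Nonempty) (hns : noSimplex d A) :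
    (A.biUnion id).card + 1 ≤ A.card := by
  have hcard : ∀ σ ∈ A, σ.card = d + 1 := fun σ hσ => by
    have := hAF hσ; simpa [allFaces] using this
  have hex : ∀ σ : Finset (Fin n), ∃ w : Fin n → Fin n, σ ∈ A → ∀ u ∈ σ, w u ∉ σ ∧ insert (w u) (σ.erase u) ∈ A := by
    intro σ
    by_cases hσ : σ ∈ A
    · have := fun u : Fin n => (show ∃ w, u ∈ σ → w ∉ σ ∧ insert w (σ.erase u) ∈ A by
        by_cases hu : u ∈ σ
        · obtain ⟨w, h⟩ := core_other hcard hA hσ hu; exact ⟨w, fun _ => h⟩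
        · exact ⟨u, fun h => absurd h hu⟩)
      choose w hw using this
      exact ⟨w, fun _ => hw⟩
    · exact ⟨id, fun h => absurd h hσ⟩
  choose w hw using hex
  set star : Finset (Fin n) → Fin n → Finset (Finset (Fin n)) := fun σ x =>
    insert σ ((σ.erase x).image (fun u => insert (w σ u) (σ.erase u))) with hstar
  have hstar_sub : ∀ σ ∈ A, ∀ x ∈ σ, star σ x ⊆ A.filter (fun σ' => x ∈ σ') := by
    intro σ hσ x hx y hy
    rcases Finset.mem_insert.1 hy with rfl | hy
    · exact Finset.mem_filter.2 ⟨hσ, hx⟩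
    · obtain ⟨u, hu, rfl⟩ := Finset.mem_image.1 hy
      refine Finset.mem_filter.2 ⟨(hw σ hσ u (Finset.mem_of_mem_erase hu)).2, ?_⟩
      exact Finset.mem_insert_of_mem (Finset.mem_erase.2 ⟨(Finset.ne_of_mem_erase hu).symm, hx⟩)
  have hstar_card : ∀ σ ∈ A, ∀ x ∈ σ, (star σ x).card = d + 1 := fun σ hσ x hx =>
    star_card (hcard σ hσ) hx (w σ) (fun u hu => (hw σ hσ u hu).1)
  set V := A.biUnion id with hV
  have hdeg : ∀ x ∈ V, d + 1 ≤ (A.filter (fun σ' => x ∈ σ')).card := by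
    intro x hx
    obtain ⟨σ, hσ, hxσ⟩ := Finset.mem_biUnion.1 hx
    rw [← hstar_card σ hσ x hxσ]
    exact Finset.card_le_card (hstar_sub σ hσ x hxσ)
  have hsum : ∑ x ∈ V, (A.filter (fun σ' => x ∈ σ')).card = A.card * (d + 1) := by
    have : ∑ σ ∈ A, σ.card = A.card * (d + 1) := Finset.sum_const_nat hcard
    rw [← this]
    simp_rw [Finset.card_filter]
    rw [Finset.sum_comm]
    refine Finset.sum_congr rfl fun σ hσ => ?_
    rw [← Finset.card_filter]
    congr 1
    ext x
    simp only [Finset.mem_filter]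
    exact ⟨fun h => h.2, fun h => ⟨Finset.mem_biUnion.2 ⟨σ, hσ, h⟩, h⟩⟩
  by_contra hcon
  push Not at hcon
  have hle : A.card ≤ V.card := by omega
  have hdeg_eq : ∀ x ∈ V, (A.filter (fun σ' => x ∈ σ')).card = d + 1 := by
    intro x hx
    by_contra hne'
    have hlt : ∑ x ∈ V, (d + 1) < ∑ x ∈ V, (A.filter (fun σ' => x ∈ σ')).card :=
      Finset.sum_lt_sum hdeg ⟨x, hx, lt_of_le_of_ne (hdeg x hx) (Ne.symm hne')⟩
    rw [hsum, Finset.sum_const, smul_eq_mul] at hlt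
    have := Nat.mul_le_mul_right (d + 1) hle
    omega
  have hstar_eq : ∀ σ ∈ A, ∀ x ∈ σ, star σ x = A.filter (fun σ' => x ∈ σ') := by
    intro σ hσ x hx
    refine Finset.eq_of_subset_of_card_le (hstar_sub σ hσ x hx) ?_
    rw [hstar_card σ hσ x hx, hdeg_eq x (Finset.mem_biUnion.2 ⟨σ, hσ, hx⟩)]
  obtain ⟨σ, hσ⟩ := hne
  have hww : ∀ u ∈ σ, ∀ u' ∈ σ, u ≠ u' → w σ u = w σ u' := by
    intro u hu u' hu' huu
    -- third vertex x
    have : ((σ.erase u).erase u').Nonempty := by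
      apply Finset.card_pos.1
      rw [Finset.card_erase_of_mem (Finset.mem_erase.2 ⟨huu.symm, hu'⟩), Finset.card_erase_of_mem hu, hcard σ hσ]
      omega
    obtain ⟨x, hx⟩ := this
    simp only [Finset.mem_erase] at hx
    obtain ⟨hxu', hxu, hxσ⟩ := hx
    set σu := insert (w σ u) (σ.erase u) with hσu
    obtain ⟨hwu, hσuA⟩ := hw σ hσ u hu
    have hu'σu : u' ∈ σu := Finset.mem_insert_of_mem (Finset.mem_erase.2 ⟨huu.symm, hu'⟩)
    obtain ⟨σ', hσ', hneq, hsub⟩ := hA σu hσuA u' hu'σu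
    have hwne : w σ u ≠ u' := fun h => hwu (h ▸ hu')
    have hxσ' : x ∈ σ' := hsub (Finset.mem_erase.2 ⟨hxu', Finset.mem_insert_of_mem (Finset.mem_erase.2 ⟨hxu, hxσ⟩)⟩)
    have hwσ' : w σ u ∈ σ' := hsub (Finset.mem_erase.2 ⟨hwne, Finset.mem_insert_self _ _⟩)
    have hmem : σ' ∈ star σ x := by rw [hstar_eq σ hσ x hxσ]; exact Finset.mem_filter.2 ⟨hσ', hxσ'⟩
    rcases Finset.mem_insert.1 hmem with h | h
    · exact absurd (h ▸ hwσ') hwu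
    · obtain ⟨u2, hu2, he⟩ := Finset.mem_image.1 h
      have hu2σ := Finset.mem_of_mem_erase hu2
      have hu2u : u2 ≠ u := by rintro rfl; exact hneq he.symm
      have hu2u' : u2 = u' := by
        by_contra hne'
        have h1 : u2 ∈ σ' := hsub (Finset.mem_erase.2 ⟨hne', Finset.mem_insert_of_mem
          (Finset.mem_erase.2 ⟨hu2u, hu2σ⟩)⟩)
        rw [← he, Finset.mem_insert] at h1
        rcases h1 with h1 | h1
        · exact (hw σ hσ u2 hu2σ).1 (h1 ▸ hu2σ)
        · exact Finset.notMem_erase _ _ h1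
      subst hu2u'
      rw [← he, Finset.mem_insert] at hwσ'
      rcases hwσ' with h1 | h1
      · exact h1
      · exact absurd (Finset.mem_of_mem_erase h1) hwu
  have hσne : σ.Nonempty := Finset.card_pos.1 (by rw [hcard σ hσ]; omega)
  obtain ⟨x, hx⟩ := hσne
  have hwx := (hw σ hσ x hx).1
  obtain ⟨s, hs, hsc, hsA⟩ := hns (insert (w σ x) σ) (by rw [Finset.card_insert_of_notMem hwx, hcard σ hσ])
  apply hsA
  obtain ⟨y, hy, rfl⟩ := exists_erase ⟨hs, by rw [hsc, Finset.card_insert_of_notMem hwx, hcard σ hσ]⟩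
  rcases Finset.mem_insert.1 hy with rfl | hy
  · rw [Finset.erase_insert hwx]; exact hσ
  · have hyw : w σ x ≠ y := fun h => hwx (h ▸ hy)
    have hxy : w σ x = w σ y := by
      by_cases h : x = y
      · rw [h]
      · exact hww x hx y hy h
    rw [Finset.erase_insert_of_ne hyw, hxy]
    exact (hw σ hσ y hy).2

end

section

variable {n : ℕ}

/-- heavy sets -/
def HH (γ : ℝ) (d : ℕ) (A : Finset (Finset (Fin n))) : ℕ → Finset (Finset (Fin n))
  | 0 => A.shadow
  | k + 1 => Finset.univ.filter (fun ρ => ρ.card + k + 1 = d ∧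
      γ ^ (2 ^ k) * n ≤ ((Finset.univ.filter (fun v => v ∉ ρ ∧ insert v ρ ∈ HH γ d A k)).card : ℝ))

def ecH (γ : ℝ) (d : ℕ) (A : Finset (Finset (Fin n))) (k : ℕ) (ρ : Finset (Fin n)) : ℕ :=
  (Finset.univ.filter (fun v => v ∉ ρ ∧ insert v ρ ∈ HH γ d A k)).card

lemma mem_HH_succ {γ : ℝ} {d : ℕ} {A : Finset (Finset (Fin n))} {k : ℕ} {ρ : Finset (Fin n)} :
    ρ ∈ HH γ d A (k + 1) ↔ ρ.card + k + 1 = d ∧ γ ^ (2 ^ k) * n ≤ (ecH γ d A k ρ : ℝ) := by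
  simp [HH, ecH]

lemma HH_card_mem {γ : ℝ} {d : ℕ} {A : Finset (Finset (Fin n))} (hAF : A ⊆ allFaces n d) {k : ℕ}
    {ρ : Finset (Fin n)} (h : ρ ∈ HH γ d A k) : ρ.card + k = d := by
  rcases k with _ | k
  · obtain ⟨σ, hσ, v, hv, rfl⟩ := Finset.mem_shadow_iff.1 h
    have : σ.card = d + 1 := by simpa [allFaces] using hAF hσ
    rw [Finset.card_erase_of_mem hv, this]; rfl
  · have := (mem_HH_succ.1 h).1; omega

lemma HH_double {γ : ℝ} {d : ℕ} {A : Finset (Finset (Fin n))} (hAF : A ⊆ allFaces n d) (k : ℕ) :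
    ∑ ρ ∈ HH γ d A (k + 1), ecH γ d A k ρ ≤ d * (HH γ d A k).card := by
  have h1 : ∑ η ∈ HH γ d A k, η.card ≤ d * (HH γ d A k).card := by
    rw [mul_comm, ← smul_eq_mul, ← Finset.sum_const]
    exact Finset.sum_le_sum fun η hη => by have := HH_card_mem hAF hη; omega
  refine le_trans ?_ h1
  have e1 : ∑ ρ ∈ HH γ d A (k + 1), ecH γ d A k ρ = ((HH γ d A (k + 1)).sigma
      (fun ρ => Finset.univ.filter (fun v => v ∉ ρ ∧ insert v ρ ∈ HH γ d A k))).card := by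
    rw [Finset.card_sigma]; rfl
  rw [e1, ← Finset.card_sigma (HH γ d A k) (fun η => η)]
  refine Finset.card_le_card_of_injOn (fun x => ⟨insert x.2 x.1, x.2⟩) ?_ ?_
  · rintro ⟨ρ, v⟩ hx
    have := (Finset.mem_filter.1 (Finset.mem_sigma.1 (Finset.mem_coe.1 hx)).2).2
    exact Finset.mem_coe.2 (Finset.mem_sigma.2 ⟨this.2, Finset.mem_insert_self _ _⟩)
  · rintro ⟨ρ, v⟩ hx ⟨ρ', v'⟩ hx' h
    have h1 := (Finset.mem_filter.1 (Finset.mem_sigma.1 (Finset.mem_coe.1 hx)).2).2.1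
    have h2 := (Finset.mem_filter.1 (Finset.mem_sigma.1 (Finset.mem_coe.1 hx')).2).2.1
    simp only [Sigma.mk.injEq, heq_eq_eq] at h ⊢
    obtain ⟨h3, rfl⟩ := h
    refine ⟨?_, rfl⟩
    have := congrArg (fun s => s.erase v) h3
    simpa [Finset.erase_insert h1, Finset.erase_insert h2] using this

lemma HH_bound {γ : ℝ} (hγ : 0 < γ) {d : ℕ} {A : Finset (Finset (Fin n))} (hAF : A ⊆ allFaces n d)
    (k : ℕ) : ((HH γ d A k).card : ℝ) * (γ ^ (2 ^ k) * n ^ k) ≤ γ * d ^ k * A.shadow.card := by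
  induction k with
  | zero => simp [HH]; rw [mul_comm]
  | succ k ih =>
    have h1 : ((HH γ d A (k + 1)).card : ℝ) * (γ ^ (2 ^ k) * n) ≤ d * (HH γ d A k).card := by
      have h2 : ((∑ ρ ∈ HH γ d A (k + 1), ecH γ d A k ρ : ℕ) : ℝ) ≤ d * (HH γ d A k).card := by
        exact_mod_cast HH_double hAF k
      refine le_trans ?_ h2
      rw [← nsmul_eq_mul, ← Finset.sum_const]
      push_cast
      exact Finset.sum_le_sum fun ρ hρ => (mem_HH_succ.1 hρ).2
    have hnn : (0:ℝ) ≤ γ ^ (2 ^ k) * n ^ k := by positivity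
    calc ((HH γ d A (k + 1)).card : ℝ) * (γ ^ (2 ^ (k + 1)) * n ^ (k + 1))
        = (((HH γ d A (k + 1)).card : ℝ) * (γ ^ (2 ^ k) * n)) * (γ ^ (2 ^ k) * n ^ k) := by
          rw [pow_succ 2 k, pow_mul]; ring
      _ ≤ (d * (HH γ d A k).card) * (γ ^ (2 ^ k) * n ^ k) := mul_le_mul_of_nonneg_right h1 hnn
      _ = d * ((HH γ d A k).card * (γ ^ (2 ^ k) * n ^ k)) := by ring
      _ ≤ d * (γ * d ^ k * A.shadow.card) := mul_le_mul_of_nonneg_left ih (by positivity)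
      _ = _ := by ring

def HHu (γ : ℝ) (d : ℕ) (A : Finset (Finset (Fin n))) : Finset (Finset (Fin n)) :=
  (Finset.Icc 1 (d - 1)).biUnion (HH γ d A)

lemma mem_HHu {γ : ℝ} {d : ℕ} {A : Finset (Finset (Fin n))} {ρ : Finset (Fin n)} :
    ρ ∈ HHu γ d A ↔ ∃ k, (1 ≤ k ∧ k ≤ d - 1) ∧ ρ ∈ HH γ d A k := by
  simp [HHu]

lemma HHu_sizes {γ : ℝ} {d : ℕ} (hd : 2 ≤ d) {A : Finset (Finset (Fin n))} (hAF : A ⊆ allFaces n d) :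
    ∀ ρ ∈ HHu γ d A, 1 ≤ ρ.card ∧ ρ.card < d := by
  intro ρ hρ
  obtain ⟨k, hk, h⟩ := mem_HHu.1 hρ
  have := HH_card_mem hAF h
  omega

lemma HHu_mem_HH {γ : ℝ} {d : ℕ} {A : Finset (Finset (Fin n))} (hAF : A ⊆ allFaces n d)
    {ρ : Finset (Fin n)} {k : ℕ} (hk : ρ.card + k = d) (h : ρ ∈ HHu γ d A ∪ A.shadow) :
    ρ ∈ HH γ d A k := by
  rcases Finset.mem_union.1 h with h | h
  · obtain ⟨k', hk', h'⟩ := mem_HHu.1 h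
    have := HH_card_mem hAF h'
    have : k = k' := by omega
    rwa [this]
  · have h' : ρ ∈ HH γ d A 0 := h
    have := HH_card_mem hAF h'
    have : k = 0 := by omega
    rwa [this]

lemma pow_anti {γ : ℝ} (hγ : 0 < γ) (hγ1 : γ ≤ 1) {a b : ℕ} (h : a ≤ b) :
    γ ^ (2 ^ b) ≤ γ ^ (2 ^ a) :=
  pow_le_pow_of_le_one hγ.le hγ1 (Nat.pow_le_pow_right (by norm_num) h)

lemma light_bound {γ : ℝ} (hγ : 0 < γ) (hγ1 : γ ≤ 1) {d : ℕ} (hd : 2 ≤ d) (hn : 0 < n)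
    {A : Finset (Finset (Fin n))}
    (hAF : A ⊆ allFaces n d) (hs : (d : ℝ) ^ d * A.shadow.card ≤ γ ^ (2 ^ d) * n ^ d)
    {ρ : Finset (Fin n)} (hρ : ρ ∉ HHu γ d A) {k : ℕ} (hk : ρ.card + k + 1 = d) :
    (ecH γ d A k ρ : ℝ) ≤ γ ^ (2 ^ k) * n := by
  by_cases hk1 : k + 1 ≤ d - 1
  · by_contra hcon
    push Not at hcon
    exact hρ (mem_HHu.2 ⟨k + 1, ⟨by omega, hk1⟩, mem_HH_succ.2 ⟨hk, hcon.le⟩⟩)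
  · have hρ0 : ρ = ∅ := Finset.card_eq_zero.1 (by omega)
    have hkd : d = k + 1 := by omega
    have h1 : ecH γ d A k ρ ≤ (HH γ d A k).card := by
      refine Finset.card_le_card_of_injOn (fun v => insert v ρ) ?_ ?_
      · intro v hv; exact Finset.mem_coe.2 (Finset.mem_filter.1 (Finset.mem_coe.1 hv)).2.2
      · intro a _ b _ h
        rw [hρ0] at h
        simpa using h
    refine le_trans (Nat.cast_le.2 h1) ?_
    have h2 := HH_bound hγ hAF k
    have hnR : (0:ℝ) < n := by exact_mod_cast hn
    have hpos : (0:ℝ) < γ ^ (2 ^ k) * n ^ k := by positivity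
    refine le_of_mul_le_mul_right (h2.trans ?_) hpos
    have hdd : (1:ℝ) ≤ d := by exact_mod_cast (by omega : 1 ≤ d)
    calc γ * d ^ k * A.shadow.card ≤ 1 * d ^ d * A.shadow.card := by
          have : (d:ℝ) ^ k ≤ d ^ d := pow_le_pow_right₀ hdd (by omega)
          gcongr
      _ ≤ γ ^ (2 ^ d) * n ^ d := by rw [one_mul]; exact hs
      _ = _ := by rw [hkd, pow_succ 2 k, pow_mul]; ring

lemma light_bound' {γ : ℝ} (hγ : 0 < γ) (hγ1 : γ ≤ 1) {d : ℕ} (hd : 2 ≤ d) (hn : 0 < n)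
    {A : Finset (Finset (Fin n))}
    (hAF : A ⊆ allFaces n d) (hs : (d : ℝ) ^ d * A.shadow.card ≤ γ ^ (2 ^ d) * n ^ d)
    {ρ : Finset (Fin n)} (hρ : ρ ∉ HHu γ d A) {k : ℕ} (hk : ρ.card + k < d) :
    (Finset.univ.filter (fun v => v ∉ ρ ∧ insert v ρ ∈ HHu γ d A ∪ A.shadow)).card
      ≤ ⌊γ ^ (2 ^ k) * n⌋₊ := by
  apply Nat.le_floor
  obtain ⟨k', hk', hkk⟩ : ∃ k', ρ.card + k' + 1 = d ∧ k ≤ k' := ⟨d - 1 - ρ.card, by omega, by omega⟩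
  have h1 := light_bound hγ hγ1 hd hn hAF hs hρ hk'
  refine le_trans (le_trans (Nat.cast_le.2 (Finset.card_le_card ?_)) h1)
    (mul_le_mul_of_nonneg_right (pow_anti hγ hγ1 hkk) (by positivity))
  intro v hv
  obtain ⟨-, h2, h3⟩ := Finset.mem_filter.1 hv
  refine Finset.mem_filter.2 ⟨Finset.mem_univ _, h2, HHu_mem_HH hAF ?_ h3⟩
  rw [Finset.card_insert_of_notMem h2]; omega

/-- an inclusion minimal element of `H` inside a given element of `H`. -/
lemma exists_min_heavy {H : Finset (Finset (Fin n))} {ρ : Finset (Fin n)} (h : ρ ∈ H) :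
    ∃ η ∈ H, η ⊆ ρ ∧ ∀ ζ ∈ H, ζ ⊆ η → ζ = η := by
  have hne : (H.filter (fun η => η ⊆ ρ)).Nonempty := ⟨ρ, Finset.mem_filter.2 ⟨h, Finset.Subset.refl _⟩⟩
  obtain ⟨η, hη, hmin⟩ := Finset.exists_min_image _ (fun η => η.card) hne
  obtain ⟨h1, h2⟩ := Finset.mem_filter.1 hη
  refine ⟨η, h1, h2, fun ζ hζ hsub => ?_⟩
  exact Finset.eq_of_subset_of_card_le hsub (hmin ζ (Finset.mem_filter.2 ⟨hζ, hsub.trans h2⟩))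

lemma veryBad_struct {H : Finset (Finset (Fin n))} (hH : ∀ ρ ∈ H, 1 ≤ ρ.card) {τ : Finset (Fin n)}
    (hτ : τ.Nonempty) (hvb : veryBad H τ) :
    ∃ ρ ∈ H, ρ ⊆ τ ∧ ∃ η ∈ H, η ⊆ τ ∧ η.card ≤ ρ.card ∧ ∃ w ∈ η, w ∉ ρ ∧ η.erase w ∉ H := by
  obtain ⟨u0, hu0⟩ := hτ
  obtain ⟨ρ0, hρ0, hs0⟩ := hvb u0 hu0
  obtain ⟨η, hη, hηs, hηm⟩ := exists_min_heavy hρ0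
  have hητ : η ⊆ τ := hηs.trans (hs0.trans (Finset.erase_subset _ _))
  obtain ⟨u, hu⟩ := Finset.card_pos.1 (hH η hη)
  obtain ⟨ρ1, hρ1, hs1⟩ := hvb u (hητ hu)
  obtain ⟨ρ, hρ, hρs, hρm⟩ := exists_min_heavy hρ1
  have hρτ : ρ ⊆ τ := hρs.trans (hs1.trans (Finset.erase_subset _ _))
  have huρ : u ∉ ρ := fun h => Finset.notMem_erase u τ (hs1 (hρs h))
  have hne : ρ ≠ η := by rintro rfl; exact huρ hu
  have herase : ∀ η ∈ H, (∀ ζ ∈ H, ζ ⊆ η → ζ = η) → ∀ w ∈ η, η.erase w ∉ H := by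
    intro η _ hm w hw hh
    have := hm _ hh (Finset.erase_subset _ _)
    have h2 := Finset.notMem_erase w η
    rw [this] at h2
    exact h2 hw
  rcases le_total η.card ρ.card with h | h
  · exact ⟨ρ, hρ, hρτ, η, hη, hητ, h, u, hu, huρ, herase η hη hηm u hu⟩
  · have : ¬ ρ ⊆ η := fun hh => hne (hηm ρ hρ hh)
    obtain ⟨w, hw, hwη⟩ := Finset.not_subset.1 this
    exact ⟨η, hη, hητ, ρ, hρ, hρτ, h, w, hw, hwη, herase ρ hρ hρm w hw⟩

lemma veryBad_count {γ : ℝ} (hγ : 0 < γ) (hγ1 : γ ≤ 1) {d : ℕ} (hd : 2 ≤ d) (hn : 0 < n)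
    {A : Finset (Finset (Fin n))}
    (hAF : A ⊆ allFaces n d) (hs : (d : ℝ) ^ d * A.shadow.card ≤ γ ^ (2 ^ d) * n ^ d) :
    ((A.shadow.filter (veryBad (HHu γ d A))).card : ℝ) ≤ d * (2 ^ d * (d ^ d * (γ * A.shadow.card))) := by
  set H := HHu γ d A with hH
  set W : ℕ → ℕ := fun k => ⌊γ ^ (2 ^ k) * n⌋₊ with hW
  let cand : ℕ → Finset (Finset (Fin n)) := fun k =>
    (HH γ d A k).biUnion fun ρ => (Finset.powersetCard (k - 1) Finset.univ).biUnion fun X =>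
      ((ρ ∪ X).powerset.filter (fun ζ => (ρ ∪ X).card ≤ d ∧ ζ ∉ H ∧ ζ.card + k < d)).biUnion fun ζ =>
        (Finset.univ.filter (fun v => v ∉ ζ ∧ insert v ζ ∈ H ∪ A.shadow)).image
          (fun v => insert v (ρ ∪ X))
  have hsub : A.shadow.filter (veryBad H) ⊆ (Finset.Icc 1 (d - 1)).biUnion cand := by
    intro τ hτ
    obtain ⟨hτs, hvb⟩ := Finset.mem_filter.1 hτ
    have hτc : τ.card = d := HH_card_mem (γ := γ) hAF (k := 0) hτs
    obtain ⟨ρ, hρ, hρτ, η, hη, hητ, hle, w, hw, hwρ, hlight⟩ := veryBad_struct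
      (fun ρ h => (HHu_sizes hd hAF ρ h).1) (Finset.card_pos.1 (by omega)) hvb
    obtain ⟨k, hk, hρk⟩ := mem_HHu.1 hρ
    have hρc := HH_card_mem hAF hρk
    have hwτ := hητ hw
    have hρe : ρ ⊆ τ.erase w := fun x hx => Finset.mem_erase.2 ⟨fun h => hwρ (h ▸ hx), hρτ hx⟩
    have hunion : ρ ∪ (τ.erase w \ ρ) = τ.erase w := Finset.union_sdiff_of_subset hρe
    have hec : (τ.erase w).card = d - 1 := by rw [Finset.card_erase_of_mem hwτ, hτc]
    refine Finset.mem_biUnion.2 ⟨k, Finset.mem_Icc.2 hk, Finset.mem_biUnion.2 ⟨ρ, hρk, ?_⟩⟩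
    refine Finset.mem_biUnion.2 ⟨τ.erase w \ ρ, Finset.mem_powersetCard.2 ⟨Finset.subset_univ _, ?_⟩, ?_⟩
    · rw [Finset.card_sdiff_of_subset hρe, hec]; omega
    rw [hunion]
    refine Finset.mem_biUnion.2 ⟨η.erase w, Finset.mem_filter.2 ⟨?_, ?_, hlight, ?_⟩, ?_⟩
    · exact Finset.mem_powerset.2 (Finset.erase_subset_erase _ hητ)
    · omega
    · have := Finset.card_erase_add_one hw; omega
    · refine Finset.mem_image.2 ⟨w, Finset.mem_filter.2 ⟨Finset.mem_univ _, Finset.notMem_erase _ _, ?_⟩, ?_⟩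
      · rw [Finset.insert_erase hw]; exact Finset.mem_union_left _ hη
      · exact Finset.insert_erase hwτ
  have hcand : ∀ k ∈ Finset.Icc 1 (d - 1), ((cand k).card : ℝ) ≤ 2 ^ d * (d ^ d * (γ * A.shadow.card)) := by
    intro k hk
    obtain ⟨hk1, hk2⟩ := Finset.mem_Icc.1 hk
    have h1 : (cand k).card ≤ (HH γ d A k).card * (n ^ (k - 1) * (2 ^ d * W k)) := by
      refine Finset.card_biUnion_le_card_mul _ _ _ fun ρ hρ => ?_
      refine (Finset.card_biUnion_le_card_mul _ _ (2 ^ d * W k) fun X hX => ?_).trans ?_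
      · by_cases hc : (ρ ∪ X).card ≤ d
        · refine (Finset.card_biUnion_le_card_mul _ _ (W k) fun ζ hζ => ?_).trans ?_
          · obtain ⟨-, -, h3, h4⟩ := Finset.mem_filter.1 hζ
            exact Finset.card_image_le.trans (light_bound' hγ hγ1 hd hn hAF hs h3 h4)
          · refine Nat.mul_le_mul_right _ ((Finset.card_filter_le _ _).trans ?_)
            rw [Finset.card_powerset]
            exact Nat.pow_le_pow_right (by norm_num) hc
        · rw [Finset.filter_false_of_mem (fun ζ _ h => hc h.1)]; simp
      · refine Nat.mul_le_mul_right _ ?_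
        rw [Finset.card_powersetCard]
        simpa using Nat.choose_le_pow n (k - 1)
    have h2 : ((cand k).card : ℝ) ≤ (HH γ d A k).card * (n ^ (k - 1) * (2 ^ d * (γ ^ (2 ^ k) * n))) := by
      refine (Nat.cast_le.2 h1).trans ?_
      push_cast
      have : (W k : ℝ) ≤ γ ^ (2 ^ k) * n := Nat.floor_le (by positivity)
      gcongr
    have h3 := HH_bound hγ hAF k
    have hdd : (1:ℝ) ≤ d := by exact_mod_cast (by omega : 1 ≤ d)
    calc ((cand k).card : ℝ) ≤ (HH γ d A k).card * (n ^ (k - 1) * (2 ^ d * (γ ^ (2 ^ k) * n))) := h2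
      _ = 2 ^ d * ((HH γ d A k).card * (γ ^ (2 ^ k) * n ^ k)) := by
          obtain ⟨j, rfl⟩ : ∃ j, k = j + 1 := ⟨k - 1, by omega⟩
          simp only [Nat.add_sub_cancel]; ring
      _ ≤ 2 ^ d * (γ * d ^ k * A.shadow.card) := by gcongr
      _ ≤ 2 ^ d * (γ * d ^ d * A.shadow.card) := by
          have : (d:ℝ) ^ k ≤ d ^ d := pow_le_pow_right₀ hdd (by omega)
          gcongr
      _ = _ := by ring
  calc ((A.shadow.filter (veryBad H)).card : ℝ) ≤ ((∑ k ∈ Finset.Icc 1 (d - 1), (cand k).card : ℕ) : ℝ) :=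
        Nat.cast_le.2 ((Finset.card_le_card hsub).trans Finset.card_biUnion_le)
    _ = ∑ k ∈ Finset.Icc 1 (d - 1), ((cand k).card : ℝ) := by push_cast; rfl
    _ ≤ ∑ k ∈ Finset.Icc 1 (d - 1), (2 ^ d * (d ^ d * (γ * A.shadow.card)) : ℝ) := Finset.sum_le_sum hcand
    _ ≤ _ := by
      rw [Finset.sum_const, nsmul_eq_mul, Nat.card_Icc]
      have : ((d - 1 + 1 - 1 : ℕ) : ℝ) ≤ d := by exact_mod_cast (by omega)
      gcongr

lemma HHu_card {γ : ℝ} (hγ : 0 < γ) (hγ1 : γ ≤ 1) {d : ℕ} (hd : 2 ≤ d) (hn : 0 < n)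
    {A : Finset (Finset (Fin n))} (hAF : A ⊆ allFaces n d) :
    ((HHu γ d A).card : ℝ) * (γ ^ (2 ^ d) * n) ≤ d * (d ^ d * A.shadow.card) := by
  have hnR : (1:ℝ) ≤ n := by exact_mod_cast hn
  have hdd : (1:ℝ) ≤ d := by exact_mod_cast (by omega : 1 ≤ d)
  have h1 : ∀ k ∈ Finset.Icc 1 (d - 1), ((HH γ d A k).card : ℝ) * (γ ^ (2 ^ d) * n) ≤ d ^ d * A.shadow.card := by
    intro k hk
    obtain ⟨hk1, hk2⟩ := Finset.mem_Icc.1 hk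
    have h3 := HH_bound hγ hAF k
    calc ((HH γ d A k).card : ℝ) * (γ ^ (2 ^ d) * n) ≤ (HH γ d A k).card * (γ ^ (2 ^ k) * n ^ k) := by
          have a1 := pow_anti hγ hγ1 (show k ≤ d by omega)
          have a2 : (n:ℝ) ≤ n ^ k := le_self_pow₀ hnR (by omega)
          gcongr
      _ ≤ γ * d ^ k * A.shadow.card := h3
      _ ≤ 1 * d ^ d * A.shadow.card := by
          have : (d:ℝ) ^ k ≤ d ^ d := pow_le_pow_right₀ hdd (by omega)
          gcongr
      _ = _ := by ring
  have h2 : ((HHu γ d A).card : ℝ) ≤ ∑ k ∈ Finset.Icc 1 (d - 1), ((HH γ d A k).card : ℝ) := by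
    have := Finset.card_biUnion_le (s := Finset.Icc 1 (d-1)) (t := HH γ d A)
    unfold HHu
    exact_mod_cast this
  calc ((HHu γ d A).card : ℝ) * (γ ^ (2 ^ d) * n)
      ≤ (∑ k ∈ Finset.Icc 1 (d - 1), ((HH γ d A k).card : ℝ)) * (γ ^ (2 ^ d) * n) :=
        mul_le_mul_of_nonneg_right h2 (by positivity)
    _ = ∑ k ∈ Finset.Icc 1 (d - 1), ((HH γ d A k).card : ℝ) * (γ ^ (2 ^ d) * n) := Finset.sum_mul _ _ _
    _ ≤ ∑ k ∈ Finset.Icc 1 (d - 1), (d ^ d * A.shadow.card : ℝ) := Finset.sum_le_sum h1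
    _ ≤ _ := by
      rw [Finset.sum_const, nsmul_eq_mul, Nat.card_Icc]
      have : ((d - 1 + 1 - 1 : ℕ) : ℝ) ≤ d := by exact_mod_cast (by omega)
      gcongr

lemma shadow_card_le {d : ℕ} {A : Finset (Finset (Fin n))} (hAF : A ⊆ allFaces n d) :
    A.shadow.card ≤ (d + 1) * A.card := by
  rw [mul_comm]
  unfold Finset.shadow
  rw [Finset.sup_eq_biUnion]
  refine Finset.card_biUnion_le_card_mul _ _ _ fun σ hσ => le_trans Finset.card_image_le ?_
  have : σ.card = d + 1 := by simpa [allFaces] using hAF hσ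
  omega

end

section

variable {n : ℕ}

lemma count_sets {α : Type*} [DecidableEq α] (U : Finset α) (h : ℕ) :
    (U.powerset.filter (fun s => s.card ≤ h)).card ≤ (U.card + 1) ^ h := by
  let V : Finset (Option α) := Finset.insertNone U
  have hV : V.card = U.card + 1 := Finset.card_insertNone U
  have h1 : (Fintype.piFinset (fun _ : Fin h => V)).card = (U.card + 1) ^ h := by
    rw [Fintype.card_piFinset_const, hV]
  rw [← h1]
  refine Finset.card_le_card_of_surjOn
    (fun f => U.filter (fun a => ∃ i, f i = some a)) ?_
  intro s hs
  obtain ⟨hsU, hsh⟩ := Finset.mem_filter.1 (Finset.mem_coe.1 hs)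
  rw [Finset.mem_powerset] at hsU
  let e := s.equivFin
  refine ⟨fun i => if hi : i.1 < s.card then some (e.symm ⟨i.1, hi⟩).1 else none, ?_, ?_⟩
  · simp only [Finset.mem_coe, Fintype.mem_piFinset]
    intro i
    by_cases hi : i.1 < s.card
    · simp only [hi, dif_pos, V, Finset.some_mem_insertNone]
      exact hsU (e.symm ⟨i.1, hi⟩).2
    · simp [hi, V]
  · ext a
    simp only [Finset.mem_filter]
    constructor
    · rintro ⟨_, i, hi⟩
      by_cases h' : i.1 < s.card
      · simp only [h', dif_pos, Option.some.injEq] at hi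
        rw [← hi]; exact (e.symm ⟨i.1, h'⟩).2
      · simp [h'] at hi
    · intro ha
      refine ⟨hsU ha, ⟨(e ⟨a, ha⟩).1, lt_of_lt_of_le (e ⟨a, ha⟩).2 hsh⟩, ?_⟩
      simp

def cores (n d m : ℕ) : Finset (Finset (Finset (Fin n))) :=
  (allFaces n d).powerset.filter (fun A => isMinCore A ∧ noSimplex d A ∧ A.card = m)

lemma mem_cores {d m : ℕ} {A : Finset (Finset (Fin n))} :
    A ∈ cores n d m ↔ A ⊆ allFaces n d ∧ isMinCore A ∧ noSimplex d A ∧ A.card = m := by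
  simp [cores]

lemma exists_minCore {A : Finset (Finset (Fin n))} (hne : A.Nonempty) (hA : isCore A) :
    ∃ K ⊆ A, isMinCore K := by
  induction A using Finset.strongInduction with
  | H A ih =>
    by_cases h : ∀ K ⊂ A, K.Nonempty → ¬ isCore K
    · exact ⟨A, subset_rfl, hne, hA, h⟩
    · push Not at h
      obtain ⟨K, hK, hKn, hKc⟩ := h
      obtain ⟨K', h1, h2⟩ := ih K hK hKn hKc
      exact ⟨K', h1.trans hK.1, h2⟩

lemma cores_small {d m : ℕ} (hd : 2 ≤ d) :
    (cores n d m).card ≤ (n + 1) ^ (m - 1) * 2 ^ 2 ^ (m - 1) := by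
  have hsub : cores n d m ⊆ ((Finset.univ : Finset (Fin n)).powerset.filter
      (fun s => s.card ≤ m - 1)).biUnion (fun W => W.powerset.powerset) := by
    intro A hA
    obtain ⟨h1, h2, h3, h4⟩ := mem_cores.1 hA
    have := core_vertices hd h1 h2.2.1 h2.1 h3
    refine Finset.mem_biUnion.2 ⟨A.biUnion id, ?_, ?_⟩
    · simp only [Finset.mem_filter, Finset.mem_powerset, Finset.subset_univ, true_and]
      omega
    · rw [Finset.mem_powerset]
      intro σ hσ
      rw [Finset.mem_powerset]
      intro v hv
      exact Finset.mem_biUnion.2 ⟨σ, hσ, hv⟩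
  refine (Finset.card_le_card hsub).trans ?_
  refine (Finset.card_biUnion_le_card_mul _ _ (2 ^ 2 ^ (m - 1)) ?_).trans ?_
  · intro W hW
    rw [Finset.card_powerset, Finset.card_powerset]
    gcongr
    · norm_num
    · norm_num
    · exact (Finset.mem_filter.1 hW).2
  · have := count_sets (Finset.univ : Finset (Fin n)) (m - 1)
    simp only [Finset.card_univ, Fintype.card_fin] at this
    gcongr
    

lemma cores_medium {d m q0 : ℕ} (hd : 2 ≤ d) (hn : 0 < n) (hm : 1 ≤ m)
    (hBn : 2 ^ d * ((d + 1) * m) ≤ n) (hq0 : ∀ q, m ≤ (d + 2) * q + 1 → q0 ≤ q) :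
    (cores n d m).card * n ^ q0 ≤ m * (n ^ d * 2 ^ m * n ^ m * (2 ^ d * ((d + 1) * m)) ^ q0) := by
  refine count_cores (b := 0) (H := ∅) hd (by simp) ?_ ?_ ?_ hn hBn (by simpa using hq0) hm
  · intro A hA
    obtain ⟨h1, h2, h3, h4⟩ := mem_cores.1 hA
    exact ⟨h2, h1, h4⟩
  · intro A hA ρ _ hρ
    obtain ⟨h1, h2, h3, h4⟩ := mem_cores.1 hA
    rw [← h4]
    refine le_trans ?_ (shadow_card_le h1)
    refine Finset.card_le_card_of_injOn (fun v => insert v ρ) ?_ ?_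
    · intro v hv
      simpa using (Finset.mem_filter.1 hv).2.2
    · intro v hv w hw h
      have hv' := (Finset.mem_filter.1 hv).2.1
      have hw' := (Finset.mem_filter.1 hw).2.1
      have : v ∈ insert w ρ := by
        have : v ∈ insert v ρ := Finset.mem_insert_self _ _
        simp only at h
        rwa [h] at this
      rcases Finset.mem_insert.1 this with h | h
      · exact h
      · exact absurd h hv'
  · intro A hA
    obtain ⟨h1, h2, h3, h4⟩ := mem_cores.1 hA
    rw [Nat.le_zero, Finset.card_eq_zero, Finset.filter_eq_empty_iff]
    intro τ hτ hvb
    have hc : τ.card = d := by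
      have h5 : (A : Set (Finset (Fin n))).Sized (d + 1) := by
        intro σ hσ
        simpa [allFaces] using h1 hσ
      simpa using h5.shadow hτ
    obtain ⟨u, hu⟩ : τ.Nonempty := Finset.card_pos.1 (by omega)
    obtain ⟨ρ, hρ, _⟩ := hvb u hu
    simp at hρ

lemma cores_large {d m q0 b h : ℕ} {γ : ℝ} (hγ : 0 < γ) (hγ1 : γ ≤ 1) (hd : 2 ≤ d) (hn : 0 < n) (hm : 1 ≤ m)
    (hγd : 2 ^ d * γ ≤ 1)
    (hs : (d : ℝ) ^ d * ((d + 1) * m) ≤ γ ^ (2 ^ d) * n ^ d)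
    (hb : (d : ℝ) * (2 ^ d * (d ^ d * (γ * ((d + 1) * m)))) < b + 1)
    (hh : (d : ℝ) * (d ^ d * ((d + 1) * m)) < (h + 1) * (γ ^ (2 ^ d) * n))
    (hq0 : ∀ q, m ≤ (d + 2) * q + b + 1 → q0 ≤ q) :
    (cores n d m).card * n ^ q0 ≤
      (n + 2) ^ (d * h) * (m * (n ^ d * 2 ^ m * n ^ m * (2 ^ d * ⌊γ * n⌋₊) ^ q0)) := by
  set U : Finset (Finset (Fin n)) := Finset.univ.powerset.filter (fun ρ => ρ.card ≤ d) with hU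
  have hUc : U.card ≤ (n + 1) ^ d := by
    have := count_sets (Finset.univ : Finset (Fin n)) d
    rwa [Finset.card_univ, Fintype.card_fin] at this
  have hsh : ∀ A ∈ cores n d m, (A.shadow.card : ℝ) ≤ (d + 1) * m := by
    intro A hA
    obtain ⟨h1, h2, h3, h4⟩ := mem_cores.1 hA
    rw [← h4]
    exact_mod_cast shadow_card_le h1
  have hmap : ∀ A ∈ cores n d m, HHu γ d A ∈ U.powerset.filter (fun s => s.card ≤ h) := by
    intro A hA
    obtain ⟨h1, h2, h3, h4⟩ := mem_cores.1 hA
    rw [Finset.mem_filter, Finset.mem_powerset]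
    constructor
    · intro ρ hρ
      have := HHu_sizes hd h1 ρ hρ
      simp only [hU, Finset.mem_filter, Finset.mem_powerset, Finset.subset_univ, true_and]
      omega
    · have h5 := HHu_card hγ hγ1 hd hn h1
      have h6 : ((HHu γ d A).card : ℝ) * (γ ^ (2 ^ d) * n) < (h + 1) * (γ ^ (2 ^ d) * n) := by
        refine lt_of_le_of_lt (h5.trans ?_) hh
        have := hsh A hA
        gcongr
      have h7 : (0:ℝ) < γ ^ (2 ^ d) * n := by positivity
      have h8 := lt_of_mul_lt_mul_right h6 h7.le
      have : (HHu γ d A).card < h + 1 := by exact_mod_cast h8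
      omega
  have hfib : ∀ H ∈ U.powerset.filter (fun s => s.card ≤ h),
      ((cores n d m).filter (fun A => HHu γ d A = H)).card * n ^ q0 ≤
        m * (n ^ d * 2 ^ m * n ^ m * (2 ^ d * ⌊γ * n⌋₊) ^ q0) := by
    intro H hH
    rcases Finset.eq_empty_or_nonempty ((cores n d m).filter (fun A => HHu γ d A = H)) with he | ⟨A0, hA0⟩
    · rw [he]; simp
    obtain ⟨hA0, hA0H⟩ := Finset.mem_filter.1 hA0
    refine count_cores (b := b) (H := H) hd ?_ ?_ ?_ ?_ hn ?_ hq0 hm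
    · rw [← hA0H]
      exact HHu_sizes hd (mem_cores.1 hA0).1
    · intro A hA
      obtain ⟨h1, h2, h3, h4⟩ := mem_cores.1 (Finset.mem_filter.1 hA).1
      exact ⟨h2, h1, h4⟩
    · intro A hA0' ρ hρ hρd
      obtain ⟨hA, hAH⟩ := Finset.mem_filter.1 hA0'
      subst hAH
      obtain ⟨h1, h2, h3, h4⟩ := mem_cores.1 hA
      have hs' : (d : ℝ) ^ d * A.shadow.card ≤ γ ^ (2 ^ d) * n ^ d := by
        refine le_trans ?_ hs
        have := hsh A hA
        gcongr
      have := light_bound' hγ hγ1 hd hn h1 hs' hρ (k := 0) (by omega)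
      simpa using this
    · intro A hA0'
      obtain ⟨hA, hAH⟩ := Finset.mem_filter.1 hA0'
      subst hAH
      obtain ⟨h1, h2, h3, h4⟩ := mem_cores.1 hA
      have hs' : (d : ℝ) ^ d * A.shadow.card ≤ γ ^ (2 ^ d) * n ^ d := by
        refine le_trans ?_ hs
        have := hsh A hA
        gcongr
      have h5 := veryBad_count hγ hγ1 hd hn h1 hs'
      have h6 : ((A.shadow.filter (veryBad (HHu γ d A))).card : ℝ) < b + 1 := by
        refine lt_of_le_of_lt (h5.trans ?_) hb
        have := hsh A hA
        gcongr
      have : (A.shadow.filter (veryBad (HHu γ d A))).card < b + 1 := by exact_mod_cast h6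
      omega
    · have h1 : ((⌊γ * n⌋₊ : ℕ) : ℝ) ≤ γ * n := Nat.floor_le (by positivity)
      have : ((2 ^ d * ⌊γ * n⌋₊ : ℕ) : ℝ) ≤ n := by
        push_cast
        calc (2:ℝ) ^ d * ⌊γ * n⌋₊ ≤ 2 ^ d * (γ * n) := by gcongr
          _ = (2 ^ d * γ) * n := by ring
          _ ≤ 1 * n := by gcongr
          _ = n := one_mul _
      exact_mod_cast this
  have hnum : (U.powerset.filter (fun s => s.card ≤ h)).card ≤ (n + 2) ^ (d * h) := by
    refine (count_sets U h).trans ?_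
    rw [pow_mul]
    refine Nat.pow_le_pow_left ?_ h
    have : (n + 1) ^ d < (n + 2) ^ d := Nat.pow_lt_pow_left (by omega) (by omega)
    omega
  rw [Finset.card_eq_sum_card_fiberwise hmap, Finset.sum_mul]
  refine (Finset.sum_le_sum hfib).trans ?_
  rw [Finset.sum_const, smul_eq_mul]
  exact Nat.mul_le_mul_right _ hnum

end

section

lemma small_term {d : ℕ} (hd : 2 ≤ d) {c : ℝ} (hc : 0 < c) (M0 : ℕ) : ∃ C : ℝ, 0 ≤ C ∧ ∀ n : ℕ, 1 ≤ n →
    ∀ m : ℕ, 1 ≤ m → m < M0 → ((cores n d m).card : ℝ) * (c / n) ^ m ≤ C / (n * (m + 1) ^ 2) := by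
  let g : ℕ → ℝ := fun m => (2 ^ (m - 1) * 2 ^ 2 ^ (m - 1) * c ^ m) * (m + 1) ^ 2
  have hg : ∀ m, 0 ≤ g m := fun m => by positivity
  refine ⟨∑ m ∈ range M0, g m, Finset.sum_nonneg fun m _ => hg m, fun n hn m hm hmM => ?_⟩
  have h1 : g m ≤ ∑ m ∈ range M0, g m := Finset.single_le_sum (fun m _ => hg m) (Finset.mem_range.2 hmM)
  have hnR : (1:ℝ) ≤ n := by exact_mod_cast hn
  have h2 : ((cores n d m).card : ℝ) ≤ ((2 * n : ℝ)) ^ (m - 1) * 2 ^ 2 ^ (m - 1) := by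
    have := cores_small (n := n) (m := m) hd
    have h3 : ((cores n d m).card : ℝ) ≤ ((n:ℝ) + 1) ^ (m - 1) * 2 ^ 2 ^ (m - 1) := by exact_mod_cast this
    refine h3.trans ?_
    gcongr
    linarith
  rw [le_div_iff₀ (by positivity)]
  refine le_trans ?_ h1
  obtain ⟨k, rfl⟩ : ∃ k, m = k + 1 := ⟨m - 1, by omega⟩
  have e : g (k+1) = ((2 * n : ℝ)) ^ (k + 1 - 1) * 2 ^ 2 ^ (k + 1 - 1) * (c / n) ^ (k + 1) * (n * ((k + 1 : ℕ) + 1) ^ 2) := by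
    simp only [g, Nat.add_sub_cancel]
    rw [mul_pow, div_pow]
    field_simp
    ring
  rw [e]
  gcongr

lemma medium_term {d : ℕ} (hd : 2 ≤ d) {c : ℝ} (hc : 0 < c) : ∃ M0 : ℕ, ∃ C : ℝ, 0 ≤ C ∧ ∃ N : ℕ, ∀ n : ℕ, N ≤ n →
    ∀ m : ℕ, M0 ≤ m → 1 ≤ m → m ^ 2 ≤ n → ((cores n d m).card : ℝ) * (c / n) ^ m ≤ C / (n * (m + 1) ^ 2) := by
  set c' : ℝ := max (2 * c) 1 with hc'
  have hc'1 : 1 ≤ c' := le_max_right _ _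
  have hc'c : 2 * c ≤ c' := le_max_left _ _
  set K1 : ℕ := 2 ^ d * (d + 1) with hK1
  set K2 : ℝ := c' ^ (d + 2) * K1 with hK2
  have hK2p : 0 ≤ K2 := by positivity
  refine ⟨(d + 2) * (4 * (d + 4)) + 2, 4 * c', by positivity, ⌈K2 ^ 4⌉₊ + K1 ^ 2 + 1, fun n hn m hm0 hm hmn => ?_⟩
  have hn1 : 0 < n := by omega
  have hnR : (0:ℝ) < n := by exact_mod_cast hn1
  have hn1R : (1:ℝ) ≤ n := by exact_mod_cast hn1
  have hnK : K2 ^ 4 ≤ n := by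
    have : ((⌈K2 ^ 4⌉₊ : ℕ) : ℝ) ≤ n := by exact_mod_cast (by omega)
    exact (Nat.le_ceil _).trans this
  have hK1m : K1 * m ≤ n := by
    have h1 : K1 ^ 2 ≤ n := by omega
    rcases le_total K1 m with h | h
    · exact le_trans (Nat.mul_le_mul_right m h) (by rw [← sq]; exact hmn)
    · exact le_trans (Nat.mul_le_mul_left K1 h) (by rw [← sq]; exact h1)
  set q0 := (m - 1 + (d + 1)) / (d + 2) with hq0
  have hq0a : m ≤ (d + 2) * q0 + 1 := by
    have := Nat.div_add_mod (m - 1 + (d + 1)) (d + 2)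
    have h2 := Nat.mod_lt (m - 1 + (d + 1)) (show 0 < d + 2 by omega)
    rw [← hq0] at this
    omega
  have hq0b : ∀ q, m ≤ (d + 2) * q + 1 → q0 ≤ q := by
    intro q hq
    rw [hq0]
    refine Nat.lt_succ_iff.1 ((Nat.div_lt_iff_lt_mul (by omega)).2 ?_)
    have : (q + 1) * (d + 2) = (d + 2) * q + (d + 2) := by ring
    rw [Nat.succ_eq_add_one, this]
    omega
  have hq0c : 4 * (d + 4) ≤ q0 := by
    rw [hq0, Nat.le_div_iff_mul_le (by omega)]
    have : 4 * (d + 4) * (d + 2) = (d + 2) * (4 * (d + 4)) := by ring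
    omega
  have hmain := cores_medium (n := n) (m := m) (q0 := q0) hd hn1 hm
    (by rw [← mul_assoc]; exact hK1m) hq0b
  have hmainR : ((cores n d m).card : ℝ) * (n:ℝ) ^ q0 ≤
      m * ((n:ℝ) ^ d * 2 ^ m * n ^ m * (K1 * m) ^ q0) := by
    have e : 2 ^ d * ((d + 1) * m) = K1 * m := by rw [hK1]; ring
    rw [e] at hmain
    exact_mod_cast hmain
  -- fourth root
  set r : ℝ := Real.sqrt (Real.sqrt n) with hr
  have hr2 : r ^ 2 = Real.sqrt n := Real.sq_sqrt (Real.sqrt_nonneg _)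
  have hr4 : r ^ 4 = n := by
    have : r ^ 4 = (r ^ 2) ^ 2 := by ring
    rw [this, hr2, Real.sq_sqrt hnR.le]
  have hr0 : 0 < r := Real.sqrt_pos.2 (Real.sqrt_pos.2 hnR)
  have hr1 : 1 ≤ r := by
    by_contra h
    push Not at h
    have : r ^ 4 < 1 := pow_lt_one₀ hr0.le h (by norm_num)
    linarith
  have hmr : (m : ℝ) ≤ r ^ 2 := by
    rw [hr2]
    apply Real.le_sqrt_of_sq_le
    exact_mod_cast hmn
  have hKr : K2 ≤ r := by
    rw [← hr4] at hnK
    exact le_of_pow_le_pow_left₀ (by norm_num) hr0.le hnK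
  have hmn' : (m:ℝ) ≤ n := by
    have : m ≤ n := le_trans (Nat.le_self_pow (by norm_num) m) hmn
    exact_mod_cast this
  have h1 : ((cores n d m).card : ℝ) * (c / n) ^ m ≤ m * (n:ℝ) ^ d * (2 * c) ^ m * (K1 * m / n) ^ q0 := by
    rw [div_pow, div_pow, mul_div_assoc', mul_div_assoc', div_le_div_iff₀ (by positivity) (by positivity)]
    calc ((cores n d m).card : ℝ) * c ^ m * (n:ℝ) ^ q0 = (((cores n d m).card : ℝ) * (n:ℝ) ^ q0) * c ^ m := by ring
      _ ≤ (m * ((n:ℝ) ^ d * 2 ^ m * n ^ m * (K1 * m) ^ q0)) * c ^ m := by gcongr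
      _ = _ := by rw [mul_pow 2 c m]; ring
  have h2 : (2 * c) ^ m ≤ c' * (c' ^ (d + 2)) ^ q0 := by
    calc (2 * c) ^ m ≤ c' ^ m := by gcongr
      _ ≤ c' ^ ((d + 2) * q0 + 1) := pow_le_pow_right₀ hc'1 hq0a
      _ = _ := by rw [pow_succ, pow_mul]; ring
  have h3 : c' ^ (d + 2) * (K1 * m / n) ≤ 1 / r := by
    rw [mul_div_assoc', div_le_div_iff₀ hnR hr0]
    calc c' ^ (d + 2) * (K1 * m) * r = K2 * m * r := by rw [hK2]; ring
      _ ≤ r * r ^ 2 * r := by gcongr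
      _ = 1 * n := by rw [← hr4]; ring
  calc ((cores n d m).card : ℝ) * (c / n) ^ m ≤ m * (n:ℝ) ^ d * (2 * c) ^ m * (K1 * m / n) ^ q0 := h1
    _ ≤ m * (n:ℝ) ^ d * (c' * (c' ^ (d + 2)) ^ q0) * (K1 * m / n) ^ q0 := by gcongr
    _ = m * (n:ℝ) ^ d * c' * (c' ^ (d + 2) * (K1 * m / n)) ^ q0 := by rw [mul_pow]; ring
    _ ≤ n * (n:ℝ) ^ d * c' * (1 / r) ^ q0 := by gcongr
    _ ≤ n * (n:ℝ) ^ d * c' * (1 / r) ^ (4 * (d + 4)) := by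
        have : (1 / r) ^ q0 ≤ (1 / r) ^ (4 * (d + 4)) :=
          pow_le_pow_of_le_one (by positivity) (by rw [div_le_one hr0]; exact hr1) hq0c
        gcongr
    _ = c' / n ^ 3 := by
        rw [one_div, inv_pow, pow_mul, hr4]
        field_simp
        ring
    _ ≤ 4 * c' / (n * (m + 1) ^ 2) := by
        rw [div_le_div_iff₀ (by positivity) (by positivity)]
        have hm1 : (1:ℝ) ≤ m := by exact_mod_cast hm
        have a1 : ((m:ℝ) + 1) ^ 2 ≤ 4 * n := by
          have : (m:ℝ)^2 ≤ n := by exact_mod_cast hmn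
          nlinarith
        have a2 : (n:ℝ) * (m + 1) ^ 2 ≤ 4 * n ^ 3 := by
          calc (n:ℝ) * (m + 1) ^ 2 ≤ n * (4 * n) := by gcongr
            _ = 4 * n ^ 2 := by ring
            _ ≤ 4 * n ^ 3 := by gcongr; norm_num
        nlinarith

end

section

lemma log_bound (L : ℝ) (hL : 0 < L) : ∃ N : ℕ, ∀ n : ℕ, N ≤ n → L * Real.log (n + 2) ≤ n * Real.log 2 := by
  have hl2 : 0 < Real.log 2 := Real.log_pos (by norm_num)
  have h := Real.isLittleO_log_id_atTop.def (show (0:ℝ) < Real.log 2 / (3 * L) by positivity)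
  obtain ⟨x0, hx0⟩ := Filter.eventually_atTop.1 h
  refine ⟨⌈x0⌉₊ + 1, fun n hn => ?_⟩
  have hn1 : (1:ℝ) ≤ n := by exact_mod_cast (by omega)
  have h1 : x0 ≤ (n:ℝ) + 2 := by
    have : ((⌈x0⌉₊ : ℕ) : ℝ) ≤ n := by exact_mod_cast (by omega)
    linarith [Nat.le_ceil x0]
  have h2 := hx0 _ h1
  simp only [id, Real.norm_eq_abs] at h2
  have h3 := (le_abs_self _).trans h2
  rw [abs_of_nonneg (by positivity)] at h3
  calc L * Real.log (n + 2) ≤ L * (Real.log 2 / (3 * L) * (n + 2)) := by gcongr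
    _ = Real.log 2 * ((n + 2) / 3) := by field_simp
    _ ≤ Real.log 2 * n := by gcongr; linarith
    _ = _ := mul_comm _ _

lemma poly_exp_bound (k : ℕ) : ∃ K : ℝ, 0 ≤ K ∧ ∀ m : ℕ, (m:ℝ) ^ k ≤ K * 2 ^ m := by
  have h := tendsto_pow_const_mul_const_pow_of_abs_lt_one k (show |(1/2:ℝ)| < 1 by norm_num [abs_of_pos])
  obtain ⟨K, hK⟩ := h.bddAbove_range
  refine ⟨max K 0, le_max_right _ _, fun m => ?_⟩
  have h1 := (hK ⟨m, rfl⟩ : (m:ℝ) ^ k * (1 / 2) ^ m ≤ K).trans (le_max_left K 0)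
  rw [one_div, inv_pow, ← div_eq_mul_inv, div_le_iff₀ (by positivity)] at h1
  exact h1

lemma large_term {d : ℕ} (hd : 2 ≤ d) {c : ℝ} (hc : 0 < c) : ∃ δ : ℝ, 0 < δ ∧ ∃ C : ℝ, 0 ≤ C ∧ ∃ N : ℕ, ∀ n : ℕ, N ≤ n →
    ∀ m : ℕ, n < m ^ 2 → (m : ℝ) ≤ δ * n ^ d → ((cores n d m).card : ℝ) * (c / n) ^ m ≤ C / (n * (m + 1) ^ 2) := by
  have hdR : (2:ℝ) ≤ d := by exact_mod_cast hd
  have hd0 : (0:ℝ) < d := by linarith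
  set c' : ℝ := max c 1 with hc'
  have hc'1 : 1 ≤ c' := le_max_right _ _
  have hc'c : c ≤ c' := le_max_left _ _
  set κ : ℝ := 1 / (16 * c') with hκ
  have hκ0 : 0 < κ := by positivity
  have hκ1 : κ ≤ 1 := by rw [hκ, div_le_one (by positivity)]; linarith
  set D : ℝ := d * (2 ^ d * (d ^ d * (d + 1))) with hD
  have hD0 : 0 < D := by positivity
  set γ : ℝ := min (κ ^ (4 * (d + 2)) / 2 ^ d) (1 / (2 * D)) with hγ
  have hγ0 : 0 < γ := lt_min (by positivity) (by positivity)
  have hγa : 2 ^ d * γ ≤ κ ^ (4 * (d + 2)) := by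
    have : γ ≤ κ ^ (4 * (d + 2)) / 2 ^ d := min_le_left _ _
    rw [le_div_iff₀ (by positivity)] at this
    linarith
  have hγb : D * γ ≤ 1 / 2 := by
    have : γ ≤ 1 / (2 * D) := min_le_right _ _
    calc D * γ ≤ D * (1 / (2 * D)) := by gcongr
      _ = 1 / 2 := by field_simp
  have hγd : 2 ^ d * γ ≤ 1 := hγa.trans (pow_le_one₀ hκ0.le hκ1)
  have hγ1 : γ ≤ 1 := by
    have : (1:ℝ) ≤ 2 ^ d := one_le_pow₀ (by norm_num)
    nlinarith
  set C2 : ℝ := d * (d ^ d * (d + 1)) / γ ^ (2 ^ d) with hC2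
  have hC20 : 0 < C2 := by positivity
  obtain ⟨N1, hN1⟩ := log_bound (d * C2) (by positivity)
  obtain ⟨K, hK0, hK⟩ := poly_exp_bound (2 * d + 4)
  refine ⟨γ ^ (2 ^ d) / (d ^ d * (d + 1)), by positivity, 4 * K, by positivity, N1 + 16, fun n hn m hnm hmδ => ?_⟩
  have hn1 : 0 < n := by omega
  have hnR : (0:ℝ) < n := by exact_mod_cast hn1
  have hm4 : 4 < m := by nlinarith
  have hmR : (4:ℝ) < m := by exact_mod_cast hm4
  set b := m / 2 with hb
  set h := ⌊C2 * m / n⌋₊ with hh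
  set q0 := (m - b - 1 + (d + 1)) / (d + 2) with hq0
  have hbR : (m:ℝ) < 2 * (b + 1) := by
    have : m < 2 * (b + 1) := by omega
    exact_mod_cast this
  have hq0a : m ≤ 4 * (d + 2) * q0 := by
    have := Nat.div_add_mod (m - b - 1 + (d + 1)) (d + 2)
    have h2 := Nat.mod_lt (m - b - 1 + (d + 1)) (show 0 < d + 2 by omega)
    rw [← hq0] at this
    have h3 : 4 * (d + 2) * q0 = 4 * ((d + 2) * q0) := by ring
    omega
  have hq0b : ∀ q, m ≤ (d + 2) * q + b + 1 → q0 ≤ q := by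
    intro q hq
    rw [hq0]
    refine Nat.lt_succ_iff.1 ((Nat.div_lt_iff_lt_mul (by omega)).2 ?_)
    have : (q + 1) * (d + 2) = (d + 2) * q + (d + 2) := by ring
    rw [Nat.succ_eq_add_one, this]
    omega
  have hmain := cores_large (n := n) (m := m) (q0 := q0) (b := b) (h := h) hγ0 hγ1 hd hn1 (by omega) hγd
    (by
      rw [div_mul_eq_mul_div, le_div_iff₀ (by positivity)] at hmδ
      linarith)
    (by
      calc (d : ℝ) * (2 ^ d * (d ^ d * (γ * ((d + 1) * m)))) = (D * γ) * m := by rw [hD]; ring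
        _ ≤ 1 / 2 * m := by gcongr
        _ < _ := by linarith)
    (by
      have h1 := Nat.lt_floor_add_one (C2 * m / n)
      rw [← hh, div_lt_iff₀ hnR] at h1
      calc (d : ℝ) * (d ^ d * ((d + 1) * m)) = (C2 * m) * γ ^ (2 ^ d) := by rw [hC2]; field_simp
        _ < ((h + 1) * n) * γ ^ (2 ^ d) := by gcongr
        _ = _ := by ring)
    hq0b
  have hmainR : ((cores n d m).card : ℝ) * (n:ℝ) ^ q0 ≤
      ((n:ℝ) + 2) ^ (d * h) * (m * ((n:ℝ) ^ d * 2 ^ m * n ^ m * (2 ^ d * ⌊γ * n⌋₊) ^ q0)) := by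
    exact_mod_cast hmain
  have hnum : ((n:ℝ) + 2) ^ (d * h) ≤ 2 ^ m := by
    rw [← Real.log_le_log_iff (by positivity) (by positivity), Real.log_pow, Real.log_pow]
    have h1 : (h:ℝ) ≤ C2 * m / n := Nat.floor_le (by positivity)
    have h2 := hN1 n (by omega)
    have h3 : 0 ≤ Real.log ((n:ℝ) + 2) := Real.log_nonneg (by linarith)
    push_cast
    calc (d:ℝ) * h * Real.log (n + 2) ≤ d * (C2 * m / n) * Real.log (n + 2) := by gcongr
      _ = (d * C2 * Real.log (n + 2)) * m / n := by ring
      _ ≤ (n * Real.log 2) * m / n := by gcongr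
      _ = _ := by field_simp
  have hfl : (2:ℝ) ^ d * ⌊γ * n⌋₊ ≤ κ ^ (4 * (d + 2)) * n := by
    have h1 : ((⌊γ * n⌋₊ : ℕ) : ℝ) ≤ γ * n := Nat.floor_le (by positivity)
    calc (2:ℝ) ^ d * ⌊γ * n⌋₊ ≤ 2 ^ d * (γ * n) := by gcongr
      _ = (2 ^ d * γ) * n := by ring
      _ ≤ _ := by gcongr
  have hκq : (κ ^ (4 * (d + 2))) ^ q0 ≤ κ ^ m := by
    rw [← pow_mul]
    exact pow_le_pow_of_le_one hκ0.le hκ1 hq0a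
  have h5 : ((cores n d m).card : ℝ) ≤ 2 ^ m * (m * ((n:ℝ) ^ d * 2 ^ m * n ^ m * κ ^ m)) := by
    have : ((cores n d m).card : ℝ) * (n:ℝ) ^ q0 ≤ (2 ^ m * (m * ((n:ℝ) ^ d * 2 ^ m * n ^ m * κ ^ m))) * n ^ q0 := by
      calc _ ≤ _ := hmainR
        _ ≤ (2:ℝ) ^ m * (m * ((n:ℝ) ^ d * 2 ^ m * n ^ m * (κ ^ (4 * (d + 2)) * n) ^ q0)) := by gcongr
        _ = (2:ℝ) ^ m * (m * ((n:ℝ) ^ d * 2 ^ m * n ^ m * ((κ ^ (4 * (d + 2))) ^ q0))) * n ^ q0 := by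
            rw [mul_pow]; ring
        _ ≤ _ := by gcongr
    exact le_of_mul_le_mul_right this (by positivity)
  have h6 : c * κ ≤ 1 / 16 := by
    rw [hκ, mul_one_div, div_le_div_iff₀ (by positivity) (by norm_num)]
    linarith
  have hm2 : (m:ℝ) ≤ 2 ^ m := by exact_mod_cast Nat.lt_two_pow_self.le
  have h7 : ((cores n d m).card : ℝ) * (c / n) ^ m ≤ n ^ d / 2 ^ m := by
    calc ((cores n d m).card : ℝ) * (c / n) ^ m ≤ (2 ^ m * (m * ((n:ℝ) ^ d * 2 ^ m * n ^ m * κ ^ m))) * (c / n) ^ m := by gcongr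
      _ = m * n ^ d * (4 ^ m * (c * κ) ^ m) := by
        have e1 : (c / (n:ℝ)) ^ m = c ^ m / n ^ m := div_pow _ _ _
        have e2 : (c * κ) ^ m = c ^ m * κ ^ m := mul_pow _ _ _
        have e3 : (4:ℝ) ^ m = 2 ^ m * 2 ^ m := by rw [← mul_pow]; norm_num
        rw [e1, e2, e3]
        clear_value κ
        field_simp
      _ ≤ 2 ^ m * n ^ d * (4 ^ m * (1 / 16) ^ m) := by gcongr
      _ = _ := by
        have e1 : ((1:ℝ) / 16) ^ m = 1 / (4 ^ m * (2 ^ m * 2 ^ m)) := by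
          rw [div_pow, one_pow, ← mul_pow, ← mul_pow]; norm_num
        rw [e1]
        field_simp
  refine h7.trans ?_
  rw [div_le_div_iff₀ (by positivity) (by positivity)]
  have h8 : (n:ℝ) ≤ m ^ 2 := by exact_mod_cast hnm.le
  calc (n:ℝ) ^ d * (n * (m + 1) ^ 2) = n ^ (d + 1) * (m + 1) ^ 2 := by ring
    _ ≤ ((m:ℝ) ^ 2) ^ (d + 1) * (2 * m) ^ 2 := by gcongr; linarith
    _ = 4 * (m:ℝ) ^ (2 * d + 4) := by rw [← pow_mul]; ring
    _ ≤ 4 * (K * 2 ^ m) := by gcongr; exact hK m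
    _ = _ := by ring

lemma core_term {d : ℕ} (hd : 2 ≤ d) {c : ℝ} (hc : 0 < c) : ∃ δ : ℝ, 0 < δ ∧ ∃ C : ℝ, 0 ≤ C ∧ ∃ N : ℕ, ∀ n : ℕ, N ≤ n →
    ∀ m : ℕ, 1 ≤ m → (m : ℝ) ≤ δ * n ^ d → ((cores n d m).card : ℝ) * (c / n) ^ m ≤ C / (n * (m + 1) ^ 2) := by
  obtain ⟨M0, C2, hC2, N2, h2⟩ := medium_term hd hc
  obtain ⟨C1, hC1, h1⟩ := small_term hd hc M0
  obtain ⟨δ, hδ, C3, hC3, N3, h3⟩ := large_term hd hc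
  refine ⟨δ, hδ, C1 + C2 + C3, by positivity, N2 + N3 + 1, fun n hn m hm hmδ => ?_⟩
  have key : ∀ C ≤ C1 + C2 + C3, C / (n * ((m:ℝ) + 1) ^ 2) ≤ (C1 + C2 + C3) / (n * ((m:ℝ) + 1) ^ 2) := by
    intro C hC
    gcongr
  by_cases hM : m < M0
  · exact (h1 n (by omega) m hm hM).trans (key _ (by linarith))
  by_cases hmn : m ^ 2 ≤ n
  · exact (h2 n (by omega) m (by omega) hm hmn).trans (key _ (by linarith))
  · exact (h3 n (by omega) m (by omega) hmδ).trans (key _ (by linarith))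

theorem no_small_cores {d : ℕ} (hd : 2 ≤ d) {c : ℝ} (hc : 0 < c) : ∃ δ : ℝ, 0 < δ ∧ ∀ ε > 0, ∃ N : ℕ, ∀ n : ℕ, N ≤ n →
    Pr (allFaces n d) (c / n) (fun F => ∃ A ⊆ F, A.Nonempty ∧ isCore A ∧ noSimplex d A ∧ (A.card : ℝ) ≤ δ * n ^ d) ≤ ε := by
  obtain ⟨δ, hδ, C, hC, N, h⟩ := core_term hd hc
  refine ⟨δ, hδ, fun ε hε => ?_⟩
  have hsum : Summable (fun m : ℕ => 1 / ((m:ℝ) + 1) ^ 2) := by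
    have := (summable_nat_add_iff 1).2 (Real.summable_one_div_nat_pow.2 (show 1 < 2 by norm_num))
    simpa using this
  set S := ∑' m : ℕ, 1 / ((m:ℝ) + 1) ^ 2 with hS
  have hS0 : 0 ≤ S := tsum_nonneg fun m => by positivity
  refine ⟨N + ⌈C * S / ε⌉₊ + ⌈c⌉₊ + 1, fun n hn => ?_⟩
  have hnR : (0:ℝ) < n := by exact_mod_cast (by omega)
  have hcn : c ≤ n := by
    have : ((⌈c⌉₊ : ℕ) : ℝ) ≤ n := by exact_mod_cast (by omega)
    linarith [Nat.le_ceil c]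
  have hCn : C * S / ε ≤ n := by
    have : ((⌈C * S / ε⌉₊ : ℕ) : ℝ) ≤ n := by exact_mod_cast (by omega)
    linarith [Nat.le_ceil (C * S / ε)]
  have hp0 : 0 ≤ c / n := by positivity
  have hp1 : c / n ≤ 1 := by rw [div_le_one hnR]; exact hcn
  set M := ⌊δ * n ^ d⌋₊ with hM
  set 𝒜 := (Finset.Icc 1 M).biUnion (fun m => cores n d m) with h𝒜
  have hub := Pr_union_bound hp0 hp1 𝒜 (E := allFaces n d) (by
    intro A hA
    obtain ⟨m, _, hm⟩ := Finset.mem_biUnion.1 hA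
    exact (mem_cores.1 hm).1)
  have hmono : Pr (allFaces n d) (c / n) (fun F => ∃ A ⊆ F, A.Nonempty ∧ isCore A ∧ noSimplex d A ∧ (A.card : ℝ) ≤ δ * n ^ d)
      ≤ Pr (allFaces n d) (c / n) (fun F => ∃ A ∈ 𝒜, A ⊆ F) := by
    unfold Pr
    refine Ex_mono hp0 hp1 fun F hF => ?_
    split_ifs with h1 h2
    · exact le_refl _
    · exfalso
      apply h2
      obtain ⟨A, hA, hne, hco, hns, hcard⟩ := h1
      obtain ⟨K, hK, hmin⟩ := exists_minCore hne hco
      refine ⟨K, ?_, hK.trans hA⟩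
      refine Finset.mem_biUnion.2 ⟨K.card, ?_, ?_⟩
      · rw [Finset.mem_Icc]
        refine ⟨Finset.card_pos.2 hmin.1, Nat.le_floor ?_⟩
        refine le_trans ?_ hcard
        exact_mod_cast Finset.card_le_card hK
      · refine mem_cores.2 ⟨(hK.trans hA).trans hF, hmin, ?_, rfl⟩
        intro T hT
        obtain ⟨s, hs, h1, h2⟩ := hns T hT
        exact ⟨s, hs, h1, fun h => h2 (hK h)⟩
    · norm_num
    · exact le_refl _
  refine hmono.trans (hub.trans ?_)
  calc ∑ A ∈ 𝒜, (c / n) ^ A.card ≤ ∑ m ∈ Finset.Icc 1 M, ∑ A ∈ cores n d m, (c / n) ^ A.card := by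
        rw [h𝒜]
        rw [Finset.sum_biUnion]
        intro m _ m' _ hne
        rw [Function.onFun, Finset.disjoint_left]
        intro A h1 h2
        exact hne ((mem_cores.1 h1).2.2.2.symm.trans (mem_cores.1 h2).2.2.2)
    _ = ∑ m ∈ Finset.Icc 1 M, ((cores n d m).card : ℝ) * (c / n) ^ m := by
        refine Finset.sum_congr rfl fun m _ => ?_
        rw [Finset.sum_congr rfl (fun A hA => by rw [(mem_cores.1 hA).2.2.2] : ∀ A ∈ cores n d m, (c / (n:ℝ)) ^ A.card = (c / n) ^ m)]
        rw [Finset.sum_const, nsmul_eq_mul]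
    _ ≤ ∑ m ∈ Finset.Icc 1 M, C / n * (1 / ((m:ℝ) + 1) ^ 2) := by
        refine Finset.sum_le_sum fun m hm => ?_
        obtain ⟨hm1, hm2⟩ := Finset.mem_Icc.1 hm
        refine (h n (by omega) m hm1 ((Nat.le_floor_iff (by positivity)).1 hm2)).trans (le_of_eq ?_)
        field_simp
    _ = C / n * ∑ m ∈ Finset.Icc 1 M, (1 / ((m:ℝ) + 1) ^ 2) := by rw [Finset.mul_sum]
    _ ≤ C / n * S := by
        gcongr
        exact hsum.sum_le_tsum _ (fun m _ => by positivity)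
    _ ≤ ε := by
        rw [div_mul_eq_mul_div, div_le_iff₀ hnR]
        rw [div_le_iff₀ hε] at hCn
        linarith

end

section

def hh6 (d : ℕ) (t : ℝ) : ℝ := -1 + d * Real.log t + 1 / t
def ff6 (d : ℕ) (t : ℝ) : ℝ := ((d : ℝ) + 1) * (1 - t) + (1 + (d : ℝ) * t) * Real.log t
def cc6 (d : ℕ) (t : ℝ) : ℝ := -Real.log t / (1 - t) ^ d

lemma hasDeriv_ff6 (d : ℕ) {t : ℝ} (ht : 0 < t) : HasDerivAt (ff6 d) (hh6 d t) t := by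
  have h1 : HasDerivAt (fun t : ℝ => ((d : ℝ) + 1) * (1 - t)) (((d : ℝ) + 1) * (-1)) t :=
    ((hasDerivAt_id t).const_sub 1).const_mul _
  have h2 : HasDerivAt (fun t : ℝ => 1 + (d : ℝ) * t) ((d : ℝ) * 1) t :=
    ((hasDerivAt_id t).const_mul (d:ℝ)).const_add 1
  have h3 := h1.add (h2.mul (Real.hasDerivAt_log ht.ne'))
  refine HasDerivAt.congr_deriv h3 ?_
  unfold hh6; field_simp; ring

lemma hasDeriv_cc6 (d : ℕ) {t : ℝ} (ht : 0 < t) (ht1 : t < 1) :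
    HasDerivAt (cc6 d) (-(hh6 d t) * ((1 - t) ^ (d + 1))⁻¹) t := by
  have h1 : HasDerivAt (fun t : ℝ => (1 - t) ^ d) ((d : ℝ) * (1 - t) ^ (d - 1) * (-1)) t :=
    ((hasDerivAt_id t).const_sub 1).pow d
  have h0 : 0 < 1 - t := by linarith
  have h3 := (Real.hasDerivAt_log ht.ne').neg.div h1 (by positivity)
  refine HasDerivAt.congr_deriv h3 ?_
  unfold hh6
  rcases d with _ | d
  · simp; field_simp; ring
  · simp only [Nat.add_sub_cancel, Pi.neg_apply]; field_simp; push_cast; ring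

lemma hh6_neg {d : ℕ} (hd : 2 ≤ d) {s t : ℝ} (hs : 0 < s) (h : hh6 d s ≤ 0) (hst : s < t) (ht : t < 1) :
    hh6 d t < 0 := by
  -- in terms of u = 1/t, strict convexity of u - 1 - d log u
  have hlog := strictConcaveOn_log_Ioi
  have ht0 : 0 < t := hs.trans hst
  -- 1/t = a * 1 + b * (1/s)
  have hus : 1 < 1 / s := by rw [lt_div_iff₀ hs]; linarith
  have hut : 1 < 1 / t := by rw [lt_div_iff₀ ht0]; linarith
  have hlt : 1 / t < 1 / s := one_div_lt_one_div_of_lt hs hst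
  set us := 1 / s with hus'
  set ut := 1 / t with hut'
  have hb : 0 < (ut - 1) / (us - 1) := div_pos (by linarith) (by linarith)
  have ha : 0 < (us - ut) / (us - 1) := div_pos (by linarith) (by linarith)
  have hne : us - 1 ≠ 0 := by linarith
  have hab : (us - ut) / (us - 1) + (ut - 1) / (us - 1) = 1 := by field_simp; ring
  have key := hlog.2 (show (1:ℝ) ∈ Set.Ioi 0 by simp) (show us ∈ Set.Ioi 0 by simp; linarith) hus.ne ha hb hab
  simp only [smul_eq_mul, Real.log_one, mul_zero, zero_add] at key
  have e1 : (us - ut) / (us - 1) * 1 + (ut - 1) / (us - 1) * us = ut := by field_simp; ring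
  rw [e1] at key
  have l1 : Real.log us = - Real.log s := by rw [hus', one_div, Real.log_inv]
  have l2 : Real.log ut = - Real.log t := by rw [hut', one_div, Real.log_inv]
  unfold hh6 at h ⊢
  rw [← hus'] at h
  rw [← hut']
  have hd0 : (0:ℝ) < d := by exact_mod_cast (by omega : 0 < d)
  have h2 : us - 1 ≤ d * Real.log us := by rw [l1]; linarith
  have h3 : (ut - 1) / (us - 1) * (us - 1) ≤ (ut - 1) / (us - 1) * (d * Real.log us) :=
    mul_le_mul_of_nonneg_left h2 hb.le
  have h4 : (ut - 1) / (us - 1) * (us - 1) = ut - 1 := by field_simp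
  have h5 := mul_lt_mul_of_pos_left key hd0
  nlinarith

lemma ff6_one (d : ℕ) : ff6 d 1 = 0 := by simp [ff6]

lemma ff6_pos {d : ℕ} (hd : 2 ≤ d) {s : ℝ} (hs : 0 < s) (hs1 : s < 1) (h : hh6 d s ≤ 0) :
    0 < ff6 d s := by
  rw [← ff6_one d]
  have : StrictAntiOn (ff6 d) (Set.Icc s 1) := by
    apply strictAntiOn_of_deriv_neg (convex_Icc _ _)
    · intro x hx
      exact (hasDeriv_ff6 d (hs.trans_le hx.1)).continuousAt.continuousWithinAt
    · intro x hx
      rw [interior_Icc] at hx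
      rw [(hasDeriv_ff6 d (hs.trans hx.1)).deriv]
      exact hh6_neg hd hs h hx.1 hx.2
  exact this (Set.left_mem_Icc.2 hs1.le) (Set.right_mem_Icc.2 hs1.le) hs1

lemma calc6 {d : ℕ} (hd : 2 ≤ d) {c td : ℝ} (hc0 : 0 < c)
    (htd : td ∈ Set.Ioo (0 : ℝ) 1)
    (hroot : ((d : ℝ) + 1) * (1 - td) + (1 + (d : ℝ) * td) * Real.log td = 0)
    (hc : c < -Real.log td / (1 - td) ^ d) {t : ℝ} (ht0 : 0 ≤ t) (ht1 : t ≤ 1)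
    (hfix : t = Real.exp (-(c * (1 - t) ^ d))) :
    t - (c / (d + 1)) * (1 - (1 - t) ^ (d + 1)) + c * t * (1 - t) ^ d ≤ 1 - c / (d + 1) := by
  have htpos : 0 < t := by rw [hfix]; exact Real.exp_pos _
  rcases ht1.eq_or_lt with rfl | ht1
  · have : d ≠ 0 := by omega
    simp [this]
  have h1t : 0 < 1 - t := by linarith
  have hlog : c * (1 - t) ^ d = - Real.log t := by
    have := congrArg Real.log hfix
    rw [Real.log_exp] at this; linarith
  have hct : c = cc6 d t := by unfold cc6; rw [← hlog]; field_simp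
  change ff6 d td = 0 at hroot
  change c < cc6 d td at hc
  have htdh : 0 < hh6 d td := by
    by_contra hcon
    have := ff6_pos hd htd.1 htd.2 (not_lt.1 hcon)
    linarith
  have hpos : ∀ t, 0 < t → t ≤ td → 0 < hh6 d t := by
    intro s hs hst
    rcases hst.eq_or_lt with rfl | hst
    · exact htdh
    by_contra hcon
    have := hh6_neg hd hs (not_lt.1 hcon) hst htd.2
    linarith
  have hf : 0 ≤ ff6 d t := by
    by_cases htt : t < td
    · exfalso
      have : AntitoneOn (cc6 d) (Set.Icc t td) := by
        apply antitoneOn_of_deriv_nonpos (convex_Icc _ _)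
        · intro x hx
          exact (hasDeriv_cc6 d (htpos.trans_le hx.1) (hx.2.trans_lt htd.2)).continuousAt.continuousWithinAt
        · intro x hx
          rw [interior_Icc] at hx
          exact (hasDeriv_cc6 d (htpos.trans hx.1) (hx.2.trans htd.2)).differentiableAt.differentiableWithinAt
        · intro x hx
          rw [interior_Icc] at hx
          rw [(hasDeriv_cc6 d (htpos.trans hx.1) (hx.2.trans htd.2)).deriv]
          have h1 := hpos x (htpos.trans hx.1) hx.2.le
          have h2 : 0 < 1 - x := by linarith [hx.2, htd.2]
          have h3 : 0 < ((1 - x) ^ (d + 1))⁻¹ := by positivity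
          nlinarith
      have := this (Set.left_mem_Icc.2 htt.le) (Set.right_mem_Icc.2 htt.le) htt.le
      linarith
    · push Not at htt
      by_cases hh : hh6 d t ≤ 0
      · exact (ff6_pos hd htpos ht1 hh).le
      push Not at hh
      have : MonotoneOn (ff6 d) (Set.Icc td t) := by
        apply monotoneOn_of_deriv_nonneg (convex_Icc _ _)
        · intro x hx
          exact (hasDeriv_ff6 d (htd.1.trans_le hx.1)).continuousAt.continuousWithinAt
        · intro x hx
          rw [interior_Icc] at hx
          exact (hasDeriv_ff6 d (htd.1.trans hx.1)).differentiableAt.differentiableWithinAt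
        · intro x hx
          rw [interior_Icc] at hx
          rw [(hasDeriv_ff6 d (htd.1.trans hx.1)).deriv]
          by_contra hcon
          push Not at hcon
          have := hh6_neg hd (htd.1.trans hx.1) hcon.le hx.2 ht1
          linarith
      have := this (Set.left_mem_Icc.2 htt) (Set.right_mem_Icc.2 htt) htt
      linarith
  have e : t - (c / (d + 1)) * (1 - (1 - t) ^ (d + 1)) + c * t * (1 - t) ^ d - (1 - c / (d + 1))
      = - ff6 d t / (d + 1) := by
    have : t - (c / (d + 1)) * (1 - (1 - t) ^ (d + 1)) + c * t * (1 - t) ^ d - (1 - c / (d + 1))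
      = (t - 1) + (c * (1 - t) ^ d) * ((1 - t) / (d + 1) + t) := by
      field_simp; ring
    rw [this, hlog]
    unfold ff6; field_simp; ring
  have : - ff6 d t / (d + 1) ≤ 0 := div_nonpos_of_nonpos_of_nonneg (by linarith) (by positivity)
  linarith

end

section

open MeasureTheory in
def cvp (μ : Measure ENNReal) : ℕ → Measure ENNReal
  | 0 => Measure.dirac 0
  | j + 1 => Measure.conv μ (cvp μ j)

open MeasureTheory in
lemma cvp_prob (μ : Measure ENNReal) [IsProbabilityMeasure μ] (j : ℕ) : IsProbabilityMeasure (cvp μ j) := by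
  induction j with
  | zero => unfold cvp; infer_instance
  | succ j ih => unfold cvp; infer_instance

open MeasureTheory in
instance cvp_inst (μ : Measure ENNReal) [IsProbabilityMeasure μ] (j : ℕ) : IsProbabilityMeasure (cvp μ j) :=
  cvp_prob μ j

open MeasureTheory in
lemma lintegral_cvp_succ (μ : Measure ENNReal) [IsProbabilityMeasure μ] (j : ℕ) {f : ENNReal → ENNReal}
    (hf : Measurable f) : ∫⁻ z, f z ∂(cvp μ (j + 1)) = ∫⁻ s, ∫⁻ z, f (s + z) ∂(cvp μ j) ∂μ := by
  show ∫⁻ z, f z ∂(Measure.conv μ (cvp μ j)) = _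
  rw [Measure.lintegral_conv hf]

open MeasureTheory in
lemma lintegral_cvp_zero (μ : Measure ENNReal) {f : ENNReal → ENNReal}
    (hf : Measurable f) : ∫⁻ z, f z ∂(cvp μ 0) = f 0 := by
  show ∫⁻ z, f z ∂(Measure.dirac 0) = _
  rw [lintegral_dirac' _ hf]

open MeasureTheory in
lemma mecke_pow (μ : Measure ENNReal) [IsProbabilityMeasure μ] (j : ℕ) {h : ENNReal → ENNReal}
    (hh : Measurable h) : ∫⁻ z, z * h z ∂(cvp μ (j + 1)) =
      (j + 1) * ∫⁻ s, ∫⁻ z, s * h (s + z) ∂(cvp μ j) ∂μ := by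
  induction j generalizing h with
  | zero =>
    rw [lintegral_cvp_succ _ _ (by fun_prop)]
    simp only [Nat.cast_zero, zero_add, one_mul]
    refine lintegral_congr fun s => ?_
    rw [lintegral_cvp_zero _ (by fun_prop), lintegral_cvp_zero _ (by fun_prop), add_zero]
  | succ j ih =>
    rw [lintegral_cvp_succ _ _ (by fun_prop)]
    have e1 : ∀ s, ∫⁻ z, (s + z) * h (s + z) ∂(cvp μ (j + 1)) =
        ∫⁻ z, s * h (s + z) ∂(cvp μ (j + 1)) +
          (j + 1) * ∫⁻ s', ∫⁻ z, s' * h (s + (s' + z)) ∂(cvp μ j) ∂μ := by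
      intro s
      rw [← ih (h := fun z => h (s + z)) (by fun_prop), ← lintegral_add_left (by fun_prop)]
      refine lintegral_congr fun z => ?_
      rw [add_mul]
    rw [lintegral_congr e1, lintegral_add_left (by fun_prop), lintegral_const_mul _ (by fun_prop)]
    have e3 : ∫⁻ s, ∫⁻ s', ∫⁻ z, s' * h (s + (s' + z)) ∂(cvp μ j) ∂μ ∂μ =
        ∫⁻ s', ∫⁻ s, ∫⁻ z, s' * h (s + (s' + z)) ∂(cvp μ j) ∂μ ∂μ :=
      lintegral_lintegral_swap (by fun_prop)
    rw [e3]
    have e2 : ∀ s', ∫⁻ s, ∫⁻ z, s' * h (s + (s' + z)) ∂(cvp μ j) ∂μ =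
        ∫⁻ z, s' * h (s' + z) ∂(cvp μ (j + 1)) := by
      intro s'
      rw [lintegral_cvp_succ _ _ (by fun_prop)]
      refine lintegral_congr fun s => lintegral_congr fun z => ?_
      rw [add_left_comm]
    rw [lintegral_congr e2]
    push_cast
    ring

def pois (c : ℝ) (j : ℕ) : ENNReal := ENNReal.ofReal (Real.exp (-c) * c ^ j / j.factorial)

lemma pois_hasSum (c : ℝ) (r : ℝ) : HasSum (fun j : ℕ => Real.exp (-c) * c ^ j / j.factorial * r ^ j)
    (Real.exp (-(c * (1 - r)))) := by
  have h := (NormedSpace.expSeries_div_hasSum_exp (c * r)).mul_left (Real.exp (-c))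
  rw [← Real.exp_eq_exp_ℝ, ← Real.exp_add] at h
  have e : -c + c * r = -(c * (1 - r)) := by ring
  rw [e] at h
  refine h.congr_fun ?_ |> fun h => h
  intro j
  rw [mul_pow]; ring

lemma tsum_pois_mul {c : ℝ} (hc : 0 ≤ c) {r : ℝ} (hr : 0 ≤ r) :
    ∑' j, pois c j * (ENNReal.ofReal r) ^ j = ENNReal.ofReal (Real.exp (-(c * (1 - r)))) := by
  have h := pois_hasSum c r
  rw [← h.tsum_eq, ENNReal.ofReal_tsum_of_nonneg (fun j => by positivity) h.summable]
  refine tsum_congr fun j => ?_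
  unfold pois
  rw [← ENNReal.ofReal_pow hr, ← ENNReal.ofReal_mul (by positivity)]

lemma tsum_pois {c : ℝ} (hc : 0 ≤ c) : ∑' j, pois c j = 1 := by
  have := tsum_pois_mul hc (r := 1) (by norm_num)
  simpa using this

lemma pois_succ {c : ℝ} (hc : 0 ≤ c) (j : ℕ) : pois c (j + 1) * (j + 1) = ENNReal.ofReal c * pois c j := by
  unfold pois
  have : ((j:ENNReal) + 1) = ENNReal.ofReal ((j:ℝ) + 1) := by
    rw [ENNReal.ofReal_add (by positivity) (by norm_num)]; simp
  rw [this, ← ENNReal.ofReal_mul (by positivity), ← ENNReal.ofReal_mul (by positivity)]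
  congr 1
  rw [Nat.factorial_succ]
  push_cast
  field_simp
  ring

open MeasureTheory in
def CP (c : ℝ) (ν : Measure ENNReal) : Measure ENNReal := Measure.sum (fun j => pois c j • cvp ν j)

open MeasureTheory in
lemma lintegral_CP (c : ℝ) (ν : Measure ENNReal) (f : ENNReal → ENNReal) :
    ∫⁻ z, f z ∂(CP c ν) = ∑' j, pois c j * ∫⁻ z, f z ∂(cvp ν j) := by
  unfold CP
  rw [lintegral_sum_measure]
  simp [lintegral_smul_measure]

open MeasureTheory in
lemma CP_prob {c : ℝ} (hc : 0 ≤ c) (ν : Measure ENNReal) [IsProbabilityMeasure ν] :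
    IsProbabilityMeasure (CP c ν) := by
  constructor
  rw [← lintegral_one, lintegral_CP]
  simp [tsum_pois hc]

open MeasureTheory in
lemma mecke {c : ℝ} (hc : 0 ≤ c) (ν : Measure ENNReal) [IsProbabilityMeasure ν] {h : ENNReal → ENNReal}
    (hh : Measurable h) : ∫⁻ z, z * h z ∂(CP c ν) =
      ENNReal.ofReal c * ∫⁻ s, ∫⁻ z, s * h (s + z) ∂(CP c ν) ∂ν := by
  have hR : ∫⁻ s, ∫⁻ z, s * h (s + z) ∂(CP c ν) ∂ν =
      ∑' j, pois c j * ∫⁻ s, ∫⁻ z, s * h (s + z) ∂(cvp ν j) ∂ν := by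
    simp_rw [lintegral_CP]
    rw [lintegral_tsum (fun j => by fun_prop)]
    refine tsum_congr fun j => ?_
    rw [lintegral_const_mul _ (by fun_prop)]
  rw [hR, lintegral_CP, tsum_eq_zero_add' ENNReal.summable, lintegral_cvp_zero _ (by fun_prop), zero_mul,
    mul_zero, zero_add, ← ENNReal.tsum_mul_left]
  refine tsum_congr fun j => ?_
  rw [mecke_pow _ _ hh, ← mul_assoc, ← mul_assoc, pois_succ hc]

open MeasureTheory in
/-- the law of the child sum reciprocal -/
def nuOf (d : ℕ) (μ : Measure ENNReal) : Measure ENNReal := Measure.map (fun s => s⁻¹) (cvp μ d)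

open MeasureTheory in
instance nuOf_inst (d : ℕ) (μ : Measure ENNReal) [IsProbabilityMeasure μ] : IsProbabilityMeasure (nuOf d μ) :=
  Measure.isProbabilityMeasure_map (by fun_prop)

open MeasureTheory in
def Lam (c : ℝ) (d : ℕ) (μ : Measure ENNReal) : Measure ENNReal :=
  Measure.map (fun z => (1 + z)⁻¹) (CP c (nuOf d μ))

open MeasureTheory in
lemma Lam_prob {c : ℝ} (hc : 0 ≤ c) (d : ℕ) (μ : Measure ENNReal) [IsProbabilityMeasure μ] :
    IsProbabilityMeasure (Lam c d μ) := by
  have := CP_prob hc (nuOf d μ)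
  exact Measure.isProbabilityMeasure_map (by fun_prop)

open MeasureTheory in
lemma lintegral_Lam (c : ℝ) (d : ℕ) (μ : Measure ENNReal) {f : ENNReal → ENNReal} (hf : Measurable f) :
    ∫⁻ x, f x ∂(Lam c d μ) = ∑' j, pois c j * ∫⁻ z, f (1 + z)⁻¹ ∂(cvp (nuOf d μ) j) := by
  unfold Lam
  rw [lintegral_map hf (by fun_prop), lintegral_CP]

open MeasureTheory in
/-- probability that the sum is zero / not top -/
lemma cvp_zero_set (μ : Measure ENNReal) [IsProbabilityMeasure μ] (j : ℕ) :
    ∫⁻ z, (if z = 0 then 1 else 0) ∂(cvp μ j) = (∫⁻ z, (if z = 0 then 1 else 0) ∂μ) ^ j := by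
  have hm : Measurable (fun z : ENNReal => if z = 0 then (1:ENNReal) else 0) :=
    Measurable.ite (measurableSet_singleton 0) measurable_const measurable_const
  induction j with
  | zero => rw [lintegral_cvp_zero _ hm]; simp
  | succ j ih =>
    rw [lintegral_cvp_succ _ _ hm]
    have : ∀ s z : ENNReal, (if s + z = 0 then (1:ENNReal) else 0) =
        (if s = 0 then 1 else 0) * (if z = 0 then 1 else 0) := by
      intro s z
      by_cases hs : s = 0 <;> by_cases hz : z = 0 <;> simp [hs, hz]
    simp_rw [this]
    simp_rw [lintegral_const_mul _ hm, ih]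
    rw [lintegral_mul_const _ hm, pow_succ, mul_comm]

open MeasureTheory in
lemma cvp_top_set (μ : Measure ENNReal) [IsProbabilityMeasure μ] (j : ℕ) :
    ∫⁻ z, (if z = ⊤ then 0 else 1) ∂(cvp μ j) = (∫⁻ z, (if z = ⊤ then 0 else 1) ∂μ) ^ j := by
  have hm : Measurable (fun z : ENNReal => if z = ⊤ then (0:ENNReal) else 1) :=
    Measurable.ite (measurableSet_singleton ⊤) measurable_const measurable_const
  induction j with
  | zero => rw [lintegral_cvp_zero _ hm]; simp
  | succ j ih =>
    rw [lintegral_cvp_succ _ _ hm]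
    have : ∀ s z : ENNReal, (if s + z = ⊤ then (0:ENNReal) else 1) =
        (if s = ⊤ then 0 else 1) * (if z = ⊤ then 0 else 1) := by
      intro s z
      by_cases hs : s = ⊤ <;> by_cases hz : z = ⊤ <;> simp [hs, hz]
    simp_rw [this]
    simp_rw [lintegral_const_mul _ hm, ih]
    rw [lintegral_mul_const _ hm, pow_succ, mul_comm]

end

section

lemma meas_ind0 : Measurable (fun z : ENNReal => if z = 0 then (1:ENNReal) else 0) :=
    Measurable.ite (measurableSet_singleton 0) measurable_const measurable_const
lemma meas_ind0' : Measurable (fun z : ENNReal => if z = 0 then (0:ENNReal) else 1) :=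
    Measurable.ite (measurableSet_singleton 0) measurable_const measurable_const
lemma meas_indT : Measurable (fun z : ENNReal => if z = ⊤ then (0:ENNReal) else 1) :=
    Measurable.ite (measurableSet_singleton ⊤) measurable_const measurable_const
lemma meas_indT' : Measurable (fun z : ENNReal => if z = ⊤ then (1:ENNReal) else 0) :=
    Measurable.ite (measurableSet_singleton ⊤) measurable_const measurable_const

lemma inv_identity (s z : ENNReal) : s * (1 + (s + z))⁻¹ + (if z = ⊤ then 0 else 1) * (if s = ⊤ then 1 else 0) =
    (1 + z)⁻¹ * ((1 + z)⁻¹ + s⁻¹)⁻¹ := by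
  by_cases hz : z = ⊤
  · simp [hz]
  by_cases hs : s = ⊤
  · subst hs
    simp [hz]
    rw [mul_comm, ENNReal.mul_inv_cancel] <;> simp [hz]
  by_cases hs0 : s = 0
  · subst hs0; simp
  simp only [hz, hs, if_false, mul_zero, add_zero]
  lift s to NNReal using hs
  lift z to NNReal using hz
  have hs1 : s ≠ 0 := by exact_mod_cast hs0
  have h1 : (1:ENNReal) + z = ((1 + z : NNReal) : ENNReal) := by push_cast; rfl
  have h2 : (1:ENNReal) + (s + z) = ((1 + (s + z) : NNReal) : ENNReal) := by push_cast; rfl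
  rw [h2, h1, ← ENNReal.coe_inv (by positivity), ← ENNReal.coe_inv (by positivity), ← ENNReal.coe_inv hs1,
    ← ENNReal.coe_add, ← ENNReal.coe_inv (by positivity), ← ENNReal.coe_mul, ← ENNReal.coe_mul]
  congr 1
  have : (0:NNReal) < s := by positivity
  field_simp
  ring

open MeasureTheory in
lemma lintegral_nuOf (d : ℕ) (μ : Measure ENNReal) {f : ENNReal → ENNReal} (hf : Measurable f) :
    ∫⁻ x, f x ∂(nuOf d μ) = ∫⁻ z, f z⁻¹ ∂(cvp μ d) := by
  unfold nuOf
  rw [lintegral_map hf (by fun_prop)]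

open MeasureTheory in
lemma ind_compl (μ : Measure ENNReal) [IsProbabilityMeasure μ] :
    ∫⁻ z, (if z = 0 then 1 else 0) ∂μ + ∫⁻ z, (if z = 0 then 0 else 1) ∂μ = 1 := by
  rw [← lintegral_add_left meas_ind0]
  have : ∀ z : ENNReal, (if z = 0 then (1:ENNReal) else 0) + (if z = 0 then 0 else 1) = 1 := by
    intro z; by_cases h : z = 0 <;> simp [h]
  simp [this]

open MeasureTheory in
lemma fixed_point_formula {c : ℝ} (hc : 0 < c) {d : ℕ} {μ : Measure ENNReal} [IsProbabilityMeasure μ]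
    (hμ : μ = Lam c d μ) : ∃ t E : ℝ, 0 ≤ t ∧ t ≤ 1 ∧ t = Real.exp (-(c * (1 - t) ^ d)) ∧
      0 ≤ E ∧ ∫⁻ x, x ∂μ = ENNReal.ofReal E ∧
      E = t - (c/(d+1))*(1-(1-t)^(d+1)) + c*t*(1-t)^d := by
  have hLz : ∀ {f : ENNReal → ENNReal}, Measurable f → ∫⁻ x, f x ∂μ = ∫⁻ z, f (1 + z)⁻¹ ∂(CP c (nuOf d μ)) := by
    intro f hf
    conv_lhs => rw [hμ]
    unfold Lam
    rw [lintegral_map hf (by fun_prop)]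
  have hCP := CP_prob hc.le (nuOf d μ)
  set p0 := ∫⁻ z, (if z = 0 then (1:ENNReal) else 0) ∂μ with hp0
  set t0 := ∫⁻ z, (if z = 0 then (0:ENNReal) else 1) ∂μ with ht0
  have hpt : p0 + t0 = 1 := ind_compl μ
  have ht0T : t0 ≠ ⊤ := by intro h; rw [h] at hpt; simp at hpt
  have hp0T : p0 ≠ ⊤ := by intro h; rw [h] at hpt; simp at hpt
  obtain ⟨t, ht, rt0⟩ : ∃ t : ℝ, 0 ≤ t ∧ t0 = ENNReal.ofReal t :=
    ⟨t0.toReal, by positivity, (ENNReal.ofReal_toReal ht0T).symm⟩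
  obtain ⟨q, hq, rp0⟩ : ∃ t : ℝ, 0 ≤ t ∧ p0 = ENNReal.ofReal t :=
    ⟨p0.toReal, by positivity, (ENNReal.ofReal_toReal hp0T).symm⟩
  clear_value p0 t0
  have hqt : q = 1 - t := by
    rw [rt0, rp0, ← ENNReal.ofReal_add hq ht, ENNReal.ofReal_eq_one] at hpt
    linarith
  have hq1 : q ≤ 1 := by linarith
  -- law of nu being top
  have hnuT : ∫⁻ z, (if z = ⊤ then 1 else 0) ∂(nuOf d μ) = p0 ^ d := by
    unfold nuOf
    rw [lintegral_map meas_indT' (by fun_prop), hp0, ← cvp_zero_set]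
    refine lintegral_congr fun z => ?_
    simp
  have hnuT' : ∫⁻ z, (if z = ⊤ then 0 else 1) ∂(nuOf d μ) = ENNReal.ofReal (1 - q ^ d) := by
    have h1 : ∫⁻ z, (if z = ⊤ then (1:ENNReal) else 0) ∂(nuOf d μ) +
        ∫⁻ z, (if z = ⊤ then 0 else 1) ∂(nuOf d μ) = 1 := by
      rw [← lintegral_add_left meas_indT']
      have : ∀ z : ENNReal, (if z = ⊤ then (1:ENNReal) else 0) + (if z = ⊤ then 0 else 1) = 1 := by
        intro z; by_cases h : z = ⊤ <;> simp [h]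
      simp [this]
    rw [hnuT, rp0, ← ENNReal.ofReal_pow hq] at h1
    have := ENNReal.eq_sub_of_add_eq (by simp) (add_comm _ _ |>.trans h1)
    rw [this, ← ENNReal.ofReal_one, ← ENNReal.ofReal_sub _ (by positivity)]
  have hqd : q ^ d ≤ 1 := pow_le_one₀ hq hq1
  have hfixE : t0 = ENNReal.ofReal (Real.exp (-(c * q ^ d))) := by
    rw [ht0, hLz meas_ind0', lintegral_CP]
    have : ∀ z : ENNReal, (if (1 + z)⁻¹ = 0 then (0:ENNReal) else 1) = if z = ⊤ then 0 else 1 := by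
      intro z; simp
    simp_rw [this, cvp_top_set, hnuT']
    rw [tsum_pois_mul hc.le (by linarith)]
    ring_nf
  have hfix : t = Real.exp (-(c * q ^ d)) := by
    rw [rt0] at hfixE
    exact (ENNReal.ofReal_eq_ofReal_iff ht (Real.exp_nonneg _)).1 hfixE
  -- main identity
  set J := ∫⁻ s, ∫⁻ z, s * (1 + (s + z))⁻¹ ∂(CP c (nuOf d μ)) ∂(nuOf d μ) with hJ
  have hA : t0 = ∫⁻ x, x ∂μ + ENNReal.ofReal c * J := by
    rw [hJ, ← mecke (h := fun z => (1 + z)⁻¹) hc.le _ (by fun_prop), hLz (f := fun x => x) measurable_id, ht0, hLz meas_ind0',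
      ← lintegral_add_left (by fun_prop)]
    refine lintegral_congr fun z => ?_
    by_cases hz : z = ⊤
    · simp [hz]
    · have : (1 + z)⁻¹ + z * (1 + z)⁻¹ = (1 + z) * (1 + z)⁻¹ := by ring
      rw [this, ENNReal.mul_inv_cancel (by simp) (by simp [hz])]
      simp [hz]
  have hB : J + t0 * p0 ^ d = ∫⁻ x, ∫⁻ S, x * (x + S)⁻¹ ∂(cvp μ d) ∂μ := by
    rw [lintegral_lintegral_swap (by fun_prop)]
    have e1 : ∀ S, ∫⁻ x, x * (x + S)⁻¹ ∂μ = ∫⁻ z, (1 + z)⁻¹ * ((1 + z)⁻¹ + S)⁻¹ ∂(CP c (nuOf d μ)) := by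
      intro S; rw [hLz (by fun_prop)]
    rw [lintegral_congr e1]
    have e2 : ∫⁻ S, ∫⁻ z, (1 + z)⁻¹ * ((1 + z)⁻¹ + S)⁻¹ ∂(CP c (nuOf d μ)) ∂(cvp μ d) =
        ∫⁻ s, ∫⁻ z, (1 + z)⁻¹ * ((1 + z)⁻¹ + s⁻¹)⁻¹ ∂(CP c (nuOf d μ)) ∂(nuOf d μ) := by
      rw [lintegral_nuOf d μ (f := fun s => ∫⁻ z, (1 + z)⁻¹ * ((1 + z)⁻¹ + s⁻¹)⁻¹ ∂(CP c (nuOf d μ))) (by fun_prop)]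
      simp
    rw [e2]
    simp_rw [← inv_identity]
    have e3 : ∀ s : ENNReal, ∫⁻ z, (s * (1 + (s + z))⁻¹ + (if z = ⊤ then 0 else 1) * (if s = ⊤ then 1 else 0))
        ∂(CP c (nuOf d μ)) = ∫⁻ z, s * (1 + (s + z))⁻¹ ∂(CP c (nuOf d μ)) + t0 * (if s = ⊤ then 1 else 0) := by
      intro s
      rw [lintegral_add_left (by fun_prop), lintegral_mul_const _ meas_indT]
      congr 2
      rw [ht0, hLz meas_ind0']
      refine lintegral_congr fun z => ?_
      simp
    rw [lintegral_congr e3, lintegral_add_left (by fun_prop), lintegral_const_mul _ meas_indT', hnuT]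
  have hC : (d + 1 : ENNReal) * (J + t0 * p0 ^ d) + p0 ^ (d + 1) = 1 := by
    rw [hB, ← mecke_pow μ d (h := fun z => z⁻¹) (by fun_prop), hp0, ← cvp_zero_set,
      ← lintegral_add_left (by fun_prop)]
    have hT : ∫⁻ z, (if z = ⊤ then 0 else 1) ∂(cvp μ (d + 1)) = 1 := by
      rw [cvp_top_set]
      have : ∫⁻ z, (if z = ⊤ then 0 else 1) ∂μ = 1 := by
        rw [hLz meas_indT]; simp
      rw [this, one_pow]
    refine Eq.trans ?_ hT
    refine lintegral_congr fun z => ?_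
    by_cases hz : z = ⊤
    · simp [hz]
    · by_cases hz0 : z = 0
      · simp [hz0]
      · simp [hz, hz0, ENNReal.mul_inv_cancel hz0 hz]
  have hJT : J ≠ ⊤ := by
    intro h; rw [h] at hC; simp at hC
  obtain ⟨j, hj, rJ⟩ : ∃ t : ℝ, 0 ≤ t ∧ J = ENNReal.ofReal t :=
    ⟨J.toReal, by positivity, (ENNReal.ofReal_toReal hJT).symm⟩
  clear_value J
  have hET : ∫⁻ x, x ∂μ ≠ ⊤ := by
    intro h; rw [h] at hA; simp at hA; exact ht0T hA
  obtain ⟨E, hE, rE⟩ : ∃ t : ℝ, 0 ≤ t ∧ ∫⁻ x, x ∂μ = ENNReal.ofReal t :=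
    ⟨(∫⁻ x, x ∂μ).toReal, by positivity, (ENNReal.ofReal_toReal hET).symm⟩
  refine ⟨t, E, ht, by linarith, by rw [← hqt]; exact hfix, hE, rE, ?_⟩
  rw [rE, rt0, rJ, ← ENNReal.ofReal_mul hc.le, ← ENNReal.ofReal_add hE (by positivity),
    ENNReal.ofReal_eq_ofReal_iff ht (by positivity)] at hA
  have hd1 : (d + 1 : ENNReal) = ENNReal.ofReal ((d:ℝ) + 1) := by
    rw [ENNReal.ofReal_add (by positivity) (by norm_num)]; simp
  rw [hd1, rt0, rJ, rp0, ← ENNReal.ofReal_pow hq, ← ENNReal.ofReal_pow hq, ← ENNReal.ofReal_mul ht,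
    ← ENNReal.ofReal_add hj (by positivity), ← ENNReal.ofReal_mul (by positivity),
    ← ENNReal.ofReal_add (by positivity) (by positivity), ENNReal.ofReal_eq_one] at hC
  rw [← hqt]
  have hJv : j = (1 - q ^ (d + 1)) / (d + 1) - t * q ^ d := by
    field_simp
    linarith
  have : E = t - c * j := by linarith
  rw [this, hJv]
  ring

end

section

open MeasureTheory in
def StLe (μ μ' : Measure ENNReal) : Prop :=
  (∀ f : ENNReal → ENNReal, Monotone f → ∫⁻ x, f x ∂μ ≤ ∫⁻ x, f x ∂μ') ∧
  (∀ f : ENNReal → ENNReal, Antitone f → ∫⁻ x, f x ∂μ' ≤ ∫⁻ x, f x ∂μ)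

open MeasureTheory in
lemma StLe_cvp {μ μ' : Measure ENNReal} [IsProbabilityMeasure μ] [IsProbabilityMeasure μ'] (h : StLe μ μ') (j : ℕ) :
    StLe (cvp μ j) (cvp μ' j) := by
  induction j with
  | zero => exact ⟨fun f _ => le_rfl, fun f _ => le_rfl⟩
  | succ j ih =>
    constructor
    · intro f hf
      have hfm := hf.measurable
      rw [lintegral_cvp_succ _ _ hfm, lintegral_cvp_succ _ _ hfm]
      refine (lintegral_mono fun s => ih.1 _ (fun a b hab => hf (by gcongr))).trans ?_
      exact h.1 _ (fun a b hab => lintegral_mono fun z => hf (by gcongr))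
    · intro f hf
      have hfm := hf.measurable
      rw [lintegral_cvp_succ _ _ hfm, lintegral_cvp_succ _ _ hfm]
      refine (lintegral_mono fun s => ih.2 _ (fun a b hab => hf (by gcongr))).trans ?_
      exact h.2 _ (fun a b hab => lintegral_mono fun z => hf (by gcongr))

open MeasureTheory in
lemma StLe_nuOf {μ μ' : Measure ENNReal} [IsProbabilityMeasure μ] [IsProbabilityMeasure μ'] (h : StLe μ μ') (d : ℕ) :
    StLe (nuOf d μ') (nuOf d μ) := by
  have h' := StLe_cvp h d
  constructor
  · intro f hf
    rw [lintegral_nuOf _ _ hf.measurable, lintegral_nuOf _ _ hf.measurable]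
    exact h'.2 _ (fun a b hab => hf (ENNReal.inv_le_inv.2 hab))
  · intro f hf
    rw [lintegral_nuOf _ _ hf.measurable, lintegral_nuOf _ _ hf.measurable]
    exact h'.1 _ (fun a b hab => hf (ENNReal.inv_le_inv.2 hab))

open MeasureTheory in
lemma StLe_Lam {μ μ' : Measure ENNReal} [IsProbabilityMeasure μ] [IsProbabilityMeasure μ'] (h : StLe μ μ')
    (c : ℝ) (d : ℕ) : StLe (Lam c d μ) (Lam c d μ') := by
  have h' := StLe_nuOf h d
  constructor
  · intro f hf
    rw [lintegral_Lam _ _ _ hf.measurable, lintegral_Lam _ _ _ hf.measurable]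
    refine ENNReal.tsum_le_tsum fun j => ?_
    refine mul_le_mul_right ?_ _
    exact (StLe_cvp h' j).2 _ (fun a b hab => hf (ENNReal.inv_le_inv.2 (by gcongr)))
  · intro f hf
    rw [lintegral_Lam _ _ _ hf.measurable, lintegral_Lam _ _ _ hf.measurable]
    refine ENNReal.tsum_le_tsum fun j => ?_
    refine mul_le_mul_right ?_ _
    exact (StLe_cvp h' j).1 _ (fun a b hab => hf (ENNReal.inv_le_inv.2 (by gcongr)))

open MeasureTheory in
def muk (c : ℝ) (d : ℕ) : ℕ → Measure ENNReal
  | 0 => Measure.dirac 1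
  | k + 1 => Lam c d (muk c d k)

open MeasureTheory in
lemma muk_prob {c : ℝ} (hc : 0 ≤ c) (d k : ℕ) : IsProbabilityMeasure (muk c d k) := by
  induction k with
  | zero => unfold muk; infer_instance
  | succ k ih => unfold muk; exact Lam_prob hc _ _

open MeasureTheory in
lemma Lam_ae_le (c : ℝ) (d : ℕ) (μ : Measure ENNReal) : ∀ᵐ x ∂(Lam c d μ), x ≤ 1 := by
  unfold Lam
  rw [ae_map_iff (by fun_prop) measurableSet_Iic]
  refine Eventually.of_forall fun z => ?_
  rw [ENNReal.inv_le_one]; exact le_self_add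

open MeasureTheory in
lemma muk_ae_le (c : ℝ) (d k : ℕ) : ∀ᵐ x ∂(muk c d k), x ≤ 1 := by
  cases k with
  | zero => 
    unfold muk
    rw [ae_dirac_iff measurableSet_Iic]
  | succ k => exact Lam_ae_le _ _ _

open MeasureTheory in
lemma StLe_muk {c : ℝ} (hc : 0 ≤ c) (d k : ℕ) : StLe (muk c d (k + 1)) (muk c d k) := by
  induction k with
  | zero =>
    have := muk_prob hc d 1
    have hm : ∀ f : ENNReal → ENNReal, Measurable f → ∫⁻ x, f x ∂(muk c d 0) = f 1 := by
      intro f hf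
      unfold muk
      rw [lintegral_dirac' _ hf]
    constructor
    · intro f hf
      rw [hm f hf.measurable]
      refine (lintegral_mono_ae ((muk_ae_le c d 1).mono fun x hx => hf hx)).trans ?_
      simp
    · intro f hf
      rw [hm f hf.measurable]
      refine le_trans ?_ (lintegral_mono_ae ((muk_ae_le c d 1).mono fun x hx => hf hx))
      simp
  | succ k ih =>
    have := muk_prob hc d k
    have := muk_prob hc d (k + 1)
    exact StLe_Lam ih c d

open MeasureTheory in
lemma tendsto_test {ι : Type*} {U : Filter ι} {u : ι → ProbabilityMeasure ENNReal} {μ : ProbabilityMeasure ENNReal}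
    (h : Tendsto u U (nhds μ)) {f : ENNReal → ENNReal} (hf : Continuous f) (hf1 : ∀ x, f x ≤ 1) :
    Tendsto (fun i => ∫⁻ x, f x ∂(u i : Measure ENNReal)) U (nhds (∫⁻ x, f x ∂(μ : Measure ENNReal))) := by
  have hT : ∀ x, f x ≠ ⊤ := fun x => ne_top_of_le_ne_top (by simp) (hf1 x)
  let g : BoundedContinuousFunction ENNReal NNReal :=
    BoundedContinuousFunction.mkOfBound ⟨fun x => (f x).toNNReal, by
      rw [continuous_iff_continuousAt]
      intro x
      exact (ENNReal.tendsto_toNNReal (hT x)).comp hf.continuousAt⟩ 1 (by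
        intro x y
        have h1 : ∀ x, ((f x).toNNReal : ℝ) ≤ 1 := by
          intro x
          have := ENNReal.toNNReal_mono (by simp) (hf1 x)
          simpa using this
        have h2 := h1 x
        have h3 := h1 y
        simp only [ContinuousMap.coe_mk, NNReal.dist_eq]
        rw [abs_le]
        constructor <;> linarith [((f x).toNNReal).coe_nonneg, ((f y).toNNReal).coe_nonneg])
  have := (ProbabilityMeasure.tendsto_iff_forall_lintegral_tendsto.1 h) g
  have e : ∀ x, (g x : ENNReal) = f x := fun x => ENNReal.coe_toNNReal (hT x)
  simpa [e] using this

open MeasureTheory in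
def cvpP (μ : ProbabilityMeasure ENNReal) (j : ℕ) : ProbabilityMeasure ENNReal := ⟨cvp μ j, inferInstance⟩

open MeasureTheory in
def nuP (d : ℕ) (μ : ProbabilityMeasure ENNReal) : ProbabilityMeasure ENNReal := ⟨nuOf d μ, inferInstance⟩

open MeasureTheory in
lemma cvpP_cont (j : ℕ) : Continuous (fun μ => cvpP μ j) := by
  induction j with
  | zero =>
    have : (fun μ => cvpP μ 0) = fun _ => cvpP ⟨Measure.dirac 0, inferInstance⟩ 0 := rfl
    rw [this]; exact continuous_const
  | succ j ih =>
    have : (fun μ => cvpP μ (j + 1)) = (fun μ : ProbabilityMeasure ENNReal =>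
        (μ.prod (cvpP μ j)).map (f := fun x => x.1 + x.2) (by fun_prop)) := by
      funext μ
      apply Subtype.ext
      rfl
    rw [this]
    refine (ProbabilityMeasure.continuous_map (by fun_prop)).comp ?_
    exact ProbabilityMeasure.continuous_prod.comp (continuous_id.prodMk ih)

open MeasureTheory in
lemma nuP_cont (d : ℕ) : Continuous (nuP d) := by
  have : nuP d = (fun μ : ProbabilityMeasure ENNReal =>
        (cvpP μ d).map (f := fun x => x⁻¹) (by fun_prop)) := by
      funext μ
      apply Subtype.ext
      rfl
  rw [this]
  exact (ProbabilityMeasure.continuous_map (by fun_prop)).comp (cvpP_cont d)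

open MeasureTheory in
lemma tendsto_Lam {ι : Type*} {U : Filter ι} {u : ι → ProbabilityMeasure ENNReal} {μ : ProbabilityMeasure ENNReal}
    {c : ℝ} (hc : 0 ≤ c) (d : ℕ)
    (h : Tendsto u U (nhds μ)) {f : ENNReal → ENNReal} (hf : Continuous f) (hf1 : ∀ x, f x ≤ 1) :
    Tendsto (fun i => ∫⁻ x, f x ∂(Lam c d (u i : Measure ENNReal))) U
      (nhds (∫⁻ x, f x ∂(Lam c d (μ : Measure ENNReal)))) := by
  simp_rw [lintegral_Lam c d _ hf.measurable]
  have hterm : ∀ j, Tendsto (fun i => ∫⁻ z, f (1 + z)⁻¹ ∂(cvp (nuOf d (u i)) j)) U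
      (nhds (∫⁻ z, f (1 + z)⁻¹ ∂(cvp (nuOf d μ) j))) := by
    intro j
    have h1 : Tendsto (fun i => cvpP (nuP d (u i)) j) U (nhds (cvpP (nuP d μ) j)) :=
      (((cvpP_cont j).comp (nuP_cont d)).tendsto μ).comp h
    exact tendsto_test h1 (f := fun z => f (1 + z)⁻¹) (by fun_prop) (fun x => hf1 _)
  have hle : ∀ (μ : ProbabilityMeasure ENNReal) j, ∫⁻ z, f (1 + z)⁻¹ ∂(cvp (nuOf d μ) j) ≤ 1 := by
    intro μ j
    refine (lintegral_mono fun z => hf1 _).trans ?_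
    simp
  have hpT : ∀ j, pois c j ≠ ⊤ := fun j => by unfold pois; simp
  have hne : ∀ (μ : ProbabilityMeasure ENNReal) j, pois c j * ∫⁻ z, f (1 + z)⁻¹ ∂(cvp (nuOf d μ) j) ≠ ⊤ := by
    intro μ j
    exact ENNReal.mul_ne_top (hpT j) (ne_top_of_le_ne_top (by simp) (hle μ j))
  have hsne : ∀ (μ : ProbabilityMeasure ENNReal), ∑' j, pois c j * ∫⁻ z, f (1 + z)⁻¹ ∂(cvp (nuOf d μ) j) ≠ ⊤ := by
    intro μ
    refine ne_top_of_le_ne_top (b := 1) (by simp) ?_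
    refine le_trans ?_ (tsum_pois hc).le
    exact ENNReal.tsum_le_tsum fun j => (mul_le_mul_right (hle μ j) (pois c j)).trans (mul_one _).le
  rw [← ENNReal.tendsto_toReal_iff (fun i => hsne _) (hsne _)]
  simp_rw [ENNReal.tsum_toReal_eq (hne _)]
  refine tendsto_tsum_of_dominated_convergence (bound := fun j => (pois c j).toReal) ?_ ?_ ?_
  · refine ENNReal.summable_toReal ?_
    rw [tsum_pois hc]; simp
  · intro j
    rw [ENNReal.tendsto_toReal_iff (fun i => hne _ _) (hne _ _)]
    exact ENNReal.Tendsto.const_mul (hterm j) (Or.inr (hpT j))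
  · refine Eventually.of_forall fun i j => ?_
    rw [Real.norm_of_nonneg ENNReal.toReal_nonneg]
    exact ENNReal.toReal_mono (hpT j) ((mul_le_mul_right (hle _ j) _).trans (by simp))

open MeasureTheory in
lemma meas_eq_of_ramp {μ ν : Measure ENNReal} [IsProbabilityMeasure μ] [IsProbabilityMeasure ν]
    (h : ∀ (a : ENNReal) (m : ℕ), ∫⁻ x, min 1 (m * (x - a)) ∂μ = ∫⁻ x, min 1 (m * (x - a)) ∂ν) : μ = ν := by
  have key : ∀ a : ENNReal, ∀ μ : Measure ENNReal, μ (Set.Ioi a) = ⨆ m : ℕ, ∫⁻ x, min 1 (m * (x - a)) ∂μ := by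
    intro a μ
    rw [← lintegral_iSup (fun m => by
      have : Continuous (fun x : ENNReal => min 1 ((m:ENNReal) * (x - a))) :=
        continuous_const.min ((ENNReal.continuous_const_mul (by simp)).comp (ENNReal.continuous_sub_right a))
      exact this.measurable)
      (fun m m' hm x => by
        have : (m:ENNReal) ≤ m' := by exact_mod_cast hm
        dsimp; gcongr), ← lintegral_indicator_one measurableSet_Ioi]
    refine lintegral_congr fun x => ?_
    by_cases hx : a < x
    · rw [Set.indicator_of_mem (show x ∈ Set.Ioi a from hx)]
      refine le_antisymm ?_ (iSup_le fun m => min_le_left _ _)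
      have hpos : x - a ≠ 0 := (tsub_pos_of_lt hx).ne'
      obtain ⟨m, hm⟩ := ENNReal.exists_nat_mul_gt hpos (b := 1) (by simp)
      refine le_iSup_of_le m ?_
      simp [hm.le]
    · rw [Set.indicator_of_notMem (show x ∉ Set.Ioi a from hx)]
      rw [tsub_eq_zero_of_le (not_lt.1 hx)]
      simp
  refine Measure.ext_of_Iic _ _ fun a => ?_
  have e : Set.Iic a = (Set.Ioi a)ᶜ := by simp
  rw [e, prob_compl_eq_one_sub measurableSet_Ioi, prob_compl_eq_one_sub measurableSet_Ioi, key a μ, key a ν]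
  simp_rw [h]

open MeasureTheory in
lemma exists_fixed {c : ℝ} (hc : 0 ≤ c) (d : ℕ) : ∃ μ : Measure ENNReal, IsProbabilityMeasure μ ∧ μ = Lam c d μ ∧
    ∃ U : Ultrafilter ℕ, Tendsto (fun k => ∫⁻ x, x ∂(muk c d k)) U (nhds (∫⁻ x, x ∂μ)) := by
  let u : ℕ → ProbabilityMeasure ENNReal := fun k => ⟨muk c d k, muk_prob hc d k⟩
  let U : Ultrafilter ℕ := hyperfilter ℕ
  have hU : (U : Filter ℕ) ≤ atTop := by
    rw [← Nat.cofinite_eq_atTop]; exact hyperfilter_le_cofinite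
  obtain ⟨μ, -, hμ⟩ := isCompact_univ.ultrafilter_le_nhds (U.map u) (by simp)
  have hu : Tendsto u U (nhds μ) := hμ
  have hfix : (μ : Measure ENNReal) = Lam c d μ := by
    have := Lam_prob hc d (μ : Measure ENNReal)
    refine meas_eq_of_ramp fun a m => ?_
    have hcont : Continuous (fun x : ENNReal => min 1 ((m:ENNReal) * (x - a))) :=
        continuous_const.min ((ENNReal.continuous_const_mul (by simp)).comp (ENNReal.continuous_sub_right a))
    have hmono : Monotone (fun x : ENNReal => min 1 ((m:ENNReal) * (x - a))) := by
      intro x y hxy; dsimp; gcongr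
    have t1 := tendsto_test hu hcont (fun x => min_le_left _ _)
    have t2 := tendsto_Lam hc d hu hcont (fun x => min_le_left _ _)
    have hanti : Antitone (fun k => ∫⁻ x, min 1 ((m:ENNReal) * (x - a)) ∂(muk c d k)) :=
      antitone_nat_of_succ_le fun k => (StLe_muk hc d k).1 _ hmono
    have t3 := tendsto_atTop_iInf hanti
    have t4 := (tendsto_add_atTop_iff_nat 1).2 t3
    exact (tendsto_nhds_unique t1 (t3.mono_left hU)).trans (tendsto_nhds_unique t2 (t4.mono_left hU)).symm
  refine ⟨μ, inferInstance, hfix, U, ?_⟩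
  have t1 := tendsto_test hu (f := fun x => min 1 x) (by fun_prop) (fun x => min_le_left _ _)
  have e : ∫⁻ x, min 1 x ∂(μ : Measure ENNReal) = ∫⁻ x, x ∂(μ : Measure ENNReal) := by
    refine lintegral_congr_ae ?_
    rw [hfix]
    exact (Lam_ae_le c d _).mono fun x hx => min_eq_right hx
  have e' : ∀ k, ∫⁻ x, min 1 x ∂(u k : Measure ENNReal) = ∫⁻ x, x ∂(muk c d k) := by
    intro k
    refine lintegral_congr_ae ?_
    exact (muk_ae_le c d k).mono fun x hx => min_eq_right hx
  rw [e] at t1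
  simp_rw [e'] at t1
  exact t1

open MeasureTheory in
lemma muk_limit {d : ℕ} (hd : 2 ≤ d) {c td : ℝ} (hc0 : 0 < c)
    (htd : td ∈ Set.Ioo (0 : ℝ) 1)
    (hroot : ((d : ℝ) + 1) * (1 - td) + (1 + (d : ℝ) * td) * Real.log td = 0)
    (hc : c < -Real.log td / (1 - td) ^ d) {η : ℝ} (hη : 0 < η) :
    ∃ k, ∫⁻ x, x ∂(muk c d k) ≤ ENNReal.ofReal (1 - c / (d + 1) + η) := by
  obtain ⟨μ, hμp, hμ, U, hU⟩ := exists_fixed hc0.le d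
  obtain ⟨t, E, ht0, ht1, hfix, hE0, hE, hEv⟩ := fixed_point_formula hc0 hμ
  have h6 := calc6 hd hc0 htd hroot hc ht0 ht1 hfix
  rw [← hEv] at h6
  have hpos : 0 < 1 - c / (d + 1) + η := by linarith
  have hlt : ∫⁻ x, x ∂μ < ENNReal.ofReal (1 - c / (d + 1) + η) := by
    rw [hE]
    exact (ENNReal.ofReal_lt_ofReal_iff hpos).2 (by linarith)
  have := hU.eventually (gt_mem_nhds hlt)
  obtain ⟨k, hk⟩ := this.exists
  exact ⟨k, hk.le⟩

end

section

/-- outcome of an exploration from a `(d-1)`-face `τ` -/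
structure Outc {n : ℕ} (D : Finset (Fin n)) (R F : Finset (Finset (Fin n))) (τ : Finset (Fin n)) (M : ℕ)
    (D' : Finset (Fin n)) (R' F' : Finset (Finset (Fin n))) (f : Finset (Fin n) → ℝ) : Prop where
  hD : D ⊆ D'
  hM : D'.card ≤ D.card + M
  hR : R' ⊆ R
  hF : F ⊆ F'
  hf : f - Pi.single τ 1 ∈ bspan F'
  hs : ∀ η, f η ≠ 0 → η = τ ∨ (η ⊆ D' ∧ ¬ η ⊆ D)
  hr : ∀ ρ ∈ R, ρ ∉ R' → (ρ \ D').card ≤ 1 ∧ (2 ≤ (ρ \ D).card ∨ (τ ⊆ ρ ∧ (ρ \ D).card = 1))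
  hp : 0 < ∑ η, f η ^ 2

/-- coefficient -/
def cf {n : ℕ} (τ σ : Finset (Fin n)) (u : Fin n) : ℝ := -(bdCoeff τ σ * bdCoeff (σ.erase u) σ)

/-- partial exploration of the children of a face `σ ⊃ τ` -/
structure Chld {n : ℕ} (D : Finset (Fin n)) (R F : Finset (Finset (Fin n))) (σ τ P : Finset (Fin n)) (M : ℕ)
    (D' : Finset (Fin n)) (R' F' : Finset (Finset (Fin n))) (g : Finset (Fin n) → ℝ) : Prop where
  hD : D ⊆ D'
  hM : D'.card ≤ D.card + P.card * M
  hR : R' ⊆ R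
  hF : F ⊆ F'
  hg : g - ∑ u ∈ P, cf τ σ u • (Pi.single (σ.erase u) 1 : Finset (Fin n) → ℝ) ∈ bspan F'
  hs : ∀ η, g η ≠ 0 → (∃ u ∈ P, η = σ.erase u) ∨ (η ⊆ D' ∧ ¬ η ⊆ D)
  hr : ∀ ρ ∈ R, ρ ∉ R' → (ρ \ D').card ≤ 1 ∧ (2 ≤ (ρ \ D).card ∨ ∃ u ∈ P, σ.erase u ⊆ ρ ∧ (ρ \ D).card = 1)
  hp : P.Nonempty → 0 < ∑ η, g η ^ 2

lemma sdiff_card_mono {n : ℕ} {A D D' : Finset (Fin n)} (h : D ⊆ D') : (A \ D').card ≤ (A \ D).card :=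
  Finset.card_le_card (Finset.sdiff_subset_sdiff le_rfl h)

lemma bdCoeff_erase_sq {n : ℕ} {σ : Finset (Fin n)} {v : Fin n} (hv : v ∈ σ) :
    bdCoeff (σ.erase v) σ ^ 2 = 1 := by
  rw [bdCoeff_erase hv, ← pow_mul, mul_comm, pow_mul]; norm_num

lemma cf_sq {n : ℕ} {σ : Finset (Fin n)} {v u : Fin n} (hv : v ∈ σ) (hu : u ∈ σ) :
    cf (σ.erase v) σ u ^ 2 = 1 := by
  unfold cf
  rw [neg_sq, mul_pow, bdCoeff_erase_sq hv, bdCoeff_erase_sq hu, one_mul]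

lemma Chld_zero {n : ℕ} (D : Finset (Fin n)) (R F : Finset (Finset (Fin n))) (σ τ : Finset (Fin n)) (M : ℕ) :
    Chld D R F σ τ ∅ M D R F 0 := by
  constructor
  · exact le_rfl
  · simp
  · exact le_rfl
  · exact le_rfl
  · simp
  · simp
  · intro ρ h h'; exact absurd h h'
  · simp

lemma Chld_step {n : ℕ} {D : Finset (Fin n)} {R F : Finset (Finset (Fin n))} {σ P : Finset (Fin n)} {v : Fin n} {M : ℕ}
    {D2 : Finset (Fin n)} {R2 F2 : Finset (Finset (Fin n))} {g : Finset (Fin n) → ℝ}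
    (h : Chld D R F σ (σ.erase v) P M D2 R2 F2 g) (hv : v ∈ σ) (hσ : σ ⊆ D) (hP : P ⊆ σ)
    {u : Fin n} (hu : u ∈ σ) (huP : u ∉ P)
    {D' : Finset (Fin n)} {R' F' : Finset (Finset (Fin n))} {f : Finset (Fin n) → ℝ}
    (ho : Outc D2 R2 F2 (σ.erase u) M D' R' F' f) :
    Chld D R F σ (σ.erase v) (insert u P) M D' R' F' (g + cf (σ.erase v) σ u • f) ∧
    ∑ η, (g + cf (σ.erase v) σ u • f) η ^ 2 = ∑ η, g η ^ 2 + ∑ η, f η ^ 2 := by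
  have hdisj : ∀ η, g η ≠ 0 → f η ≠ 0 → False := by
    intro η hg hf
    rcases h.hs η hg with ⟨u', hu', rfl⟩ | ⟨h1, h2⟩
    · rcases ho.hs _ hf with h3 | ⟨h3, h4⟩
      · have : u' = u := (Finset.erase_injOn σ) (by exact_mod_cast hP hu') (by exact_mod_cast hu) h3
        exact huP (this ▸ hu')
      · exact h4 ((Finset.erase_subset _ _).trans (hσ.trans h.hD))
    · rcases ho.hs _ hf with h3 | ⟨h3, h4⟩
      · subst h3; exact h2 ((Finset.erase_subset _ _).trans hσ)
      · exact h4 h1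
  have hsum : ∑ η, (g + cf (σ.erase v) σ u • f) η ^ 2 = ∑ η, g η ^ 2 + ∑ η, f η ^ 2 := by
    rw [← Finset.sum_add_distrib]
    refine Finset.sum_congr rfl fun η _ => ?_
    have hc := cf_sq hv hu
    simp only [Pi.add_apply, Pi.smul_apply, smul_eq_mul]
    by_cases h1 : g η = 0
    · rw [h1, zero_add, mul_pow, hc]; ring
    · have h2 : f η = 0 := by by_contra h2; exact hdisj η h1 h2
      rw [h2]; ring
  refine ⟨⟨h.hD.trans ho.hD, ?_, ho.hR.trans h.hR, h.hF.trans ho.hF, ?_, ?_, ?_, ?_⟩, hsum⟩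
  · have := ho.hM; have := h.hM
    rw [Finset.card_insert_of_notMem huP]; linarith
  · rw [Finset.sum_insert huP]
    have e : g + cf (σ.erase v) σ u • f - (cf (σ.erase v) σ u • (Pi.single (σ.erase u) 1 : Finset (Fin n) → ℝ) +
        ∑ w ∈ P, cf (σ.erase v) σ w • (Pi.single (σ.erase w) 1 : Finset (Fin n) → ℝ)) =
        (g - ∑ w ∈ P, cf (σ.erase v) σ w • (Pi.single (σ.erase w) 1 : Finset (Fin n) → ℝ)) +
        cf (σ.erase v) σ u • (f - Pi.single (σ.erase u) 1) := by
      rw [smul_sub]; abel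
    rw [e]
    exact Submodule.add_mem _ (bspan_mono ho.hF h.hg) (Submodule.smul_mem _ _ ho.hf)
  · intro η hη
    by_cases h1 : g η = 0
    · have h2 : f η ≠ 0 := by
        intro h2; apply hη; simp [h1, h2]
      rcases ho.hs _ h2 with h3 | ⟨h3, h4⟩
      · exact Or.inl ⟨u, Finset.mem_insert_self _ _, h3⟩
      · exact Or.inr ⟨h3, fun h5 => h4 (h5.trans h.hD)⟩
    · rcases h.hs _ h1 with ⟨w, hw, h3⟩ | ⟨h3, h4⟩
      · exact Or.inl ⟨w, Finset.mem_insert_of_mem hw, h3⟩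
      · exact Or.inr ⟨h3.trans ho.hD, h4⟩
  · intro ρ hρ hρ'
    by_cases hρ2 : ρ ∈ R2
    · obtain ⟨h1, h2⟩ := ho.hr ρ hρ2 hρ'
      refine ⟨h1, ?_⟩
      have hm := sdiff_card_mono (A := ρ) h.hD
      rcases h2 with h2 | ⟨h2, h3⟩
      · left; omega
      · rcases Nat.lt_or_ge (ρ \ D).card 2 with h4 | h4
        · right; exact ⟨u, Finset.mem_insert_self _ _, h2, by omega⟩
        · left; exact h4
    · obtain ⟨h1, h2⟩ := h.hr ρ hρ hρ2
      refine ⟨(sdiff_card_mono ho.hD).trans h1, ?_⟩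
      rcases h2 with h2 | ⟨w, hw, h3⟩
      · left; exact h2
      · right; exact ⟨w, Finset.mem_insert_of_mem hw, h3⟩
  · intro _
    rw [hsum]
    have := ho.hp
    have : 0 ≤ ∑ η, g η ^ 2 := Finset.sum_nonneg fun _ _ => sq_nonneg _
    linarith

/-- starting condition for an exploration -/
def Start {n : ℕ} (d : ℕ) (D : Finset (Fin n)) (R : Finset (Finset (Fin n))) (τ : Finset (Fin n)) : Prop :=
  τ ⊆ D ∧ τ.card = d ∧ (∀ v ∉ D, insert v τ ∈ R) ∧ ∀ σ : Finset (Fin n), σ.card = d + 1 → 2 ≤ (σ \ D).card → σ ∈ R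

lemma Start_child {n d : ℕ} {D0 : Finset (Fin n)} {R0 F0 : Finset (Finset (Fin n))} {τ : Finset (Fin n)} {M M' : ℕ}
    (hst : Start d D0 R0 τ)
    {D : Finset (Fin n)} {R F : Finset (Finset (Fin n))} {f : Finset (Fin n) → ℝ}
    (ho : Outc D0 R0 F0 τ M D R F f) {v : Fin n} (hv : v ∉ D) {P : Finset (Fin n)}
    {D2 : Finset (Fin n)} {R2 F2 : Finset (Finset (Fin n))} {g : Finset (Fin n) → ℝ}
    (hc : Chld (insert v D) (R.erase (insert v τ)) (insert (insert v τ) F) (insert v τ) τ P M' D2 R2 F2 g)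
    (hP : P ⊆ τ) {u : Fin n} (hu : u ∈ τ) (huP : u ∉ P) :
    Start d D2 R2 ((insert v τ).erase u) := by
  obtain ⟨h1, h2, h3, h4⟩ := hst
  have hτD : τ ⊆ D := h1.trans ho.hD
  have hvτ : v ∉ τ := fun h => hv (hτD h)
  have hσD1 : insert v τ ⊆ insert v D := Finset.insert_subset_insert _ hτD
  have hσD2 : insert v τ ⊆ D2 := hσD1.trans hc.hD
  have hcard : ((insert v τ).erase u).card = d := by
    rw [Finset.card_erase_of_mem (Finset.mem_insert_of_mem hu), Finset.card_insert_of_notMem hvτ]; omega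
  have hDD2 : D ⊆ D2 := (Finset.subset_insert _ _).trans hc.hD
  have hvu : v ≠ u := fun h => hvτ (h ▸ hu)
  -- general membership principle
  have hin : ∀ ρ : Finset (Fin n), ρ.card = d + 1 → 2 ≤ (ρ \ D).card → ¬ ρ ⊆ D2 → ρ ∈ R.erase (insert v τ) := by
    intro ρ hρ h2 hn
    rw [Finset.mem_erase]
    refine ⟨fun h => hn (h ▸ hσD2), ?_⟩
    by_contra hR
    have := (ho.hr ρ (h4 ρ hρ (h2.trans (sdiff_card_mono ho.hD))) hR).1
    omega
  refine ⟨(Finset.erase_subset _ _).trans hσD2, hcard, ?_, ?_⟩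
  · intro w hw
    have hwσ : w ∉ insert v τ := fun h => hw (hσD2 h)
    have hwe : w ∉ (insert v τ).erase u := fun h => hwσ (Finset.mem_of_mem_erase h)
    have hwv : w ≠ v := fun h => hwσ (h ▸ Finset.mem_insert_self _ _)
    have hmem : insert w ((insert v τ).erase u) ∈ R.erase (insert v τ) := by
      refine hin _ (by rw [Finset.card_insert_of_notMem hwe, hcard]) ?_ (fun h => hw (h (Finset.mem_insert_self _ _)))
      have : ({w, v} : Finset (Fin n)) ⊆ insert w ((insert v τ).erase u) \ D := by
        intro x hx
        simp only [Finset.mem_insert, Finset.mem_singleton] at hx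
        rcases hx with rfl | rfl
        · simp only [Finset.mem_sdiff, Finset.mem_insert, true_or, true_and]
          exact fun h => hw (hDD2 h)
        · simp [hv, hvu]
      calc 2 = ({w, v} : Finset (Fin n)).card := (Finset.card_pair hwv).symm
        _ ≤ _ := Finset.card_le_card this
    by_contra hR2
    have hr := (hc.hr _ hmem hR2).2
    have hsd : (insert w ((insert v τ).erase u) \ insert v D) ⊆ {w} := by
      intro x hx
      simp only [Finset.mem_sdiff, Finset.mem_insert, Finset.mem_erase] at hx
      simp only [Finset.mem_singleton]
      by_contra hne
      rcases hx.1 with h | ⟨_, h | h⟩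
      · exact hne h
      · exact hx.2 (Or.inl h)
      · exact hx.2 (Or.inr (hτD h))
    have hle := Finset.card_le_card hsd
    rw [Finset.card_singleton] at hle
    rcases hr with hr | ⟨u', hu', hsub, _⟩
    · omega
    · have hu'σ : u ∈ (insert v τ).erase u' := by
        rw [Finset.mem_erase]
        exact ⟨fun h => huP (h ▸ hu'), Finset.mem_insert_of_mem hu⟩
      have := hsub hu'σ
      rw [Finset.mem_insert] at this
      rcases this with h | h
      · exact hwσ (h ▸ Finset.mem_insert_of_mem hu)
      · exact Finset.notMem_erase _ _ h
  · intro ρ hρ h2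
    have hn : ¬ ρ ⊆ D2 := by
      intro h
      rw [Finset.sdiff_eq_empty_iff_subset.2 h] at h2; simp at h2
    have hmem := hin ρ hρ (h2.trans (sdiff_card_mono hDD2)) hn
    by_contra hR2
    have := (hc.hr ρ hmem hR2).1
    omega

lemma Outc_notfound {n : ℕ} {D0 : Finset (Fin n)} {R0 F0 : Finset (Finset (Fin n))} {τ : Finset (Fin n)} {M : ℕ}
    (hτ : τ ⊆ D0)
    {D : Finset (Fin n)} {R F : Finset (Finset (Fin n))} {f : Finset (Fin n) → ℝ}
    (ho : Outc D0 R0 F0 τ M D R F f) {v : Fin n} (hv : v ∉ D) :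
    Outc D0 R0 F0 τ M D (R.erase (insert v τ)) F f := by
  refine ⟨ho.hD, ho.hM, (Finset.erase_subset _ _).trans ho.hR, ho.hF, ho.hf, ho.hs, ?_, ho.hp⟩
  intro ρ hρ hρ'
  by_cases h : ρ ∈ R
  · have e : ρ = insert v τ := by
      by_contra hne; exact hρ' (Finset.mem_erase.2 ⟨hne, h⟩)
    subst e
    have hs : ∀ D' : Finset (Fin n), τ ⊆ D' → v ∉ D' → insert v τ \ D' = {v} := by
      intro D' h1 h2
      rw [Finset.insert_sdiff_of_notMem _ h2, Finset.sdiff_eq_empty_iff_subset.2 h1]; rfl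
    rw [hs D (hτ.trans ho.hD) hv, hs D0 hτ (fun h => hv (ho.hD h))]
    simp
  · exact ho.hr ρ hρ h

lemma Outc_found {n : ℕ} {D0 : Finset (Fin n)} {R0 F0 : Finset (Finset (Fin n))} {τ : Finset (Fin n)} {M M' : ℕ}
    (hτ : τ ⊆ D0) (hne : τ.Nonempty)
    {D : Finset (Fin n)} {R F : Finset (Finset (Fin n))} {f : Finset (Fin n) → ℝ}
    (ho : Outc D0 R0 F0 τ M D R F f) {v : Fin n} (hv : v ∉ D)
    {D2 : Finset (Fin n)} {R2 F2 : Finset (Finset (Fin n))} {g : Finset (Fin n) → ℝ}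
    (hc : Chld (insert v D) (R.erase (insert v τ)) (insert (insert v τ) F) (insert v τ) τ τ M' D2 R2 F2 g) :
    ∃ f', Outc D0 R0 F0 τ (M + (1 + τ.card * M')) D2 R2 F2 f' ∧
      (∑ η, f' η ^ 2)⁻¹ = (∑ η, f η ^ 2)⁻¹ + (∑ η, g η ^ 2)⁻¹ := by
  have hτD : τ ⊆ D := hτ.trans ho.hD
  have hvτ : v ∉ τ := fun h => hv (hτD h)
  have hve : (insert v τ).erase v = τ := Finset.erase_insert hvτ
  have hDD2 : D ⊆ D2 := (Finset.subset_insert _ _).trans hc.hD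
  have hσD2 : insert v τ ⊆ D2 := (Finset.insert_subset_insert _ hτD).trans hc.hD
  have hsf := ho.hp
  have hsg := hc.hp hne
  set A := ∑ η, f η ^ 2 with hA
  set S := ∑ η, g η ^ 2 with hS
  have hAS : A⁻¹ + S⁻¹ ≠ 0 := by positivity
  have hdisj : ∀ η, f η ≠ 0 → g η ≠ 0 → False := by
    intro η hf hg
    have h1 : η ⊆ D := by
      rcases ho.hs η hf with h | h
      · rw [h]; exact hτD
      · exact h.1
    rcases hc.hs η hg with ⟨u, hu, rfl⟩ | h
    · refine hv (h1 ?_)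
      rw [Finset.mem_erase]
      exact ⟨fun h => hvτ (h ▸ hu), Finset.mem_insert_self _ _⟩
    · exact h.2 (h1.trans (Finset.subset_insert _ _))
  -- g represents e_τ
  have hgτ : g - Pi.single τ 1 ∈ bspan F2 := by
    have hb : bvec (insert v τ) ∈ bspan F2 := bvec_mem (hc.hF (Finset.mem_insert_self _ _))
    have e : g - Pi.single τ 1 = (g - ∑ u ∈ τ, cf τ (insert v τ) u • (Pi.single ((insert v τ).erase u) 1 : Finset (Fin n) → ℝ))
        - bdCoeff τ (insert v τ) • bvec (insert v τ) := by
      have hb2 : bvec (insert v τ) = bdCoeff τ (insert v τ) • (Pi.single τ 1 : Finset (Fin n) → ℝ) +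
          ∑ u ∈ τ, bdCoeff ((insert v τ).erase u) (insert v τ) • (Pi.single ((insert v τ).erase u) 1 : Finset (Fin n) → ℝ) := by
        have hb3 : bvec (insert v τ) = ∑ u ∈ insert v τ, bdCoeff ((insert v τ).erase u) (insert v τ) •
            (Pi.single ((insert v τ).erase u) 1 : Finset (Fin n) → ℝ) := by
          funext η
          simp only [bvec, Finset.sum_apply, Pi.smul_apply, smul_eq_mul, Pi.single_apply, mul_ite, mul_one, mul_zero]
          by_cases hη : bdCoeff η (insert v τ) = 0
          · rw [hη]
            symm
            refine Finset.sum_eq_zero fun u hu => ?_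
            split_ifs with h
            · rw [← h, hη]
            · rfl
          · obtain ⟨w, hw, rfl⟩ := exists_erase ((bdCoeff_ne_zero_iff _ _).1 hη)
            rw [Finset.sum_eq_single w]
            · simp
            · intro u hu huw
              rw [if_neg]
              intro h
              exact huw ((Finset.erase_injOn (insert v τ)) (by exact_mod_cast hu) (by exact_mod_cast hw) h.symm)
            · intro h; exact absurd hw h
        rw [hb3, Finset.sum_insert hvτ, hve]
      have hsq : bdCoeff τ (insert v τ) * bdCoeff τ (insert v τ) = 1 := by
        have := bdCoeff_erase_sq (Finset.mem_insert_self v τ)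
        rw [hve] at this; rw [← this]; ring
      rw [hb2, smul_add, smul_smul, hsq, one_smul, Finset.smul_sum]
      simp only [cf, smul_smul, neg_smul, Finset.sum_neg_distrib]
      abel
    rw [e]
    exact Submodule.sub_mem _ hc.hg (Submodule.smul_mem _ _ hb)
  have hfτ : f - Pi.single τ 1 ∈ bspan F2 := bspan_mono ((Finset.subset_insert _ _).trans hc.hF) ho.hf
  set α := A⁻¹ / (A⁻¹ + S⁻¹) with hα
  set β := S⁻¹ / (A⁻¹ + S⁻¹) with hβ
  have hαβ : α + β = 1 := by rw [hα, hβ]; field_simp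
  have hsum : ∑ η, (α • f + β • g) η ^ 2 = (A⁻¹ + S⁻¹)⁻¹ := by
    have : ∑ η, (α • f + β • g) η ^ 2 = α ^ 2 * A + β ^ 2 * S := by
      rw [hA, hS, Finset.mul_sum, Finset.mul_sum, ← Finset.sum_add_distrib]
      refine Finset.sum_congr rfl fun η _ => ?_
      simp only [Pi.add_apply, Pi.smul_apply, smul_eq_mul]
      by_cases h1 : f η = 0
      · rw [h1]; ring
      · have h2 : g η = 0 := by by_contra h2; exact hdisj η h1 h2
        rw [h2]; ring
    rw [this, hα, hβ]
    clear_value A S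
    field_simp
  refine ⟨α • f + β • g, ⟨ho.hD.trans hDD2, ?_, hc.hR.trans ((Finset.erase_subset _ _).trans ho.hR),
    ho.hF.trans ((Finset.subset_insert _ _).trans hc.hF), ?_, ?_, ?_, ?_⟩, ?_⟩
  · have h1 := hc.hM
    have h2 := ho.hM
    rw [Finset.card_insert_of_notMem hv] at h1
    linarith
  · have e : α • f + β • g - Pi.single τ 1 = α • (f - Pi.single τ 1) + β • (g - Pi.single τ 1) := by
      have : (Pi.single τ 1 : Finset (Fin n) → ℝ) = (α + β) • Pi.single τ 1 := by rw [hαβ, one_smul]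
      conv_lhs => rw [this]
      rw [add_smul, smul_sub, smul_sub]; abel
    rw [e]
    exact Submodule.add_mem _ (Submodule.smul_mem _ _ hfτ) (Submodule.smul_mem _ _ hgτ)
  · intro η hη
    by_cases h1 : f η = 0
    · have h2 : g η ≠ 0 := by intro h2; apply hη; simp [h1, h2]
      right
      rcases hc.hs η h2 with ⟨u, hu, rfl⟩ | ⟨h3, h4⟩
      · refine ⟨(Finset.erase_subset _ _).trans hσD2, fun h => hv (ho.hD (h ?_))⟩
        rw [Finset.mem_erase]
        exact ⟨fun h => hvτ (h ▸ hu), Finset.mem_insert_self _ _⟩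
      · exact ⟨h3, fun h => h4 (h.trans (ho.hD.trans (Finset.subset_insert _ _)))⟩
    · rcases ho.hs η h1 with h | h
      · exact Or.inl h
      · exact Or.inr ⟨h.1.trans hDD2, h.2⟩
  · intro ρ hρ hρ'
    by_cases h1 : ρ ∈ R.erase (insert v τ)
    · obtain ⟨h2, h3⟩ := hc.hr ρ h1 hρ'
      refine ⟨h2, Or.inl ?_⟩
      rcases h3 with h3 | ⟨u, hu, h3, h4⟩
      · exact h3.trans (sdiff_card_mono (ho.hD.trans (Finset.subset_insert _ _)))
      · have hvρ : v ∈ ρ := h3 (Finset.mem_erase.2 ⟨fun h => hvτ (h ▸ hu), Finset.mem_insert_self _ _⟩)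
        have hsub : insert v (ρ \ insert v D) ⊆ ρ \ D0 := by
          intro x hx
          rw [Finset.mem_insert] at hx
          rcases hx with rfl | hx
          · exact Finset.mem_sdiff.2 ⟨hvρ, fun h => hv (ho.hD h)⟩
          · rw [Finset.mem_sdiff] at hx ⊢
            exact ⟨hx.1, fun h => hx.2 (Finset.mem_insert_of_mem (ho.hD h))⟩
        have := Finset.card_le_card hsub
        rw [Finset.card_insert_of_notMem (by simp)] at this
        omega
    · obtain ⟨h2, h3⟩ := (Outc_notfound hτ ho hv).hr ρ hρ h1
      exact ⟨(sdiff_card_mono hDD2).trans h2, h3⟩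
  · rw [hsum]; positivity
  · rw [hsum, inv_inv]

lemma Cand_found {n : ℕ} {τ D : Finset (Fin n)} {M' : ℕ} {R F : Finset (Finset (Fin n))}
    (hτD : τ ⊆ D) {v : Fin n} (hv : v ∉ D)
    {D2 : Finset (Fin n)} {R2 F2 : Finset (Finset (Fin n))} {g : Finset (Fin n) → ℝ}
    (hc : Chld (insert v D) (R.erase (insert v τ)) (insert (insert v τ) F) (insert v τ) τ τ M' D2 R2 F2 g)
    {C : Finset (Fin n)} (hC : ∀ w ∈ C, w ∉ D ∧ insert w τ ∈ R) :
    ∃ C' : Finset (Fin n), (∀ w ∈ C', w ∉ D2 ∧ insert w τ ∈ R2) ∧ C.card ≤ C'.card + 1 + τ.card * M' := by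
  have hvτ : v ∉ τ := fun h => hv (hτD h)
  refine ⟨C \ D2, ?_, ?_⟩
  · intro w hw
    rw [Finset.mem_sdiff] at hw
    refine ⟨hw.2, ?_⟩
    have hwv : w ≠ v := fun h => hw.2 (hc.hD (h ▸ Finset.mem_insert_self _ _))
    have hwD := (hC w hw.1).1
    have hwτ : w ∉ τ := fun h => hwD (hτD h)
    have hmem : insert w τ ∈ R.erase (insert v τ) := by
      rw [Finset.mem_erase]
      refine ⟨fun h => ?_, (hC w hw.1).2⟩
      have : w ∈ insert v τ := h ▸ Finset.mem_insert_self _ _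
      simp [hwv, hwτ] at this
    by_contra hR2
    obtain ⟨-, hr⟩ := hc.hr _ hmem hR2
    have hsd : insert w τ \ insert v D ⊆ {w} := by
      intro x hx
      simp only [Finset.mem_sdiff, Finset.mem_insert] at hx
      simp only [Finset.mem_singleton]
      rcases hx.1 with h | h
      · exact h
      · exact absurd (Or.inr (hτD h)) hx.2
    have hle := Finset.card_le_card hsd
    rw [Finset.card_singleton] at hle
    rcases hr with hr | ⟨u, hu, hr, _⟩
    · omega
    · have : v ∈ insert w τ := hr (Finset.mem_erase.2 ⟨fun h => hvτ (h ▸ hu), Finset.mem_insert_self _ _⟩)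
      simp [hwv.symm, hvτ] at this
  · have h1 : C ⊆ (C \ D2) ∪ (D2 \ D) := by
      intro w hw
      by_cases h : w ∈ D2
      · exact Finset.mem_union_right _ (Finset.mem_sdiff.2 ⟨h, (hC w hw).1⟩)
      · exact Finset.mem_union_left _ (Finset.mem_sdiff.2 ⟨hw, h⟩)
    have h2 := (Finset.card_le_card h1).trans (Finset.card_union_le _ _)
    have h3 := hc.hM
    rw [Finset.card_insert_of_notMem hv] at h3
    rw [Finset.card_sdiff_of_subset ((Finset.subset_insert _ _).trans hc.hD)] at h2
    omega

end

section

/-- expected value of `X` on the unexplored randomness -/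
def EX {n : ℕ} (p : ℝ) (X : Finset (Finset (Fin n)) → ℝ) (R F : Finset (Finset (Fin n))) : ENNReal :=
  ENNReal.ofReal (Ex R p (fun G => X (F ∪ G)))

/-- squared norm -/
def nsq {n : ℕ} (f : Finset (Fin n) → ℝ) : ENNReal := ENNReal.ofReal (∑ η, f η ^ 2)

open MeasureTheory in
/-- one-level exploration property -/
def Step (n d : ℕ) (p : ℝ) (H M : ℕ) (ε : ENNReal) (μ : Measure ENNReal)
    (X : Finset (Finset (Fin n)) → ℝ) : Prop :=
  ∀ (D τ : Finset (Fin n)) (R F0 : Finset (Finset (Fin n))) (φ : ENNReal → ENNReal), D.card ≤ H → Start d D R τ →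
    Measurable φ → (∀ D' R' F' f, Outc D R F0 τ M D' R' F' f → EX p X R' F' ≤ φ (nsq f)) →
    EX p X R F0 ≤ ∫⁻ x, φ x ∂μ + ε

open MeasureTheory in
lemma child_loop {n d : ℕ} {p : ℝ} {Hc Mk : ℕ} {ε : ENNReal} {μ : Measure ENNReal} [IsProbabilityMeasure μ]
    {X : Finset (Finset (Fin n)) → ℝ} (hS : Step n d p Hc Mk ε μ X)
    {D0 : Finset (Fin n)} {R0 F0 : Finset (Finset (Fin n))} {τ : Finset (Fin n)} {M : ℕ}
    (hst : Start d D0 R0 τ)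
    {D : Finset (Fin n)} {R F : Finset (Finset (Fin n))} {f : Finset (Fin n) → ℝ}
    (ho : Outc D0 R0 F0 τ M D R F f) {v : Fin n} (hv : v ∉ D) (hH : D.card + 1 + d * Mk ≤ Hc)
    {Ψ : ENNReal → ENNReal} (hΨm : Measurable Ψ)
    (hΨ : ∀ D2 R2 F2 g, Chld (insert v D) (R.erase (insert v τ)) (insert (insert v τ) F) (insert v τ) τ τ
      Mk D2 R2 F2 g → EX p X R2 F2 ≤ Ψ (nsq g)) (i : ℕ) :
    ∀ P, P ⊆ τ → (τ \ P).card = i → ∀ D2 R2 F2 g,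
      Chld (insert v D) (R.erase (insert v τ)) (insert (insert v τ) F) (insert v τ) τ P Mk D2 R2 F2 g →
      EX p X R2 F2 ≤ ∫⁻ y, Ψ (nsq g + y) ∂(cvp μ i) + i * ε := by
  have hτD : τ ⊆ D := hst.1.trans ho.hD
  have hvτ : v ∉ τ := fun h => hv (hτD h)
  induction i with
  | zero =>
    intro P hP hc D2 R2 F2 g hg
    have : P = τ := by
      apply Finset.Subset.antisymm hP
      rwa [Finset.card_eq_zero, Finset.sdiff_eq_empty_iff_subset] at hc
    subst this
    rw [lintegral_cvp_zero _ (by fun_prop)]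
    simpa using hΨ D2 R2 F2 g hg
  | succ i ih =>
    intro P hP hc D2 R2 F2 g hg
    obtain ⟨u, hu⟩ : (τ \ P).Nonempty := by rw [← Finset.card_pos, hc]; omega
    have hu' := Finset.mem_sdiff.1 hu
    have hcard : D2.card ≤ Hc := by
      have h1 := hg.hM
      rw [Finset.card_insert_of_notMem hv] at h1
      have h2 : P.card ≤ d := hst.2.1 ▸ Finset.card_le_card hP
      have := Nat.mul_le_mul_right Mk h2
      omega
    have key := hS D2 ((insert v τ).erase u) R2 F2
      (fun y => ∫⁻ z, Ψ (nsq g + y + z) ∂(cvp μ i) + i * ε) hcard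
      (Start_child hst ho hv hg hP hu'.1 hu'.2) (by fun_prop) ?_
    · refine key.trans (le_of_eq ?_)
      rw [lintegral_add_right _ measurable_const, lintegral_const, measure_univ, mul_one,
        lintegral_cvp_succ _ _ (by fun_prop)]
      simp_rw [add_assoc]
      push_cast
      ring
    · intro D' R' F' f' ho'
      have hve : (insert v τ).erase v = τ := Finset.erase_insert hvτ
      have hg2 : Chld (insert v D) (R.erase (insert v τ)) (insert (insert v τ) F) (insert v τ)
        ((insert v τ).erase v) P Mk D2 R2 F2 g := by rw [hve]; exact hg
      obtain ⟨h1, h2⟩ := Chld_step hg2 (Finset.mem_insert_self v τ) (Finset.insert_subset_insert _ hτD)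
        (hP.trans (Finset.subset_insert _ _)) (Finset.mem_insert_of_mem hu'.1) hu'.2 ho'
      rw [hve] at h1 h2
      have h3 := ih (insert u P) (Finset.insert_subset hu'.1 hP) ?_ _ _ _ _ h1
      · have e : nsq (g + cf τ (insert v τ) u • f') = nsq g + nsq f' := by
          unfold nsq
          rw [h2, ENNReal.ofReal_add (Finset.sum_nonneg fun _ _ => sq_nonneg _)
            (Finset.sum_nonneg fun _ _ => sq_nonneg _)]
        rw [e] at h3
        exact h3
      · have : τ \ insert u P = (τ \ P).erase u := by
          ext x; simp only [Finset.mem_sdiff, Finset.mem_insert, Finset.mem_erase]; tauto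
        rw [this, Finset.card_erase_of_mem hu, hc]; rfl

open MeasureTheory in
def Qf (ψ : ENNReal → ENNReal) (ν : Measure ENNReal) (p : ℝ) : ℕ → ℕ → ENNReal → ENNReal
  | 0 => fun B A => if B = 0 then 1 else ψ A
  | L + 1 => fun B A => if B = 0 then 1 else
      ENNReal.ofReal (1 - p) * Qf ψ ν p L B A + ENNReal.ofReal p * ∫⁻ s, Qf ψ ν p L (B - 1) (A + s) ∂ν

open MeasureTheory in
lemma Qf_zero (ψ : ENNReal → ENNReal) (ν : Measure ENNReal) (p : ℝ) (L : ℕ) (A : ENNReal) :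
    Qf ψ ν p L 0 A = 1 := by
  cases L <;> simp [Qf]

open MeasureTheory in
lemma Qf_meas {ψ : ENNReal → ENNReal} (hψ : Measurable ψ) (ν : Measure ENNReal) [IsProbabilityMeasure ν]
    (p : ℝ) (L : ℕ) : ∀ B, Measurable (Qf ψ ν p L B) := by
  induction L with
  | zero =>
    intro B
    by_cases h : B = 0
    · subst h; exact measurable_const
    · have : Qf ψ ν p 0 B = ψ := by funext A; simp [Qf, h]
      rw [this]; exact hψ
  | succ L ih =>
    intro B
    by_cases h : B = 0
    · subst h; exact measurable_const
    · have : Qf ψ ν p (L+1) B = fun A => ENNReal.ofReal (1 - p) * Qf ψ ν p L B A +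
          ENNReal.ofReal p * ∫⁻ s, Qf ψ ν p L (B - 1) (A + s) ∂ν := by funext A; simp [Qf, h]
      rw [this]
      have h1 := ih B
      have h2 := ih (B - 1)
      fun_prop

open MeasureTheory in
lemma outer_loop {n d : ℕ} (hd : 2 ≤ d) {p : ℝ} (hp0 : 0 ≤ p) (hp1 : p ≤ 1) {Hc Mk : ℕ} {ε : ENNReal}
    {μ : Measure ENNReal} [IsProbabilityMeasure μ]
    {X : Finset (Finset (Fin n)) → ℝ} (hX0 : ∀ F, 0 ≤ X F) (hX1 : ∀ F, X F ≤ 1) (hS : Step n d p Hc Mk ε μ X)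
    {D0 : Finset (Fin n)} {R0 F0 : Finset (Finset (Fin n))} {τ : Finset (Fin n)} {Bm : ℕ}
    (hst : Start d D0 R0 τ) (hH : D0.card + Bm * (1 + d * Mk) ≤ Hc)
    {ψ : ENNReal → ENNReal} (hψm : Measurable ψ)
    (hψ : ∀ D' R' F' f, Outc D0 R0 F0 τ (Bm * (1 + d * Mk)) D' R' F' f → EX p X R' F' ≤ ψ (nsq f)⁻¹) (L : ℕ) :
    ∀ B b D R F f (C : Finset (Fin n)), b + B = Bm → Outc D0 R0 F0 τ (b * (1 + d * Mk)) D R F f →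
      (∀ w ∈ C, w ∉ D ∧ insert w τ ∈ R) → L + B * (d * Mk) ≤ C.card →
      EX p X R F ≤ Qf ψ (nuOf d μ) p L B (nsq f)⁻¹ + B * (d * ε) := by
  have hone : ∀ R F, EX p X R F ≤ 1 := by
    intro R F
    unfold EX
    rw [ENNReal.ofReal_le_one]
    exact Ex_le_one hp0 hp1 fun G _ => hX1 _
  have hB0 : ∀ L b D R F f (C : Finset (Fin n)), b + 0 = Bm → Outc D0 R0 F0 τ (b * (1 + d * Mk)) D R F f →
      (∀ w ∈ C, w ∉ D ∧ insert w τ ∈ R) → L + 0 * (d * Mk) ≤ C.card →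
      EX p X R F ≤ Qf ψ (nuOf d μ) p L 0 (nsq f)⁻¹ + (0:ℕ) * (d * ε) := by
    intro L b D R F f C _ _ _ _
    rw [Qf_zero]
    exact (hone _ _).trans le_self_add
  induction L with
  | zero =>
    intro B b D R F f C hb ho hC hL
    rcases B with _ | B
    · exact hB0 0 b D R F f C hb ho hC hL
    · have : Qf ψ (nuOf d μ) p 0 (B+1) (nsq f)⁻¹ = ψ (nsq f)⁻¹ := by simp [Qf]
      rw [this]
      refine (hψ D R F f { ho with hM := ho.hM.trans ?_ }).trans le_self_add
      exact Nat.add_le_add_left (Nat.mul_le_mul_right _ (by omega)) _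
  | succ L ih =>
    intro B b D R F f C hb ho hC hL
    rcases B with _ | B
    · exact hB0 (L+1) b D R F f C hb ho hC hL
    have hτD : τ ⊆ D := hst.1.trans ho.hD
    have hτne : τ.Nonempty := by rw [← Finset.card_pos, hst.2.1]; omega
    obtain ⟨v, hvC⟩ : C.Nonempty := by rw [← Finset.card_pos]; omega
    obtain ⟨hvD, hvR⟩ := hC v hvC
    have hvτ : v ∉ τ := fun h => hvD (hτD h)
    -- not found
    have hA := ih (B+1) b D (R.erase (insert v τ)) F f (C.erase v) hb (Outc_notfound hst.1 ho hvD) ?_ ?_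
    rotate_left
    · intro w hw
      obtain ⟨hwv, hw⟩ := Finset.mem_erase.1 hw
      obtain ⟨h1, h2⟩ := hC w hw
      refine ⟨h1, Finset.mem_erase.2 ⟨fun h => ?_, h2⟩⟩
      have : w ∈ insert v τ := h ▸ Finset.mem_insert_self w τ
      rcases Finset.mem_insert.1 this with h | h
      · exact hwv h
      · exact h1 (hτD h)
    · rw [Finset.card_erase_of_mem hvC]; omega
    -- found
    have hQm := Qf_meas hψm (nuOf d μ) p L B
    have hBc := child_loop hS hst ho hvD (Ψ := fun s => Qf ψ (nuOf d μ) p L B ((nsq f)⁻¹ + s⁻¹) + B * (d * ε))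
      ?_ (by fun_prop) ?_ d ∅ (by simp) (by simpa using hst.2.1) _ _ _ _
      (Chld_zero (insert v D) (R.erase (insert v τ)) (insert (insert v τ) F) (insert v τ) τ Mk)
    rotate_left
    · have h1 := ho.hM
      have h2 : (b + 1) * (1 + d * Mk) ≤ Bm * (1 + d * Mk) := Nat.mul_le_mul_right _ (by omega)
      have h3 : (b + 1) * (1 + d * Mk) = b * (1 + d * Mk) + (1 + d * Mk) := by ring
      omega
    · intro D2 R2 F2 g hg
      obtain ⟨f', ho', hf'⟩ := Outc_found hst.1 hτne ho hvD hg
      obtain ⟨C', hC', hCc⟩ := Cand_found hτD hvD hg hC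
      rw [hst.2.1] at ho' hCc
      have := ih B (b+1) D2 R2 F2 f' C' (by omega) (by convert ho' using 1; ring) hC' ?_
      · have e : (nsq f')⁻¹ = (nsq f)⁻¹ + (nsq g)⁻¹ := by
          unfold nsq
          have hg0 := hg.hp hτne
          rw [← ENNReal.ofReal_inv_of_pos ho'.hp, ← ENNReal.ofReal_inv_of_pos ho.hp,
            ← ENNReal.ofReal_inv_of_pos hg0, hf', ENNReal.ofReal_add]
          · exact (inv_pos.2 ho.hp).le
          · exact (inv_pos.2 hg0).le
        rw [e] at this
        exact this
      · have : (B + 1) * (d * Mk) = B * (d * Mk) + d * Mk := by ring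
        omega
    have hz : nsq (0 : Finset (Fin n) → ℝ) = 0 := by simp [nsq]
    rw [hz] at hBc
    simp only [zero_add] at hBc
    rw [lintegral_add_right _ measurable_const, lintegral_const, measure_univ, mul_one,
      ← lintegral_nuOf d μ (f := fun s => Qf ψ (nuOf d μ) p L B ((nsq f)⁻¹ + s)) (by fun_prop)] at hBc
    have hsplit : EX p X R F = ENNReal.ofReal p * EX p X (R.erase (insert v τ)) (insert (insert v τ) F) +
        ENNReal.ofReal (1 - p) * EX p X (R.erase (insert v τ)) F := by
      unfold EX
      rw [Ex_erase hvR, ENNReal.ofReal_add, ENNReal.ofReal_mul hp0, ENNReal.ofReal_mul (by linarith)]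
      · simp only [Finset.union_insert, Finset.insert_union]
      · exact mul_nonneg hp0 (Ex_nonneg hp0 hp1 fun _ _ => hX0 _)
      · exact mul_nonneg (by linarith) (Ex_nonneg hp0 hp1 fun _ _ => hX0 _)
    have hQe : Qf ψ (nuOf d μ) p (L+1) (B+1) (nsq f)⁻¹ = ENNReal.ofReal (1 - p) * Qf ψ (nuOf d μ) p L (B+1) (nsq f)⁻¹
        + ENNReal.ofReal p * ∫⁻ s, Qf ψ (nuOf d μ) p L B ((nsq f)⁻¹ + s) ∂(nuOf d μ) := by simp [Qf]
    have hpp : ENNReal.ofReal p + ENNReal.ofReal (1 - p) = 1 := by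
      rw [← ENNReal.ofReal_add hp0 (by linarith)]; simp
    rw [hsplit, hQe]
    calc _ ≤ ENNReal.ofReal p * (∫⁻ s, Qf ψ (nuOf d μ) p L B ((nsq f)⁻¹ + s) ∂(nuOf d μ) + B * (d * ε) + d * ε) +
        ENNReal.ofReal (1 - p) * (Qf ψ (nuOf d μ) p L (B+1) (nsq f)⁻¹ + (B + 1 : ℕ) * (d * ε)) := by gcongr
      _ = ENNReal.ofReal (1 - p) * Qf ψ (nuOf d μ) p L (B+1) (nsq f)⁻¹
        + ENNReal.ofReal p * ∫⁻ s, Qf ψ (nuOf d μ) p L B ((nsq f)⁻¹ + s) ∂(nuOf d μ) +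
        (ENNReal.ofReal p + ENNReal.ofReal (1 - p)) * ((B + 1 : ℕ) * (d * ε)) := by push_cast; ring
      _ = _ := by rw [hpp, one_mul]

end

section

/-- binomial weights -/
def binw (p : ℝ) (L j : ℕ) : ℝ := (L.choose j : ℝ) * p ^ j * (1 - p) ^ (L - j)

lemma binw_nonneg {p : ℝ} (hp0 : 0 ≤ p) (hp1 : p ≤ 1) (L j : ℕ) : 0 ≤ binw p L j := by
  have : 0 ≤ 1 - p := by linarith
  unfold binw; positivity

lemma binw_succ_zero (p : ℝ) (L : ℕ) : binw p (L + 1) 0 = (1 - p) * binw p L 0 := by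
  simp [binw, pow_succ, mul_comm]

lemma binw_succ (p : ℝ) (L j : ℕ) : binw p (L + 1) (j + 1) = (1 - p) * binw p L (j + 1) + p * binw p L j := by
  unfold binw
  rw [Nat.choose_succ_succ', show L + 1 - (j + 1) = L - j by omega]
  push_cast
  by_cases h : j + 1 ≤ L
  · rw [show L - j = (L - (j + 1)) + 1 by omega]; ring
  · rw [Nat.choose_eq_zero_of_lt (show L < j + 1 by omega)]; push_cast; ring

lemma binw_le {p c : ℝ} {n L B j : ℕ} (hp0 : 0 ≤ p) (hp1 : p ≤ 1) (hn : p * n = c) (hL : L ≤ n) (hj : j ≤ B) :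
    binw p L j ≤ (Real.exp (-c) * c ^ j / j.factorial) * Real.exp (c - p * L + p * B) := by
  have hc : 0 ≤ c := by rw [← hn]; positivity
  by_cases h : j ≤ L
  · have h1 : (L.choose j : ℝ) * p ^ j ≤ c ^ j / j.factorial := by
      have := Nat.choose_le_pow_div (α := ℝ) j L
      calc (L.choose j : ℝ) * p ^ j ≤ ((L:ℝ) ^ j / j.factorial) * p ^ j := by gcongr
        _ ≤ ((n:ℝ) ^ j / j.factorial) * p ^ j := by gcongr
        _ = c ^ j / j.factorial := by rw [← hn, mul_pow]; ring
    have h2 : (1 - p) ^ (L - j) ≤ Real.exp (- p * L + p * B) := by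
      have h3 : 1 - p ≤ Real.exp (-p) := by have := Real.add_one_le_exp (-p); linarith
      calc (1 - p) ^ (L - j) ≤ Real.exp (-p) ^ (L - j) := pow_le_pow_left₀ (by linarith) h3 _
        _ = Real.exp (((L:ℝ) - j) * (-p)) := by rw [← Real.exp_nat_mul]; push_cast [h]; rfl
        _ ≤ _ := by
          apply Real.exp_le_exp.2
          have : (j:ℝ) ≤ B := by exact_mod_cast hj
          nlinarith
    have h0 : 0 ≤ (1 - p) ^ (L - j) := pow_nonneg (by linarith) _
    calc binw p L j ≤ (c ^ j / j.factorial) * Real.exp (- p * L + p * B) := by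
          unfold binw; gcongr
      _ = (c ^ j / j.factorial) * (Real.exp (-c) * Real.exp (c - p * L + p * B)) := by
          rw [← Real.exp_add]; congr 2; ring
      _ = _ := by ring
  · unfold binw
    rw [Nat.choose_eq_zero_of_lt (by omega)]
    simp only [Nat.cast_zero, zero_mul]
    positivity

open MeasureTheory in
lemma Qf_le {ψ : ENNReal → ENNReal} (hψ : Measurable ψ) (ν : Measure ENNReal) [IsProbabilityMeasure ν]
    {p : ℝ} (hp0 : 0 ≤ p) (hp1 : p ≤ 1) (L : ℕ) : ∀ B A, Qf ψ ν p L B A ≤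
      ∑ j ∈ Finset.range B, ENNReal.ofReal (binw p L j) * ∫⁻ z, ψ (A + z) ∂(cvp ν j) +
        ENNReal.ofReal (L.choose B * p ^ B) := by
  have hq : 0 ≤ 1 - p := by linarith
  induction L with
  | zero =>
    intro B A
    rcases B with _ | B
    · simp [Qf]
    · have : Qf ψ ν p 0 (B+1) A = ψ A := by simp [Qf]
      rw [this, Finset.sum_range_succ']
      refine le_trans ?_ (le_self_add)
      refine le_trans ?_ (le_add_self)
      rw [lintegral_cvp_zero _ (by fun_prop)]
      simp [binw]
  | succ L ih =>
    intro B A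
    rcases B with _ | B
    · simp [Qf_zero]
    have e : Qf ψ ν p (L+1) (B+1) A = ENNReal.ofReal (1 - p) * Qf ψ ν p L (B+1) A
        + ENNReal.ofReal p * ∫⁻ s, Qf ψ ν p L B (A + s) ∂ν := by simp [Qf]
    rw [e]
    have h2 : ∫⁻ s, Qf ψ ν p L B (A + s) ∂ν ≤
        ∑ j ∈ Finset.range B, ENNReal.ofReal (binw p L j) * ∫⁻ z, ψ (A + z) ∂(cvp ν (j+1)) +
        ENNReal.ofReal (L.choose B * p ^ B) := by
      refine (lintegral_mono fun s => ih B (A + s)).trans (le_of_eq ?_)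
      rw [lintegral_add_right _ measurable_const, lintegral_const, measure_univ, mul_one,
        lintegral_finsetSum _ (fun j _ => by fun_prop)]
      congr 1
      refine Finset.sum_congr rfl fun j _ => ?_
      rw [lintegral_const_mul _ (by fun_prop), lintegral_cvp_succ _ _ (by fun_prop)]
      simp_rw [add_assoc]
    have h1 := ih (B+1) A
    rw [Finset.sum_range_succ'] at h1
    rw [Finset.sum_range_succ']
    have e1 : ENNReal.ofReal (binw p (L+1) 0) = ENNReal.ofReal (1 - p) * ENNReal.ofReal (binw p L 0) := by
      rw [binw_succ_zero, ENNReal.ofReal_mul hq]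
    have e2 : ∀ j, ENNReal.ofReal (binw p (L+1) (j+1)) = ENNReal.ofReal (1 - p) * ENNReal.ofReal (binw p L (j+1))
        + ENNReal.ofReal p * ENNReal.ofReal (binw p L j) := by
      intro j
      rw [binw_succ, ENNReal.ofReal_add (mul_nonneg hq (binw_nonneg hp0 hp1 _ _))
        (mul_nonneg hp0 (binw_nonneg hp0 hp1 _ _)), ENNReal.ofReal_mul hq, ENNReal.ofReal_mul hp0]
    have e3 : ENNReal.ofReal (1 - p) * ENNReal.ofReal (L.choose (B+1) * p ^ (B+1)) +
        ENNReal.ofReal p * ENNReal.ofReal (L.choose B * p ^ B) ≤ ENNReal.ofReal ((L+1).choose (B+1) * p ^ (B+1)) := by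
      rw [← ENNReal.ofReal_mul hq, ← ENNReal.ofReal_mul hp0, ← ENNReal.ofReal_add (by positivity) (by positivity)]
      apply ENNReal.ofReal_le_ofReal
      rw [Nat.choose_succ_succ']
      push_cast
      have e4 : p * (L.choose B * p ^ B) = L.choose B * p ^ (B+1) := by ring
      have : 0 ≤ p * ((L.choose (B+1):ℝ) * p ^ (B+1)) := by positivity
      nlinarith
    simp_rw [e1, e2, add_mul]
    rw [Finset.sum_add_distrib]
    set I : ℕ → ENNReal := fun j => ∫⁻ z, ψ (A + z) ∂(cvp ν j) with hI
    calc _ ≤ ENNReal.ofReal (1 - p) * (∑ j ∈ Finset.range B, ENNReal.ofReal (binw p L (j+1)) * I (j+1) +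
          ENNReal.ofReal (binw p L 0) * I 0 + ENNReal.ofReal (L.choose (B+1) * p ^ (B+1))) +
          ENNReal.ofReal p * (∑ j ∈ Finset.range B, ENNReal.ofReal (binw p L j) * I (j+1) +
            ENNReal.ofReal (L.choose B * p ^ B)) := by gcongr
      _ = (∑ j ∈ Finset.range B, ENNReal.ofReal (1 - p) * ENNReal.ofReal (binw p L (j+1)) * I (j+1) +
           ∑ j ∈ Finset.range B, ENNReal.ofReal p * ENNReal.ofReal (binw p L j) * I (j+1) +
           ENNReal.ofReal (1 - p) * ENNReal.ofReal (binw p L 0) * I 0) +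
           (ENNReal.ofReal (1 - p) * ENNReal.ofReal (L.choose (B+1) * p ^ (B+1)) +
            ENNReal.ofReal p * ENNReal.ofReal (L.choose B * p ^ B)) := by
          simp_rw [mul_add, Finset.mul_sum, mul_assoc]; ring
      _ ≤ _ := by gcongr

/-- the exploration claim at depth `k` -/
def Claim (c : ℝ) (d k : ℕ) : Prop := ∀ ε : ℝ, 0 < ε → ∃ M : ℕ, ∀ H : ℕ, ∃ N : ℕ, ∀ n : ℕ, N ≤ n →
  ∀ X : Finset (Finset (Fin n)) → ℝ, (∀ F, 0 ≤ X F) → (∀ F, X F ≤ 1) →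
    Step n d (c / n) H M (ENNReal.ofReal ε) (muk c d k) X

lemma Outc_init {n : ℕ} (D τ : Finset (Fin n)) (R F : Finset (Finset (Fin n))) (M : ℕ) :
    Outc D R F τ M D R F (Pi.single τ 1) ∧ nsq (Pi.single τ 1 : Finset (Fin n) → ℝ) = 1 := by
  have hs : ∑ η, (Pi.single τ 1 : Finset (Fin n) → ℝ) η ^ 2 = 1 := by
    rw [Finset.sum_eq_single τ]
    · simp
    · intro b _ hb; simp [hb]
    · simp
  refine ⟨⟨le_rfl, by simp, le_rfl, le_rfl, by simp, ?_, ?_, by rw [hs]; norm_num⟩, by simp [nsq, hs]⟩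
  · intro η h
    left
    by_contra hne
    exact h (by simp [hne])
  · intro ρ h h'; exact absurd h h'

open MeasureTheory in
lemma Claim_zero (c : ℝ) (d : ℕ) : Claim c d 0 := by
  intro ε hε
  refine ⟨0, fun H => ⟨0, fun n _ X _ _ D τ R F0 φ _ _ hφ h => ?_⟩⟩
  obtain ⟨h1, h2⟩ := Outc_init D τ R F0 0
  have := h _ _ _ _ h1
  rw [h2] at this
  refine this.trans ?_
  show _ ≤ ∫⁻ x, φ x ∂(Measure.dirac 1) + _
  rw [lintegral_dirac' _ hφ]
  exact le_self_add

open MeasureTheory in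
lemma Claim_succ {c : ℝ} (hc : 0 < c) {d : ℕ} (hd : 2 ≤ d) {k : ℕ} (hk : Claim c d k) : Claim c d (k + 1) := by
  intro ε hε
  have hprob := muk_prob hc.le d k
  -- choose `B`
  obtain ⟨B, hB⟩ : ∃ B : ℕ, c ^ B / B.factorial ≤ ε / 3 := by
    have := (FloorSemiring.tendsto_pow_div_factorial_atTop c).eventually (gt_mem_nhds (show 0 < ε/3 by positivity))
    obtain ⟨B, hB⟩ := this.exists
    exact ⟨B, hB.le⟩
  obtain ⟨Mk, hMk⟩ := hk (ε / (3 * (B * d + 1))) (by positivity)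
  refine ⟨B * (1 + d * Mk), fun H => ?_⟩
  obtain ⟨N1, hN1⟩ := hMk (H + B * (1 + d * Mk))
  set K : ℕ := H + B * (d * Mk) + B with hK
  obtain ⟨N2, hN2⟩ : ∃ N2 : ℕ, ∀ n : ℕ, N2 ≤ n → Real.exp (c / n * K) ≤ 1 + ε / 3 := by
    have h1 : Tendsto (fun n : ℕ => Real.exp (c / n * K)) atTop (nhds (Real.exp (0 * K))) :=
      (Real.continuous_exp.tendsto _).comp ((tendsto_const_div_atTop_nhds_zero_nat c).mul_const _)
    have h2 := h1.eventually (gt_mem_nhds (show Real.exp (0 * K) < 1 + ε/3 by rw [zero_mul, Real.exp_zero]; linarith))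
    obtain ⟨N, hN⟩ := eventually_atTop.1 h2
    exact ⟨N, fun n hn => (hN n hn).le⟩
  obtain ⟨N3, hN3⟩ := exists_nat_ge c
  refine ⟨N1 + N2 + N3 + K + 1, fun n hn X hX0 hX1 D τ R F0 φ hD hst hφ h => ?_⟩
  have hn0 : (0:ℝ) < n := by have : 0 < n := by omega
                             exact_mod_cast this
  set p := c / n with hp
  have hp0 : 0 ≤ p := by positivity
  have hcn : c ≤ n := hN3.trans (by exact_mod_cast (by omega : N3 ≤ n))
  have hp1 : p ≤ 1 := by rw [hp, div_le_one hn0]; exact hcn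
  have hpn : p * n = c := by rw [hp]; field_simp
  have hS := hN1 n (by omega) X hX0 hX1
  set ψ : ENNReal → ENNReal := fun a => min (φ a⁻¹) 1 with hψ
  have hψm : Measurable ψ := by fun_prop
  obtain ⟨i1, i2⟩ := Outc_init D τ R F0 (0 * (1 + d * Mk))
  set L := n - (H + B * (d * Mk)) with hL
  have hout := outer_loop hd hp0 hp1 hX0 hX1 hS hst (Bm := B) (by omega) hψm ?_ L B 0 D R F0 _ (Finset.univ \ D)
    (by omega) i1 ?_ ?_
  rotate_left
  · intro D' R' F' f ho
    rw [hψ]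
    simp only [inv_inv]
    refine le_min (h D' R' F' f ho) ?_
    unfold EX
    rw [ENNReal.ofReal_le_one]
    exact Ex_le_one hp0 hp1 fun G _ => hX1 _
  · intro w hw
    have : w ∉ D := (Finset.mem_sdiff.1 hw).2
    exact ⟨this, hst.2.2.1 w this⟩
  · rw [Finset.card_sdiff_of_subset (Finset.subset_univ _), Finset.card_univ, Fintype.card_fin]
    omega
  rw [i2, inv_one] at hout
  refine hout.trans ?_
  -- main estimate
  have hQ := Qf_le hψm (nuOf d (muk c d k)) hp0 hp1 L B 1
  have hLn : (L:ℝ) = n - (H + B * (d * Mk)) := by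
    rw [hL, Nat.cast_sub (by omega)]; push_cast; ring
  have hexp : Real.exp (c - p * L + p * B) ≤ 1 + ε / 3 := by
    have e : c - p * L + p * B = c / n * K := by
      rw [hLn, hK, ← hp, ← hpn]; push_cast; ring
    rw [e]; exact hN2 n (by omega)
  have hw : ∀ j ∈ Finset.range B, ENNReal.ofReal (binw p L j) ≤ pois c j * ENNReal.ofReal (1 + ε/3) := by
    intro j hj
    unfold pois
    rw [← ENNReal.ofReal_mul (by positivity)]
    apply ENNReal.ofReal_le_ofReal
    refine (binw_le hp0 hp1 hpn (by omega) (Finset.mem_range.1 hj).le).trans ?_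
    gcongr
  have htail : ENNReal.ofReal (L.choose B * p ^ B) ≤ ENNReal.ofReal (ε/3) := by
    apply ENNReal.ofReal_le_ofReal
    refine le_trans ?_ hB
    have h1 := Nat.choose_le_pow_div (α := ℝ) B L
    have h2 : (L:ℝ) ≤ n := by exact_mod_cast (by omega : L ≤ n)
    calc (L.choose B : ℝ) * p ^ B ≤ ((L:ℝ) ^ B / B.factorial) * p ^ B := by gcongr
      _ ≤ ((n:ℝ) ^ B / B.factorial) * p ^ B := by gcongr
      _ = c ^ B / B.factorial := by rw [← hpn, mul_pow]; ring
  set J : ENNReal := ∑' j, pois c j * ∫⁻ z, ψ (1 + z) ∂(cvp (nuOf d (muk c d k)) j) with hJ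
  have hsum : ∑ j ∈ Finset.range B, ENNReal.ofReal (binw p L j) * ∫⁻ z, ψ (1 + z) ∂(cvp (nuOf d (muk c d k)) j) ≤
      ENNReal.ofReal (1 + ε/3) * J := by
    rw [hJ, ← ENNReal.tsum_mul_left]
    refine le_trans (Finset.sum_le_sum fun j hj => ?_) (ENNReal.sum_le_tsum (Finset.range B))
    refine (mul_le_mul_left (hw j hj) _).trans (le_of_eq (by ring))
  have hJ1 : J ≤ 1 := by
    rw [hJ]
    refine (ENNReal.tsum_le_tsum fun j => ?_).trans_eq (tsum_pois hc.le)
    have : ∫⁻ z, ψ (1 + z) ∂(cvp (nuOf d (muk c d k)) j) ≤ 1 := by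
      refine (lintegral_mono (g := fun _ => 1) fun z => min_le_right _ _).trans ?_
      simp
    exact mul_le_of_le_one_right' this
  have hJ2 : J ≤ ∫⁻ x, φ x ∂(muk c d (k+1)) := by
    show _ ≤ ∫⁻ x, φ x ∂(Lam c d (muk c d k))
    rw [lintegral_Lam _ _ _ hφ, hJ]
    refine ENNReal.tsum_le_tsum fun j => mul_le_mul_right (lintegral_mono fun z => min_le_left _ _) _
  have hchild : (B:ENNReal) * (d * ENNReal.ofReal (ε / (3 * (B * d + 1)))) ≤ ENNReal.ofReal (ε / 3) := by
    rw [← ENNReal.ofReal_natCast B, ← ENNReal.ofReal_natCast d, ← ENNReal.ofReal_mul (by positivity),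
      ← ENNReal.ofReal_mul (by positivity)]
    apply ENNReal.ofReal_le_ofReal
    rw [← sub_nonneg]
    have : ε / 3 - B * (d * (ε / (3 * (B * d + 1)))) = ε / (3 * (B * d + 1)) := by field_simp; ring
    rw [this]; positivity
  calc _ ≤ (ENNReal.ofReal (1 + ε/3) * J + ENNReal.ofReal (ε/3)) + ENNReal.ofReal (ε / 3) := by
        gcongr
        exact hQ.trans (add_le_add hsum htail)
    _ ≤ (J + ENNReal.ofReal (ε/3)) + ENNReal.ofReal (ε/3) + ENNReal.ofReal (ε/3) := by
        gcongr
        rw [ENNReal.ofReal_add (by norm_num) (by positivity), add_mul, ENNReal.ofReal_one, one_mul]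
        gcongr
        exact (mul_le_mul_right hJ1 _).trans (by simp)
    _ = J + ENNReal.ofReal ε := by
        rw [add_assoc, add_assoc, ← ENNReal.ofReal_add (by positivity) (by positivity),
          ← ENNReal.ofReal_add (by positivity) (by positivity)]
        congr 2; ring
    _ ≤ _ := by gcongr

lemma Claim_all {c : ℝ} (hc : 0 < c) {d : ℕ} (hd : 2 ≤ d) (k : ℕ) : Claim c d k := by
  induction k with
  | zero => exact Claim_zero c d
  | succ k ih => exact Claim_succ hc hd ih

open MeasureTheory in
lemma Ex_dist2_le {c : ℝ} (hc : 0 < c) {d : ℕ} (hd : 2 ≤ d) (k : ℕ) {ε : ℝ} (hε : 0 < ε) :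
    ∃ N : ℕ, ∀ n : ℕ, N ≤ n → ∀ τ : Finset (Fin n), τ.card = d →
      ENNReal.ofReal (Ex (allFaces n d) (c / n) (dist2 τ)) ≤ ∫⁻ x, x ∂(muk c d k) + ENNReal.ofReal ε := by
  obtain ⟨M, hM⟩ := Claim_all hc hd k ε hε
  obtain ⟨N, hN⟩ := hM d
  obtain ⟨N3, hN3⟩ := exists_nat_ge c
  refine ⟨N + N3 + 1, fun n hn τ hτ => ?_⟩
  have hn0 : (0:ℝ) < n := by have : 0 < n := by omega
                             exact_mod_cast this
  have hp0 : 0 ≤ c / n := by positivity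
  have hcn : c ≤ n := hN3.trans (by exact_mod_cast (by omega : N3 ≤ n))
  have hp1 : c / n ≤ 1 := by rw [div_le_one hn0]; exact hcn
  have hS := hN n (by omega) (dist2 τ) (fun F => dist2_nonneg τ F) (fun F => dist2_le_one τ F) τ τ (allFaces n d) ∅
    (fun x => x) hτ.le ?_ measurable_id ?_
  · simpa [EX] using hS
  · refine ⟨le_rfl, hτ, ?_, ?_⟩
    · intro v hv
      simp [allFaces, Finset.card_insert_of_notMem hv, hτ]
    · intro σ h1 _
      simp [allFaces, h1]
  · intro D' R' F' f ho
    unfold EX nsq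
    apply ENNReal.ofReal_le_ofReal
    refine (Ex_mono (Y := fun _ => ∑ η, f η ^ 2) hp0 hp1 fun G _ => ?_).trans (le_of_eq (Ex_const _ _ _))
    exact dist2_le τ _ f (bspan_mono Finset.subset_union_left ho.hf)

end

section

open MeasureTheory in
lemma muk_mean_pos {c : ℝ} (hc : 0 ≤ c) (d k : ℕ) : ∫⁻ x, x ∂(muk c d k) ≠ 0 := by
  rcases k with _ | k
  · show ∫⁻ x, id x ∂(Measure.dirac 1) ≠ 0
    rw [lintegral_dirac' _ measurable_id]; exact one_ne_zero
  · have := muk_prob hc d k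
    show ∫⁻ x, id x ∂(Lam c d (muk c d k)) ≠ 0
    rw [lintegral_Lam _ _ _ measurable_id]
    have h := ENNReal.le_tsum (f := fun j => pois c j * ∫⁻ z, (1 + z)⁻¹ ∂(cvp (nuOf d (muk c d k)) j)) 0
    intro h0
    have h1 : pois c 0 * ∫⁻ z, (1 + z)⁻¹ ∂(cvp (nuOf d (muk c d k)) 0) ≤ 0 := by
      rw [← h0]; exact h
    rw [lintegral_cvp_zero _ (by fun_prop)] at h1
    simp [pois] at h1
    linarith [Real.exp_pos (-c)]

lemma Ex_simplex_le {n d : ℕ} {c : ℝ} (hc : 0 ≤ c) :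
    Ex (allFaces n d) (c / n) (fun F => ((simplexBoundaries n d F).card : ℝ)) ≤ c ^ (d + 2) := by
  have e : ∀ F : Finset (Finset (Fin n)), ((simplexBoundaries n d F).card : ℝ) =
      ∑ τ ∈ Finset.powersetCard (d + 2) (Finset.univ : Finset (Fin n)),
        if Finset.powersetCard (d + 1) τ ⊆ F then 1 else 0 := by
    intro F
    rw [Finset.sum_boole]
    congr 2
    ext τ
    simp only [simplexBoundaries, Finset.mem_filter, Finset.mem_univ, true_and, Finset.mem_powersetCard,
      Finset.subset_univ, Finset.mem_powerset]
    refine and_congr Iff.rfl ⟨fun h s hs => ?_, fun h s h1 h2 => h (Finset.mem_powersetCard.2 ⟨h1, h2⟩)⟩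
    obtain ⟨h1, h2⟩ := Finset.mem_powersetCard.1 hs
    exact h s h1 h2
  simp_rw [e]
  rw [Ex_sum]
  have h2 : ∀ τ ∈ Finset.powersetCard (d + 2) (Finset.univ : Finset (Fin n)),
      Ex (allFaces n d) (c / n) (fun F => if Finset.powersetCard (d + 1) τ ⊆ F then (1:ℝ) else 0) =
        (c / n) ^ (d + 2) := by
    intro τ hτ
    rw [Ex_subset]
    · rw [Finset.card_powersetCard, (Finset.mem_powersetCard.1 hτ).2, Nat.choose_succ_self_right]
    · intro s hs
      simp [allFaces, (Finset.mem_powersetCard.1 hs).2]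
  rw [Finset.sum_congr rfl h2, Finset.sum_const, Finset.card_powersetCard, Finset.card_univ, Fintype.card_fin,
    nsmul_eq_mul]
  have h3 : ((n.choose (d+2) : ℕ) : ℝ) ≤ (n:ℝ) ^ (d+2) := by exact_mod_cast Nat.choose_le_pow n (d+2)
  calc _ ≤ (n:ℝ) ^ (d+2) * (c / n) ^ (d+2) := by gcongr
    _ = (n * (c / n)) ^ (d+2) := by rw [mul_pow]
    _ ≤ c ^ (d+2) := by
      gcongr
      by_cases hn : (n:ℝ) = 0
      · rw [hn]; simpa using hc
      · exact le_of_eq (by field_simp)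

lemma Ex_dimKer_small {d : ℕ} (hd : 2 ≤ d) {c td : ℝ} (hc0 : 0 < c)
    (htd : td ∈ Set.Ioo (0 : ℝ) 1)
    (hroot : ((d : ℝ) + 1) * (1 - td) + (1 + (d : ℝ) * td) * Real.log td = 0)
    (hc : c < -Real.log td / (1 - td) ^ d) {η : ℝ} (hη : 0 < η) :
    ∃ N : ℕ, ∀ n : ℕ, N ≤ n → Ex (allFaces n d) (c / n) (fun F => (dimKer n F : ℝ)) ≤ η * n ^ d := by
  obtain ⟨k, hk⟩ := muk_limit hd hc0 htd hroot hc (half_pos hη)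
  obtain ⟨N, hN⟩ := Ex_dist2_le hc0 hd k (half_pos hη)
  obtain ⟨N3, hN3⟩ := exists_nat_ge c
  have hpos : 0 < 1 - c / (d + 1) + η / 2 := by
    by_contra h
    rw [ENNReal.ofReal_of_nonpos (not_lt.1 h)] at hk
    exact muk_mean_pos hc0.le d k (le_antisymm hk (zero_le))
  refine ⟨N + N3 + 1, fun n hn => ?_⟩
  have hn0 : (0:ℝ) < n := by have : 0 < n := by omega
                             exact_mod_cast this
  have hp0 : 0 ≤ c / n := by positivity
  have hcn : c ≤ n := hN3.trans (by exact_mod_cast (by omega : N3 ≤ n))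
  have hp1 : c / n ≤ 1 := by rw [div_le_one hn0]; exact hcn
  have h1 := Ex_dimKer_le (n := n) (d := d) (b := 1 - c / (d + 1) + η) hp0 hp1 (fun τ hτ => by
    have h2 := (hN n (by omega) τ hτ).trans (add_le_add_left hk _)
    rw [← ENNReal.ofReal_add hpos.le (half_pos hη).le,
      ENNReal.ofReal_le_ofReal_iff (by linarith)] at h2
    linarith)
  refine h1.trans ?_
  have h3 : ((n.choose (d+1) : ℕ) : ℝ) * (d + 1) ≤ n.choose d * n := by
    have := Nat.choose_succ_right_eq n d
    have h4 : n.choose (d+1) * (d+1) ≤ n.choose d * n := by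
      rw [this]; exact Nat.mul_le_mul_left _ (Nat.sub_le _ _)
    exact_mod_cast h4
  have h4 : c / n * (n.choose (d+1)) ≤ n.choose d * (c / (d+1)) := by
    rw [div_mul_eq_mul_div, mul_div_assoc', div_le_div_iff₀ hn0 (by positivity)]
    nlinarith
  have h5 : ((n.choose d : ℕ) : ℝ) ≤ (n:ℝ) ^ d := by exact_mod_cast Nat.choose_le_pow n d
  have : η * (n.choose d : ℝ) ≤ η * n ^ d := by gcongr
  linarith

theorem main_thm (d : ℕ) (hd : 2 ≤ d) (c td : ℝ) (hc0 : 0 < c)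
    (htd : td ∈ Set.Ioo (0 : ℝ) 1)
    (hroot : ((d : ℝ) + 1) * (1 - td) + (1 + (d : ℝ) * td) * Real.log td = 0)
    (hc : c < -Real.log td / (1 - td) ^ d) :
    ∀ ε > 0, ∃ K : ℕ, ∃ N : ℕ, ∀ n ≥ N,
      1 - ε ≤ probY n d (c / n) (fun F =>
        (simplexBoundaries n d F).card ≤ K ∧
        LinearMap.ker (boundaryMap n F) =
          Submodule.span ℝ (simplexCycle n F '' ↑(simplexBoundaries n d F))) := by
  intro ε hε
  obtain ⟨c', hcc', hc'⟩ := exists_between hc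
  have hc'0 : 0 < c' := hc0.trans hcc'
  obtain ⟨δ, hδ, hcore⟩ := no_small_cores hd hc0
  obtain ⟨N1, hN1⟩ := hcore (ε/3) (by positivity)
  obtain ⟨N2, hN2⟩ := Ex_dimKer_small hd hc'0 htd hroot hc' (η := ε * δ * (c' - c) / (3 * c))
    (by have : 0 < c' - c := by linarith
        positivity)
  obtain ⟨K, hK⟩ := exists_nat_ge (c ^ (d+2) / (ε/3))
  obtain ⟨N3, hN3⟩ := exists_nat_ge c'
  refine ⟨K, N1 + N2 + N3 + 1, fun n hn => ?_⟩
  have hn0 : (0:ℝ) < n := by have : 0 < n := by omega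
                             exact_mod_cast this
  have hp0 : 0 ≤ c / n := by positivity
  have hcn : c' ≤ n := hN3.trans (by exact_mod_cast (by omega : N3 ≤ n))
  have hp1' : c' / n ≤ 1 := by rw [div_le_one hn0]; exact hcn
  have hpp : c / n < c' / n := by gcongr
  have hp1 : c / n ≤ 1 := hpp.le.trans hp1'
  have hB : Pr (allFaces n d) (c/n) (fun F => δ * n ^ d ≤ ((UU F).card : ℝ)) ≤ ε / 3 := by
    have h1 := Ex_UU_le (n := n) (d := d) hp0 hpp hp1'
    have h2 := hN2 n (by omega)
    have h3 : (c' - c) * Ex (allFaces n d) (c/n) (fun F => ((UU F).card : ℝ)) ≤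
        c * (ε * δ * (c' - c) / (3 * c) * n ^ d) := by
      have h4 := mul_le_mul_of_nonneg_left h2 hp0
      have h5 := mul_le_mul_of_nonneg_left (h1.trans h4) hn0.le
      have e1 : (n:ℝ) * ((c' / n - c / n) * Ex (allFaces n d) (c/n) (fun F => ((UU F).card : ℝ))) =
        (c' - c) * Ex (allFaces n d) (c/n) (fun F => ((UU F).card : ℝ)) := by field_simp
      have e2 : (n:ℝ) * (c / n * (ε * δ * (c' - c) / (3 * c) * n ^ d)) =
        c * (ε * δ * (c' - c) / (3 * c) * n ^ d) := by field_simp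
      rwa [e1, e2] at h5
    have h6 : Ex (allFaces n d) (c/n) (fun F => ((UU F).card : ℝ)) ≤ ε / 3 * (δ * n ^ d) := by
      have e3 : c * (ε * δ * (c' - c) / (3 * c) * n ^ d) = (c' - c) * (ε / 3 * (δ * n ^ d)) := by field_simp
      rw [e3] at h3
      exact le_of_mul_le_mul_left h3 (by linarith)
    refine (Pr_markov hp0 hp1 (fun F _ => by positivity) (by positivity)).trans ?_
    rw [div_le_iff₀ (by positivity)]
    exact h6
  have hA : Pr (allFaces n d) (c/n) (fun F => (K:ℝ) + 1 ≤ ((simplexBoundaries n d F).card : ℝ)) ≤ ε / 3 := by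
    refine (Pr_markov hp0 hp1 (fun F _ => by positivity) (by positivity)).trans ?_
    rw [div_le_iff₀ (by positivity)]
    refine (Ex_simplex_le hc0.le).trans ?_
    rw [div_le_iff₀ (by positivity)] at hK
    nlinarith
  rw [probY_eq]
  refine le_trans ?_ (Pr_three hp0 hp1 (A := fun F => (K:ℝ) + 1 ≤ ((simplexBoundaries n d F).card : ℝ))
    (B := fun F => δ * n ^ d ≤ ((UU F).card : ℝ))
    (C := fun F => ∃ A ⊆ F, A.Nonempty ∧ isCore A ∧ noSimplex d A ∧ (A.card : ℝ) ≤ δ * n ^ d) ?_)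
  · have := hN1 n (by omega)
    linarith
  · intro F hF h1 h2 h3
    refine ⟨?_, ?_⟩
    · by_contra h
      apply h1
      exact_mod_cast (by omega : K + 1 ≤ (simplexBoundaries n d F).card)
    · by_contra h
      obtain ⟨A, hA1, hA2, hA3, hA4⟩ := reduction hF h
      refine h3 ⟨A, hA1.trans (Finset.filter_subset _ _), hA2, hA3, hA4, ?_⟩
      have : (A.card : ℝ) ≤ (UU F).card := by exact_mod_cast Finset.card_le_card hA1
      linarith [not_le.1 h2]

end

/-- For `d ≥ 2` and `0 < c < c_d^*`, for every `ε > 0` there is a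
constant `K` such that for all large `n`, with probability at least `1 - ε` over
`Y = Y_d(n, c/n)`: the number of `(d+2)`-subsets of `[n]` all of whose `(d+1)`-subsets
are faces of `Y` is at most `K`, and `ker ∂_d(Y) = H_d(Y;ℝ)` is spanned by the
boundary cycles of these `(d+2)`-subsets. -/
theorem statement0 (d : ℕ) (hd : 2 ≤ d) (c td : ℝ) (hc0 : 0 < c)
    (htd : td ∈ Set.Ioo (0 : ℝ) 1)
    (hroot : ((d : ℝ) + 1) * (1 - td) + (1 + (d : ℝ) * td) * Real.log td = 0)
    (hc : c < -Real.log td / (1 - td) ^ d) :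
    ∀ ε > 0, ∃ K : ℕ, ∃ N : ℕ, ∀ n ≥ N,
      1 - ε ≤ probY n d (c / n) (fun F =>
        (simplexBoundaries n d F).card ≤ K ∧
        LinearMap.ker (boundaryMap n F) =
          Submodule.span ℝ (simplexCycle n F '' ↑(simplexBoundaries n d F))) := by
  exact main_thm d hd c td hc0 htd hroot hc

end
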